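/- Involution property of the self-translation (value-term part): suppose R̲ is either a computation-type constant or the type I̲. If Γ ⊢ t : A is derivable in EEC, then Γ ⊢ t = ι_A((tᶜ)ᶜ)[ι⁻¹(Γ)] : A in the equational theory of EEC, where [ι⁻¹(Γ)] denotes the substitution replacing each variable xᵢ:Cᵢ of Γ by ι_{Cᵢ}⁻¹(xᵢ). -/

import Mathlib

set_option autoImplicit false

namespace EEC

/-! # The enriched effect calculus (EEC)

A deep embedding of the enriched effect calculus of Egger, Møgelberg and
Simpson: value types and computation types, raw terms (de Bruijn indices for
value variables, together with a designated stoup variable `svar`), typing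
derivations with an (at most singleton) stoup, the βη-equational theory, the
simply-typed λ-calculus together with βη-equality and Moggi's computational
λ-calculus equality, the standard cbv/cbn translations of typed λ-calculus
into EEC, Hasegawa's linear-use CPS translations, and the generic linear-use
CPS self-translation of EEC. -/

mutual
  /-- Value types of EEC. -/
  inductive VType : Type
    | base : ℕ → VType                 -- value type constants α
    | unit : VType                     -- 1
    | prod : VType → VType → VType     -- A × B
    | arr : VType → VType → VType      -- A → B
    | comp : CType → VType             -- every computation type is a value type
    | lin : CType → CType → VType      -- A̲ ⊸ B̲
  /-- Computation types of EEC. -/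
  inductive CType : Type
    | base : ℕ → CType                 -- computation type constants α̲
    | cunit : CType                    -- 1̲
    | cand : CType → CType → CType     -- A̲ & B̲
    | carr : VType → CType → CType     -- A ⇒ B̲
    | iunit : CType                    -- I̲
    | bang : VType → CType             -- !A
    | copow : VType → CType → CType    -- !A ⊗ B̲
    | czero : CType                    -- 0̲
    | csum : CType → CType → CType     -- A̲ ⊕ B̲
end

/-- Raw terms of EEC.  Value variables are de Bruijn indices (`var n`, with
`var 0` the innermost bound variable); the unique stoup variable is `svar`
(the constructs `llam`, `copowlet` (in its body) and `ccase` (in its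
branches) bind the stoup variable). -/
inductive Tm : Type
  | var : ℕ → Tm                -- value variable
  | svar : Tm                   -- the stoup variable
  | unit : Tm                   -- * : 1
  | vpair : Tm → Tm → Tm        -- ⟨t,u⟩
  | vfst : Tm → Tm
  | vsnd : Tm → Tm
  | vlam : VType → Tm → Tm      -- λx:A. t
  | vapp : Tm → Tm → Tm
  | cunit : Tm                  -- ⋆ : 1̲
  | cpair : Tm → Tm → Tm        -- ⟨t,u⟩ : A̲ & B̲
  | cfst : Tm → Tm
  | csnd : Tm → Tm
  | clam : VType → Tm → Tm      -- λx:A ⇒ t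
  | capp : Tm → Tm → Tm         -- s ⋅ t
  | top : Tm                    -- ⊤ : I̲
  | ilet : Tm → Tm → Tm         -- t to ⊤. u
  | bang : Tm → Tm              -- !t
  | banglet : Tm → Tm → Tm      -- let !x = t in u   (binds a value variable in u)
  | copow : Tm → Tm → Tm        -- !t ⊗ u
  | copowlet : Tm → Tm → Tm     -- let !x⊗y = s in t (binds a value variable and the stoup variable in t)
  | cimage : CType → Tm → Tm    -- image_{A̲}(t)
  | cinl : Tm → Tm
  | cinr : Tm → Tm
  | ccase : Tm → Tm → Tm → Tm   -- case s of (x. t | y. u)  (branches bind the stoup variable)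
  | llam : CType → Tm → Tm      -- λ°z:A̲. t (binds the stoup variable)
  | lapp : Tm → Tm → Tm         -- s[t]

namespace Tm

/-- Lift a renaming of value variables under a binder. -/
def liftN (f : ℕ → ℕ) : ℕ → ℕ
  | 0 => 0
  | n + 1 => f n + 1

/-- Renaming of value variables. -/
def rename (f : ℕ → ℕ) : Tm → Tm
  | .var n => .var (f n)
  | .svar => .svar
  | .unit => .unit
  | .vpair t u => .vpair (rename f t) (rename f u)
  | .vfst t => .vfst (rename f t)
  | .vsnd t => .vsnd (rename f t)
  | .vlam A t => .vlam A (rename (liftN f) t)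
  | .vapp s t => .vapp (rename f s) (rename f t)
  | .cunit => .cunit
  | .cpair t u => .cpair (rename f t) (rename f u)
  | .cfst t => .cfst (rename f t)
  | .csnd t => .csnd (rename f t)
  | .clam A t => .clam A (rename (liftN f) t)
  | .capp s t => .capp (rename f s) (rename f t)
  | .top => .top
  | .ilet t u => .ilet (rename f t) (rename f u)
  | .bang t => .bang (rename f t)
  | .banglet t u => .banglet (rename f t) (rename (liftN f) u)
  | .copow t u => .copow (rename f t) (rename f u)
  | .copowlet s t => .copowlet (rename f s) (rename (liftN f) t)
  | .cimage A t => .cimage A (rename f t)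
  | .cinl t => .cinl (rename f t)
  | .cinr t => .cinr (rename f t)
  | .ccase s t u => .ccase (rename f s) (rename f t) (rename f u)
  | .llam A t => .llam A (rename f t)
  | .lapp s t => .lapp (rename f s) (rename f t)

/-- Weakening of value variables. -/
def shift (t : Tm) : Tm := rename Nat.succ t

/-- Lift a parallel substitution of value variables under a binder. -/
def liftS (σ : ℕ → Tm) : ℕ → Tm
  | 0 => .var 0
  | n + 1 => shift (σ n)

/-- Parallel (capture-avoiding) substitution for value variables. -/
def psubst (σ : ℕ → Tm) : Tm → Tm
  | .var n => σ n
  | .svar => .svar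
  | .unit => .unit
  | .vpair t u => .vpair (psubst σ t) (psubst σ u)
  | .vfst t => .vfst (psubst σ t)
  | .vsnd t => .vsnd (psubst σ t)
  | .vlam A t => .vlam A (psubst (liftS σ) t)
  | .vapp s t => .vapp (psubst σ s) (psubst σ t)
  | .cunit => .cunit
  | .cpair t u => .cpair (psubst σ t) (psubst σ u)
  | .cfst t => .cfst (psubst σ t)
  | .csnd t => .csnd (psubst σ t)
  | .clam A t => .clam A (psubst (liftS σ) t)
  | .capp s t => .capp (psubst σ s) (psubst σ t)
  | .top => .top
  | .ilet t u => .ilet (psubst σ t) (psubst σ u)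
  | .bang t => .bang (psubst σ t)
  | .banglet t u => .banglet (psubst σ t) (psubst (liftS σ) u)
  | .copow t u => .copow (psubst σ t) (psubst σ u)
  | .copowlet s t => .copowlet (psubst σ s) (psubst (liftS σ) t)
  | .cimage A t => .cimage A (psubst σ t)
  | .cinl t => .cinl (psubst σ t)
  | .cinr t => .cinr (psubst σ t)
  | .ccase s t u => .ccase (psubst σ s) (psubst σ t) (psubst σ u)
  | .llam A t => .llam A (psubst σ t)
  | .lapp s t => .lapp (psubst σ s) (psubst σ t)

/-- Capture-avoiding substitution `t[u/x]` of a term `u` for the innermost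
value variable of `t`. -/
def subst0 (u : Tm) (t : Tm) : Tm :=
  psubst (fun n => match n with | 0 => u | m + 1 => .var m) t

/-- Capture-avoiding substitution `t[u/z]` of a term `u` for the stoup
variable of `t`.  The substitution stops at the stoup-variable binders
(`llam`-bodies, `copowlet`-bodies and `ccase`-branches). -/
def ssubst (u : Tm) : Tm → Tm
  | .var n => .var n
  | .svar => u
  | .unit => .unit
  | .vpair t t' => .vpair (ssubst u t) (ssubst u t')
  | .vfst t => .vfst (ssubst u t)
  | .vsnd t => .vsnd (ssubst u t)
  | .vlam A t => .vlam A (ssubst (shift u) t)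
  | .vapp s t => .vapp (ssubst u s) (ssubst u t)
  | .cunit => .cunit
  | .cpair t t' => .cpair (ssubst u t) (ssubst u t')
  | .cfst t => .cfst (ssubst u t)
  | .csnd t => .csnd (ssubst u t)
  | .clam A t => .clam A (ssubst (shift u) t)
  | .capp s t => .capp (ssubst u s) (ssubst u t)
  | .top => .top
  | .ilet t t' => .ilet (ssubst u t) (ssubst u t')
  | .bang t => .bang (ssubst u t)
  | .banglet t t' => .banglet (ssubst u t) (ssubst (shift u) t')
  | .copow t t' => .copow (ssubst u t) (ssubst u t')
  | .copowlet s t => .copowlet (ssubst u s) t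
  | .cimage A t => .cimage A (ssubst u t)
  | .cinl t => .cinl (ssubst u t)
  | .cinr t => .cinr (ssubst u t)
  | .ccase s t t' => .ccase (ssubst u s) t t'
  | .llam A t => .llam A t
  | .lapp s t => .lapp (ssubst u s) (ssubst u t)

end Tm

/-- Typing derivations of EEC (Figure 1 of the paper).  `Deriv Γ none t A`
is the judgement `Γ ⊢ t : A` (empty stoup); `Deriv Γ (some A̲) t (.comp B̲)`
is the judgement `Γ | z:A̲ ⊢ t : B̲`.  In the rules below `Δ` ranges over an
arbitrary (possibly empty) stoup. -/
inductive Deriv : List VType → Option CType → Tm → VType → Type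
  | var (Γ : List VType) (n : ℕ) (A : VType) :
      Γ[n]? = some A → Deriv Γ none (.var n) A
  | svar (Γ : List VType) (A : CType) : Deriv Γ (some A) .svar (.comp A)
  | unit (Γ : List VType) : Deriv Γ none .unit .unit
  | vpair (Γ : List VType) (t u : Tm) (A B : VType) :
      Deriv Γ none t A → Deriv Γ none u B → Deriv Γ none (.vpair t u) (.prod A B)
  | vfst (Γ : List VType) (t : Tm) (A B : VType) :
      Deriv Γ none t (.prod A B) → Deriv Γ none (.vfst t) A
  | vsnd (Γ : List VType) (t : Tm) (A B : VType) :
      Deriv Γ none t (.prod A B) → Deriv Γ none (.vsnd t) B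
  | vlam (Γ : List VType) (t : Tm) (A B : VType) :
      Deriv (A :: Γ) none t B → Deriv Γ none (.vlam A t) (.arr A B)
  | vapp (Γ : List VType) (s t : Tm) (A B : VType) :
      Deriv Γ none s (.arr A B) → Deriv Γ none t A → Deriv Γ none (.vapp s t) B
  | cunit (Γ : List VType) (Δ : Option CType) : Deriv Γ Δ .cunit (.comp .cunit)
  | cpair (Γ : List VType) (Δ : Option CType) (t u : Tm) (A B : CType) :
      Deriv Γ Δ t (.comp A) → Deriv Γ Δ u (.comp B) →
      Deriv Γ Δ (.cpair t u) (.comp (.cand A B))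
  | cfst (Γ : List VType) (Δ : Option CType) (t : Tm) (A B : CType) :
      Deriv Γ Δ t (.comp (.cand A B)) → Deriv Γ Δ (.cfst t) (.comp A)
  | csnd (Γ : List VType) (Δ : Option CType) (t : Tm) (A B : CType) :
      Deriv Γ Δ t (.comp (.cand A B)) → Deriv Γ Δ (.csnd t) (.comp B)
  | clam (Γ : List VType) (Δ : Option CType) (t : Tm) (A : VType) (B : CType) :
      Deriv (A :: Γ) Δ t (.comp B) → Deriv Γ Δ (.clam A t) (.comp (.carr A B))
  | capp (Γ : List VType) (Δ : Option CType) (s t : Tm) (A : VType) (B : CType) :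
      Deriv Γ Δ s (.comp (.carr A B)) → Deriv Γ none t A →
      Deriv Γ Δ (.capp s t) (.comp B)
  | top (Γ : List VType) : Deriv Γ none .top (.comp .iunit)
  | ilet (Γ : List VType) (Δ : Option CType) (t u : Tm) (A : CType) :
      Deriv Γ Δ t (.comp .iunit) → Deriv Γ none u (.comp A) →
      Deriv Γ Δ (.ilet t u) (.comp A)
  | bang (Γ : List VType) (t : Tm) (A : VType) :
      Deriv Γ none t A → Deriv Γ none (.bang t) (.comp (.bang A))
  | banglet (Γ : List VType) (Δ : Option CType) (t u : Tm) (A : VType) (B : CType) :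
      Deriv Γ Δ t (.comp (.bang A)) → Deriv (A :: Γ) none u (.comp B) →
      Deriv Γ Δ (.banglet t u) (.comp B)
  | copow (Γ : List VType) (Δ : Option CType) (t u : Tm) (A : VType) (B : CType) :
      Deriv Γ none t A → Deriv Γ Δ u (.comp B) →
      Deriv Γ Δ (.copow t u) (.comp (.copow A B))
  | copowlet (Γ : List VType) (Δ : Option CType) (s t : Tm) (A : VType) (B C : CType) :
      Deriv Γ Δ s (.comp (.copow A B)) → Deriv (A :: Γ) (some B) t (.comp C) →
      Deriv Γ Δ (.copowlet s t) (.comp C)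
  | cimage (Γ : List VType) (Δ : Option CType) (t : Tm) (A : CType) :
      Deriv Γ Δ t (.comp .czero) → Deriv Γ Δ (.cimage A t) (.comp A)
  | cinl (Γ : List VType) (Δ : Option CType) (t : Tm) (A B : CType) :
      Deriv Γ Δ t (.comp A) → Deriv Γ Δ (.cinl t) (.comp (.csum A B))
  | cinr (Γ : List VType) (Δ : Option CType) (t : Tm) (A B : CType) :
      Deriv Γ Δ t (.comp B) → Deriv Γ Δ (.cinr t) (.comp (.csum A B))
  | ccase (Γ : List VType) (Δ : Option CType) (s t u : Tm) (A B C : CType) :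
      Deriv Γ Δ s (.comp (.csum A B)) → Deriv Γ (some A) t (.comp C) →
      Deriv Γ (some B) u (.comp C) → Deriv Γ Δ (.ccase s t u) (.comp C)
  | llam (Γ : List VType) (t : Tm) (A B : CType) :
      Deriv Γ (some A) t (.comp B) → Deriv Γ none (.llam A t) (.lin A B)
  | lapp (Γ : List VType) (Δ : Option CType) (s t : Tm) (A B : CType) :
      Deriv Γ none s (.lin A B) → Deriv Γ Δ t (.comp A) →
      Deriv Γ Δ (.lapp s t) (.comp B)

/-- The equational theory of EEC: the smallest type-respecting congruence
containing the βη-equalities of Figure 2 of the paper. -/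
inductive EEq : List VType → Option CType → Tm → Tm → VType → Prop
  -- equivalence
  | refl {Γ Δ t A} : Deriv Γ Δ t A → EEq Γ Δ t t A
  | symm {Γ Δ t u A} : EEq Γ Δ t u A → EEq Γ Δ u t A
  | trans {Γ Δ t u v A} : EEq Γ Δ t u A → EEq Γ Δ u v A → EEq Γ Δ t v A
  -- congruence rules
  | vpair_cong {Γ t t' u u' A B} : EEq Γ none t t' A → EEq Γ none u u' B →
      EEq Γ none (.vpair t u) (.vpair t' u') (.prod A B)
  | vfst_cong {Γ t t' A B} : EEq Γ none t t' (.prod A B) →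
      EEq Γ none (.vfst t) (.vfst t') A
  | vsnd_cong {Γ t t' A B} : EEq Γ none t t' (.prod A B) →
      EEq Γ none (.vsnd t) (.vsnd t') B
  | vlam_cong {Γ t t' A B} : EEq (A :: Γ) none t t' B →
      EEq Γ none (.vlam A t) (.vlam A t') (.arr A B)
  | vapp_cong {Γ s s' t t' A B} : EEq Γ none s s' (.arr A B) → EEq Γ none t t' A →
      EEq Γ none (.vapp s t) (.vapp s' t') B
  | cpair_cong {Γ Δ t t' u u' A B} : EEq Γ Δ t t' (.comp A) → EEq Γ Δ u u' (.comp B) →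
      EEq Γ Δ (.cpair t u) (.cpair t' u') (.comp (.cand A B))
  | cfst_cong {Γ Δ t t' A B} : EEq Γ Δ t t' (.comp (.cand A B)) →
      EEq Γ Δ (.cfst t) (.cfst t') (.comp A)
  | csnd_cong {Γ Δ t t' A B} : EEq Γ Δ t t' (.comp (.cand A B)) →
      EEq Γ Δ (.csnd t) (.csnd t') (.comp B)
  | clam_cong {Γ Δ t t' A B} : EEq (A :: Γ) Δ t t' (.comp B) →
      EEq Γ Δ (.clam A t) (.clam A t') (.comp (.carr A B))
  | capp_cong {Γ Δ s s' t t' A B} : EEq Γ Δ s s' (.comp (.carr A B)) → EEq Γ none t t' A →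
      EEq Γ Δ (.capp s t) (.capp s' t') (.comp B)
  | ilet_cong {Γ Δ t t' u u' A} : EEq Γ Δ t t' (.comp .iunit) → EEq Γ none u u' (.comp A) →
      EEq Γ Δ (.ilet t u) (.ilet t' u') (.comp A)
  | bang_cong {Γ t t' A} : EEq Γ none t t' A →
      EEq Γ none (.bang t) (.bang t') (.comp (.bang A))
  | banglet_cong {Γ Δ t t' u u' A B} : EEq Γ Δ t t' (.comp (.bang A)) →
      EEq (A :: Γ) none u u' (.comp B) →
      EEq Γ Δ (.banglet t u) (.banglet t' u') (.comp B)
  | copow_cong {Γ Δ t t' u u' A B} : EEq Γ none t t' A → EEq Γ Δ u u' (.comp B) →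
      EEq Γ Δ (.copow t u) (.copow t' u') (.comp (.copow A B))
  | copowlet_cong {Γ Δ s s' t t' A B C} : EEq Γ Δ s s' (.comp (.copow A B)) →
      EEq (A :: Γ) (some B) t t' (.comp C) →
      EEq Γ Δ (.copowlet s t) (.copowlet s' t') (.comp C)
  | cimage_cong {Γ Δ t t' A} : EEq Γ Δ t t' (.comp .czero) →
      EEq Γ Δ (.cimage A t) (.cimage A t') (.comp A)
  | cinl_cong {Γ Δ t t' A B} : EEq Γ Δ t t' (.comp A) →
      EEq Γ Δ (.cinl t) (.cinl t') (.comp (.csum A B))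
  | cinr_cong {Γ Δ t t' A B} : EEq Γ Δ t t' (.comp B) →
      EEq Γ Δ (.cinr t) (.cinr t') (.comp (.csum A B))
  | ccase_cong {Γ Δ s s' t t' u u' A B C} : EEq Γ Δ s s' (.comp (.csum A B)) →
      EEq Γ (some A) t t' (.comp C) → EEq Γ (some B) u u' (.comp C) →
      EEq Γ Δ (.ccase s t u) (.ccase s' t' u') (.comp C)
  | llam_cong {Γ t t' A B} : EEq Γ (some A) t t' (.comp B) →
      EEq Γ none (.llam A t) (.llam A t') (.lin A B)
  | lapp_cong {Γ Δ s s' t t' A B} : EEq Γ none s s' (.lin A B) → EEq Γ Δ t t' (.comp A) →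
      EEq Γ Δ (.lapp s t) (.lapp s' t') (.comp B)
  -- the equalities of Figure 2
  | unit_eta {Γ t} : Deriv Γ none t .unit → EEq Γ none t .unit .unit
  | vfst_beta {Γ t u A B} : Deriv Γ none t A → Deriv Γ none u B →
      EEq Γ none (.vfst (.vpair t u)) t A
  | vsnd_beta {Γ t u A B} : Deriv Γ none t A → Deriv Γ none u B →
      EEq Γ none (.vsnd (.vpair t u)) u B
  | vpair_eta {Γ t A B} : Deriv Γ none t (.prod A B) →
      EEq Γ none (.vpair (.vfst t) (.vsnd t)) t (.prod A B)
  | vlam_beta {Γ t u A B} : Deriv (A :: Γ) none t B → Deriv Γ none u A →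
      EEq Γ none (.vapp (.vlam A t) u) (Tm.subst0 u t) B
  | vlam_eta {Γ t A B} : Deriv Γ none t (.arr A B) →
      EEq Γ none (.vlam A (.vapp (Tm.shift t) (.var 0))) t (.arr A B)
  | cunit_eta {Γ Δ t} : Deriv Γ Δ t (.comp .cunit) → EEq Γ Δ t .cunit (.comp .cunit)
  | cfst_beta {Γ Δ t u A B} : Deriv Γ Δ t (.comp A) → Deriv Γ Δ u (.comp B) →
      EEq Γ Δ (.cfst (.cpair t u)) t (.comp A)
  | csnd_beta {Γ Δ t u A B} : Deriv Γ Δ t (.comp A) → Deriv Γ Δ u (.comp B) →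
      EEq Γ Δ (.csnd (.cpair t u)) u (.comp B)
  | cpair_eta {Γ Δ t A B} : Deriv Γ Δ t (.comp (.cand A B)) →
      EEq Γ Δ (.cpair (.cfst t) (.csnd t)) t (.comp (.cand A B))
  | clam_beta {Γ Δ t u A B} : Deriv (A :: Γ) Δ t (.comp B) → Deriv Γ none u A →
      EEq Γ Δ (.capp (.clam A t) u) (Tm.subst0 u t) (.comp B)
  | clam_eta {Γ Δ t A B} : Deriv Γ Δ t (.comp (.carr A B)) →
      EEq Γ Δ (.clam A (.capp (Tm.shift t) (.var 0))) t (.comp (.carr A B))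
  | ilet_beta {Γ t A} : Deriv Γ none t (.comp A) →
      EEq Γ none (.ilet .top t) t (.comp A)
  | ilet_eta {Γ Δ t u A} : Deriv Γ Δ t (.comp .iunit) → Deriv Γ (some .iunit) u (.comp A) →
      EEq Γ Δ (.ilet t (Tm.ssubst .top u)) (Tm.ssubst t u) (.comp A)
  | bang_beta {Γ t u A B} : Deriv Γ none t A → Deriv (A :: Γ) none u (.comp B) →
      EEq Γ none (.banglet (.bang t) u) (Tm.subst0 t u) (.comp B)
  | bang_eta {Γ Δ t u A B} : Deriv Γ Δ t (.comp (.bang A)) →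
      Deriv Γ (some (.bang A)) u (.comp B) →
      EEq Γ Δ (.banglet t (Tm.ssubst (.bang (.var 0)) (Tm.shift u))) (Tm.ssubst t u) (.comp B)
  | copow_beta {Γ Δ t s u A B C} : Deriv Γ none t A → Deriv Γ Δ s (.comp B) →
      Deriv (A :: Γ) (some B) u (.comp C) →
      EEq Γ Δ (.copowlet (.copow t s) u) (Tm.ssubst s (Tm.subst0 t u)) (.comp C)
  | copow_eta {Γ Δ t u A B C} : Deriv Γ Δ t (.comp (.copow A B)) →
      Deriv Γ (some (.copow A B)) u (.comp C) →
      EEq Γ Δ (.copowlet t (Tm.ssubst (.copow (.var 0) .svar) (Tm.shift u))) (Tm.ssubst t u) (.comp C)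
  | czero_eta {Γ Δ t u A} : Deriv Γ Δ t (.comp .czero) → Deriv Γ (some .czero) u (.comp A) →
      EEq Γ Δ (.cimage A t) (Tm.ssubst t u) (.comp A)
  | csum_beta_inl {Γ Δ t u u' A B C} : Deriv Γ (some A) u (.comp C) →
      Deriv Γ (some B) u' (.comp C) → Deriv Γ Δ t (.comp A) →
      EEq Γ Δ (.ccase (.cinl t) u u') (Tm.ssubst t u) (.comp C)
  | csum_beta_inr {Γ Δ t u u' A B C} : Deriv Γ (some A) u (.comp C) →
      Deriv Γ (some B) u' (.comp C) → Deriv Γ Δ t (.comp B) →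
      EEq Γ Δ (.ccase (.cinr t) u u') (Tm.ssubst t u') (.comp C)
  | csum_eta {Γ Δ t u A B C} : Deriv Γ Δ t (.comp (.csum A B)) →
      Deriv Γ (some (.csum A B)) u (.comp C) →
      EEq Γ Δ (.ccase t (Tm.ssubst (.cinl .svar) u) (Tm.ssubst (.cinr .svar) u)) (Tm.ssubst t u) (.comp C)
  | llam_beta {Γ Δ t u A B} : Deriv Γ (some A) t (.comp B) → Deriv Γ Δ u (.comp A) →
      EEq Γ Δ (.lapp (.llam A t) u) (Tm.ssubst u t) (.comp B)
  | llam_eta {Γ t A B} : Deriv Γ none t (.lin A B) →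
      EEq Γ none (.llam A (.lapp t .svar)) t (.lin A B)

end EEC

namespace EEC

/-! ## The generic linear-use CPS self-translation of EEC (Figures 4–6) -/

mutual
  /-- CPS translation `Aᶜ` of value types, relative to the result type `R̲`. -/
  def cpsV (R : CType) : VType → VType
    | .base a => .base a
    | .unit => .unit
    | .prod A B => .prod (cpsV R A) (cpsV R B)
    | .arr A B => .arr (cpsV R A) (cpsV R B)
    | .comp A => .lin (cpsC R A) R
    | .lin A B => .lin (cpsC R B) (cpsC R A)
  /-- CPS translation `A̲ᶜ` of computation types, relative to the result type
  `R̲` (a computation-type constant equal to `R̲` is translated to `I̲`). -/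
  def cpsC (R : CType) : CType → CType
    | .base a =>
        match R with
        | .base b => if b = a then .iunit else .base a
        | _ => .base a
    | .cunit => .czero
    | .cand A B => .csum (cpsC R A) (cpsC R B)
    | .carr A B => .copow (cpsV R A) (cpsC R B)
    | .iunit => R
    | .bang A => .carr (cpsV R A) R
    | .copow A B => .carr (cpsV R A) (cpsC R B)
    | .czero => .cunit
    | .csum A B => .cand (cpsC R A) (cpsC R B)
end

/-- Pointwise CPS translation `Γᶜ` of a context. -/
def cpsCtx (R : CType) (Γ : List VType) : List VType := Γ.map (cpsV R)

/-- The generic linear-use CPS self-translation on terms (Figures 5 and 6 of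
the paper), defined by recursion on typing derivations.  A value judgement
`Γ ⊢ t : A` is sent to a term `tᶜ` with `Γᶜ ⊢ tᶜ : Aᶜ`, and a stoup
judgement `Γ | z:A̲ ⊢ t : B̲` is sent (contravariantly) to a term `tᶜ` with
`Γᶜ | k_z:B̲ᶜ ⊢ tᶜ : A̲ᶜ`. -/
def cps (R : CType) : {Γ : List VType} → {Δ : Option CType} → {t : Tm} → {A : VType} →
    Deriv Γ Δ t A → Tm
  | _, _, _, _, .var _ n _ _ => .var n
  | _, _, _, _, .svar _ _ => .svar
  | _, _, _, _, .unit _ => .unit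
  | _, _, _, _, .vpair _ _ _ _ _ d1 d2 => .vpair (cps R d1) (cps R d2)
  | _, _, _, _, .vfst _ _ _ _ d => .vfst (cps R d)
  | _, _, _, _, .vsnd _ _ _ _ d => .vsnd (cps R d)
  | _, _, _, _, .vlam _ _ A _ d => .vlam (cpsV R A) (cps R d)
  | _, _, _, _, .vapp _ _ _ _ _ d1 d2 => .vapp (cps R d1) (cps R d2)
  | _, _, _, _, .cunit _ none => .llam .czero (.cimage R .svar)
  | _, _, _, _, .cunit _ (some D) => .cimage (cpsC R D) .svar
  | _, _, _, _, .cpair _ none _ _ A B d1 d2 =>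
      .llam (.csum (cpsC R A) (cpsC R B))
        (.ccase .svar (.lapp (cps R d1) .svar) (.lapp (cps R d2) .svar))
  | _, _, _, _, .cpair _ (some _) _ _ _ _ d1 d2 => .ccase .svar (cps R d1) (cps R d2)
  | _, _, _, _, .cfst _ none _ A _ d => .llam (cpsC R A) (.lapp (cps R d) (.cinl .svar))
  | _, _, _, _, .cfst _ (some _) _ _ _ d => Tm.ssubst (.cinl .svar) (cps R d)
  | _, _, _, _, .csnd _ none _ _ B d => .llam (cpsC R B) (.lapp (cps R d) (.cinr .svar))
  | _, _, _, _, .csnd _ (some _) _ _ _ d => Tm.ssubst (.cinr .svar) (cps R d)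
  | _, _, _, _, .clam _ none _ A B d =>
      .llam (.copow (cpsV R A) (cpsC R B)) (.copowlet .svar (.lapp (cps R d) .svar))
  | _, _, _, _, .clam _ (some _) _ _ _ d => .copowlet .svar (cps R d)
  | _, _, _, _, .capp _ none _ _ _ B d1 d2 =>
      .llam (cpsC R B) (.lapp (cps R d1) (.copow (cps R d2) .svar))
  | _, _, _, _, .capp _ (some _) _ _ _ _ d1 d2 =>
      Tm.ssubst (.copow (cps R d2) .svar) (cps R d1)
  | _, _, _, _, .top _ => .llam R .svar
  | _, _, _, _, .ilet _ none _ _ A d1 d2 =>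
      .llam (cpsC R A) (.lapp (cps R d1) (.lapp (cps R d2) .svar))
  | _, _, _, _, .ilet _ (some _) _ _ _ d1 d2 =>
      Tm.ssubst (.lapp (cps R d2) .svar) (cps R d1)
  | _, _, _, _, .bang _ _ A d => .llam (.carr (cpsV R A) R) (.capp .svar (cps R d))
  | _, _, _, _, .banglet _ none _ _ A B d1 d2 =>
      .llam (cpsC R B) (.lapp (cps R d1) (.clam (cpsV R A) (.lapp (cps R d2) .svar)))
  | _, _, _, _, .banglet _ (some _) _ _ A _ d1 d2 =>
      Tm.ssubst (.clam (cpsV R A) (.lapp (cps R d2) .svar)) (cps R d1)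
  | _, _, _, _, .copow _ none _ _ A B d1 d2 =>
      .llam (.carr (cpsV R A) (cpsC R B)) (.lapp (cps R d2) (.capp .svar (cps R d1)))
  | _, _, _, _, .copow _ (some _) _ _ _ _ d1 d2 =>
      Tm.ssubst (.capp .svar (cps R d1)) (cps R d2)
  | _, _, _, _, .copowlet _ none _ _ A _ C d1 d2 =>
      .llam (cpsC R C) (.lapp (cps R d1) (.clam (cpsV R A) (cps R d2)))
  | _, _, _, _, .copowlet _ (some _) _ _ A _ _ d1 d2 =>
      Tm.ssubst (.clam (cpsV R A) (cps R d2)) (cps R d1)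
  | _, _, _, _, .cimage _ none _ A d => .llam (cpsC R A) (.lapp (cps R d) .cunit)
  | _, _, _, _, .cimage _ (some _) _ _ d => Tm.ssubst .cunit (cps R d)
  | _, _, _, _, .cinl _ none _ A B d =>
      .llam (.cand (cpsC R A) (cpsC R B)) (.lapp (cps R d) (.cfst .svar))
  | _, _, _, _, .cinl _ (some _) _ _ _ d => Tm.ssubst (.cfst .svar) (cps R d)
  | _, _, _, _, .cinr _ none _ A B d =>
      .llam (.cand (cpsC R A) (cpsC R B)) (.lapp (cps R d) (.csnd .svar))
  | _, _, _, _, .cinr _ (some _) _ _ _ d => Tm.ssubst (.csnd .svar) (cps R d)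
  | _, _, _, _, .ccase _ none _ _ _ _ _ C d1 d2 d3 =>
      .llam (cpsC R C) (.lapp (cps R d1) (.cpair (cps R d2) (cps R d3)))
  | _, _, _, _, .ccase _ (some _) _ _ _ _ _ _ d1 d2 d3 =>
      Tm.ssubst (.cpair (cps R d2) (cps R d3)) (cps R d1)
  | _, _, _, _, .llam _ _ _ B d => .llam (cpsC R B) (cps R d)
  | _, _, _, _, .lapp _ none _ _ _ B d1 d2 =>
      .llam (cpsC R B) (.lapp (cps R d2) (.lapp (cps R d1) .svar))
  | _, _, _, _, .lapp _ (some _) _ _ _ _ d1 d2 =>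
      Tm.ssubst (.lapp (cps R d1) .svar) (cps R d2)

end EEC

namespace EEC

/-! ## The type isomorphisms `ι` of Figure 7, with explicit inverses -/

mutual
  /-- The closed term `ι_A : (Aᶜ)ᶜ → A` (Figure 7). -/
  def iotaV (R : CType) : VType → Tm
    | .base a => .vlam (.base a) (.var 0)
    | .unit => .vlam .unit .unit
    | .prod A B => .vlam (cpsV R (cpsV R (.prod A B)))
        (.vpair (.vapp (iotaV R A) (.vfst (.var 0))) (.vapp (iotaV R B) (.vsnd (.var 0))))
    | .arr A B => .vlam (cpsV R (cpsV R (.arr A B)))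
        (.vlam A (.vapp (iotaV R B) (.vapp (.var 1) (.vapp (iotaVinv R A) (.var 0)))))
    | .comp A => .vlam (cpsV R (cpsV R (.comp A)))
        (.lapp (iotaC R A) (.lapp (.var 0) .top))
    | .lin A B => .vlam (cpsV R (cpsV R (.lin A B)))
        (.llam A (.lapp (iotaC R B) (.lapp (.var 0) (.lapp (iotaCinv R A) .svar))))
  /-- The closed term `ι_A⁻¹ : A → (Aᶜ)ᶜ`. -/
  def iotaVinv (R : CType) : VType → Tm
    | .base a => .vlam (.base a) (.var 0)
    | .unit => .vlam .unit .unit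
    | .prod A B => .vlam (.prod A B)
        (.vpair (.vapp (iotaVinv R A) (.vfst (.var 0))) (.vapp (iotaVinv R B) (.vsnd (.var 0))))
    | .arr A B => .vlam (.arr A B)
        (.vlam (cpsV R (cpsV R A)) (.vapp (iotaVinv R B) (.vapp (.var 1) (.vapp (iotaV R A) (.var 0)))))
    | .comp A => .vlam (.comp A)
        (.llam .iunit (.ilet .svar (.lapp (iotaCinv R A) (.var 0))))
    | .lin A B => .vlam (.lin A B)
        (.llam (cpsC R (cpsC R A)) (.lapp (iotaCinv R B) (.lapp (.var 0) (.lapp (iotaC R A) .svar))))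
  /-- The closed term `ι_A̲ : (A̲ᶜ)ᶜ ⊸ A̲` (Figure 7). -/
  def iotaC (R : CType) : CType → Tm
    | .base a => .llam (cpsC R (cpsC R (.base a))) .svar
    | .cunit => .llam (cpsC R (cpsC R .cunit)) .cunit
    | .cand A B => .llam (cpsC R (cpsC R (.cand A B)))
        (.cpair (.lapp (iotaC R A) (.cfst .svar)) (.lapp (iotaC R B) (.csnd .svar)))
    | .carr A B => .llam (cpsC R (cpsC R (.carr A B)))
        (.clam A (.lapp (iotaC R B) (.capp .svar (.vapp (iotaVinv R A) (.var 0)))))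
    | .iunit => .llam (cpsC R (cpsC R .iunit)) .svar
    | .bang A => .llam (cpsC R (cpsC R (.bang A)))
        (.copowlet .svar (.ilet .svar (.bang (.vapp (iotaV R A) (.var 0)))))
    | .copow A B => .llam (cpsC R (cpsC R (.copow A B)))
        (.copowlet .svar (.copow (.vapp (iotaV R A) (.var 0)) (.lapp (iotaC R B) .svar)))
    | .czero => .llam (cpsC R (cpsC R .czero)) .svar
    | .csum A B => .llam (cpsC R (cpsC R (.csum A B)))
        (.ccase .svar (.cinl (.lapp (iotaC R A) .svar)) (.cinr (.lapp (iotaC R B) .svar)))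
  /-- The closed term `ι_A̲⁻¹ : A̲ ⊸ (A̲ᶜ)ᶜ`. -/
  def iotaCinv (R : CType) : CType → Tm
    | .base a => .llam (.base a) .svar
    | .cunit => .llam .cunit .cunit
    | .cand A B => .llam (.cand A B)
        (.cpair (.lapp (iotaCinv R A) (.cfst .svar)) (.lapp (iotaCinv R B) (.csnd .svar)))
    | .carr A B => .llam (.carr A B)
        (.clam (cpsV R (cpsV R A)) (.lapp (iotaCinv R B) (.capp .svar (.vapp (iotaV R A) (.var 0)))))
    | .iunit => .llam .iunit .svar
    | .bang A => .llam (.bang A)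
        (.banglet .svar (.copow (.vapp (iotaVinv R A) (.var 0)) .top))
    | .copow A B => .llam (.copow A B)
        (.copowlet .svar (.copow (.vapp (iotaVinv R A) (.var 0)) (.lapp (iotaCinv R B) .svar)))
    | .czero => .llam .czero .svar
    | .csum A B => .llam (.csum A B)
        (.ccase .svar (.cinl (.lapp (iotaCinv R A) .svar)) (.cinr (.lapp (iotaCinv R B) .svar)))
end

/-- The substitution `[ι⁻¹(Γ)]`, replacing each variable `xᵢ : Cᵢ` of `Γ` by
`ι_{Cᵢ}⁻¹(xᵢ)`. -/
def iotaSubst (R : CType) (Γ : List VType) (t : Tm) : Tm :=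
  Tm.psubst (fun n =>
    match Γ[n]? with
    | some C => .vapp (iotaVinv R C) (.var n)
    | none => .var n) t

/-! ## The simply-typed λ-calculus -/

/-- Simple types. -/
inductive STy : Type
  | base : ℕ → STy
  | unit : STy
  | prod : STy → STy → STy
  | arr : STy → STy → STy

/-- Raw simply-typed λ-terms (de Bruijn indices). -/
inductive LTm : Type
  | var : ℕ → LTm
  | unit : LTm
  | pair : LTm → LTm → LTm
  | fst : LTm → LTm
  | snd : LTm → LTm
  | lam : STy → LTm → LTm
  | app : LTm → LTm → LTm

namespace LTm

/-- Renaming of variables. -/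
def rename (f : ℕ → ℕ) : LTm → LTm
  | .var n => .var (f n)
  | .unit => .unit
  | .pair M N => .pair (rename f M) (rename f N)
  | .fst M => .fst (rename f M)
  | .snd M => .snd (rename f M)
  | .lam σ M => .lam σ (rename (Tm.liftN f) M)
  | .app M N => .app (rename f M) (rename f N)

/-- Weakening. -/
def shift (M : LTm) : LTm := rename Nat.succ M

/-- Parallel capture-avoiding substitution. -/
def psubst (σ : ℕ → LTm) : LTm → LTm
  | .var n => σ n
  | .unit => .unit
  | .pair M N => .pair (psubst σ M) (psubst σ N)
  | .fst M => .fst (psubst σ M)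
  | .snd M => .snd (psubst σ M)
  | .lam τ M => .lam τ (psubst (fun n => match n with | 0 => .var 0 | m + 1 => shift (σ m)) M)
  | .app M N => .app (psubst σ M) (psubst σ N)

/-- Capture-avoiding substitution `M[N/x]` for the innermost variable. -/
def subst0 (N : LTm) (M : LTm) : LTm :=
  psubst (fun n => match n with | 0 => N | m + 1 => .var m) M

end LTm

/-- Typing derivations of the simply-typed λ-calculus (Figure 3). -/
inductive LDeriv : List STy → LTm → STy → Type
  | var (Θ : List STy) (n : ℕ) (σ : STy) : Θ[n]? = some σ → LDeriv Θ (.var n) σ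
  | unit (Θ : List STy) : LDeriv Θ .unit .unit
  | pair (Θ : List STy) (M N : LTm) (σ τ : STy) :
      LDeriv Θ M σ → LDeriv Θ N τ → LDeriv Θ (.pair M N) (.prod σ τ)
  | fst (Θ : List STy) (M : LTm) (σ τ : STy) :
      LDeriv Θ M (.prod σ τ) → LDeriv Θ (.fst M) σ
  | snd (Θ : List STy) (M : LTm) (σ τ : STy) :
      LDeriv Θ M (.prod σ τ) → LDeriv Θ (.snd M) τ
  | lam (Θ : List STy) (M : LTm) (σ τ : STy) :
      LDeriv (σ :: Θ) M τ → LDeriv Θ (.lam σ M) (.arr σ τ)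
  | app (Θ : List STy) (M N : LTm) (σ τ : STy) :
      LDeriv Θ M (.arr σ τ) → LDeriv Θ N σ → LDeriv Θ (.app M N) τ

/-- Values of the (call-by-value) λ-calculus. -/
inductive LVal : LTm → Prop
  | var (n : ℕ) : LVal (.var n)
  | unit : LVal .unit
  | lam (σ : STy) (M : LTm) : LVal (.lam σ M)
  | pair {M N : LTm} : LVal M → LVal N → LVal (.pair M N)

/-- βη-equality of the simply-typed λ-calculus. -/
inductive LBetaEta : List STy → LTm → LTm → STy → Prop
  | refl {Θ M σ} : LDeriv Θ M σ → LBetaEta Θ M M σ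
  | symm {Θ M N σ} : LBetaEta Θ M N σ → LBetaEta Θ N M σ
  | trans {Θ M N P σ} : LBetaEta Θ M N σ → LBetaEta Θ N P σ → LBetaEta Θ M P σ
  | pair_cong {Θ M M' N N' σ τ} : LBetaEta Θ M M' σ → LBetaEta Θ N N' τ →
      LBetaEta Θ (.pair M N) (.pair M' N') (.prod σ τ)
  | fst_cong {Θ M M' σ τ} : LBetaEta Θ M M' (.prod σ τ) → LBetaEta Θ (.fst M) (.fst M') σ
  | snd_cong {Θ M M' σ τ} : LBetaEta Θ M M' (.prod σ τ) → LBetaEta Θ (.snd M) (.snd M') τ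
  | lam_cong {Θ M M' σ τ} : LBetaEta (σ :: Θ) M M' τ →
      LBetaEta Θ (.lam σ M) (.lam σ M') (.arr σ τ)
  | app_cong {Θ M M' N N' σ τ} : LBetaEta Θ M M' (.arr σ τ) → LBetaEta Θ N N' σ →
      LBetaEta Θ (.app M N) (.app M' N') τ
  | beta {Θ M N σ τ} : LDeriv (σ :: Θ) M τ → LDeriv Θ N σ →
      LBetaEta Θ (.app (.lam σ M) N) (LTm.subst0 N M) τ
  | eta {Θ M σ τ} : LDeriv Θ M (.arr σ τ) →
      LBetaEta Θ (.lam σ (.app (LTm.shift M) (.var 0))) M (.arr σ τ)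
  | fst_beta {Θ M N σ τ} : LDeriv Θ M σ → LDeriv Θ N τ →
      LBetaEta Θ (.fst (.pair M N)) M σ
  | snd_beta {Θ M N σ τ} : LDeriv Θ M σ → LDeriv Θ N τ →
      LBetaEta Θ (.snd (.pair M N)) N τ
  | pair_eta {Θ M σ τ} : LDeriv Θ M (.prod σ τ) →
      LBetaEta Θ (.pair (.fst M) (.snd M)) M (.prod σ τ)
  | unit_eta {Θ M} : LDeriv Θ M .unit → LBetaEta Θ M .unit .unit

/-- Equality in Moggi's computational λ-calculus `λc` (call-by-value
βη-equalities restricted to values, together with the `let`-laws, expressed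
via the standard encoding `let x = M in N := (λx.N) M`). -/
inductive LamC : List STy → LTm → LTm → STy → Prop
  | refl {Θ M σ} : LDeriv Θ M σ → LamC Θ M M σ
  | symm {Θ M N σ} : LamC Θ M N σ → LamC Θ N M σ
  | trans {Θ M N P σ} : LamC Θ M N σ → LamC Θ N P σ → LamC Θ M P σ
  | pair_cong {Θ M M' N N' σ τ} : LamC Θ M M' σ → LamC Θ N N' τ →
      LamC Θ (.pair M N) (.pair M' N') (.prod σ τ)
  | fst_cong {Θ M M' σ τ} : LamC Θ M M' (.prod σ τ) → LamC Θ (.fst M) (.fst M') σ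
  | snd_cong {Θ M M' σ τ} : LamC Θ M M' (.prod σ τ) → LamC Θ (.snd M) (.snd M') τ
  | lam_cong {Θ M M' σ τ} : LamC (σ :: Θ) M M' τ →
      LamC Θ (.lam σ M) (.lam σ M') (.arr σ τ)
  | app_cong {Θ M M' N N' σ τ} : LamC Θ M M' (.arr σ τ) → LamC Θ N N' σ →
      LamC Θ (.app M N) (.app M' N') τ
  | beta_v {Θ M V σ τ} : LDeriv (σ :: Θ) M τ → LDeriv Θ V σ → LVal V →
      LamC Θ (.app (.lam σ M) V) (LTm.subst0 V M) τ
  | eta_v {Θ V σ τ} : LVal V → LDeriv Θ V (.arr σ τ) →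
      LamC Θ (.lam σ (.app (LTm.shift V) (.var 0))) V (.arr σ τ)
  | fst_beta_v {Θ V W σ τ} : LVal V → LVal W → LDeriv Θ V σ → LDeriv Θ W τ →
      LamC Θ (.fst (.pair V W)) V σ
  | snd_beta_v {Θ V W σ τ} : LVal V → LVal W → LDeriv Θ V σ → LDeriv Θ W τ →
      LamC Θ (.snd (.pair V W)) W τ
  | pair_eta_v {Θ V σ τ} : LVal V → LDeriv Θ V (.prod σ τ) →
      LamC Θ (.pair (.fst V) (.snd V)) V (.prod σ τ)
  | unit_eta_v {Θ V} : LVal V → LDeriv Θ V .unit → LamC Θ V .unit .unit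
  | let_eta {Θ M σ} : LDeriv Θ M σ → LamC Θ (.app (.lam σ (.var 0)) M) M σ
  | let_assoc {Θ M N L σ ρ τ} : LDeriv (σ :: Θ) M τ → LDeriv (ρ :: Θ) N σ →
      LDeriv Θ L ρ →
      LamC Θ (.app (.lam σ M) (.app (.lam ρ N) L))
        (.app (.lam ρ (.app (.lam σ (LTm.rename (Tm.liftN Nat.succ) M)) N)) L) τ
  | app_left {Θ M N σ τ} : LDeriv Θ M (.arr σ τ) → LDeriv Θ N σ →
      LamC Θ (.app M N) (.app (.lam (.arr σ τ) (.app (.var 0) (LTm.shift N))) M) τ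
  | app_right {Θ V N σ τ} : LVal V → LDeriv Θ V (.arr σ τ) → LDeriv Θ N σ →
      LamC Θ (.app V N) (.app (.lam σ (.app (LTm.shift V) (.var 0))) N) τ
  | pair_left {Θ M N σ τ} : LDeriv Θ M σ → LDeriv Θ N τ →
      LamC Θ (.pair M N) (.app (.lam σ (.pair (.var 0) (LTm.shift N))) M) (.prod σ τ)
  | pair_right {Θ V N σ τ} : LVal V → LDeriv Θ V σ → LDeriv Θ N τ →
      LamC Θ (.pair V N) (.app (.lam τ (.pair (LTm.shift V) (.var 0))) N) (.prod σ τ)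
  | fst_cc {Θ M σ τ} : LDeriv Θ M (.prod σ τ) →
      LamC Θ (.fst M) (.app (.lam (.prod σ τ) (.fst (.var 0))) M) σ
  | snd_cc {Θ M σ τ} : LDeriv Θ M (.prod σ τ) →
      LamC Θ (.snd M) (.app (.lam (.prod σ τ) (.snd (.var 0))) M) τ

end EEC

namespace EEC

/-! ## The standard cbv and cbn translations of typed λ-calculus into EEC -/

/-- The computation-type constant `α̲` associated with a simply-typed
λ-calculus type constant `α` (the association is injective but not
surjective, so that some computation-type constants of EEC are different
from `α̲` for every λ-calculus type constant `α`). -/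
def assocC (a : ℕ) : CType := .base (a + 1)

/-- The call-by-value translation `σᵛ` on types. -/
def cbvT : STy → VType
  | .base a => .base a
  | .unit => .unit
  | .prod σ τ => .prod (cbvT σ) (cbvT τ)
  | .arr σ τ => .arr (cbvT σ) (.comp (.bang (cbvT τ)))

/-- The call-by-value translation `Θᵛ` on contexts. -/
def cbvCtx (Θ : List STy) : List VType := Θ.map cbvT

/-- The call-by-value translation on terms: `Θ ⊢ M : τ` is sent to
`Θᵛ ⊢ Mᵛ : !(τᵛ)`. -/
def cbvTm : LTm → Tm
  | .var n => .bang (.var n)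
  | .unit => .bang .unit
  | .pair M N => .banglet (cbvTm M) (.banglet (Tm.shift (cbvTm N)) (.bang (.vpair (.var 1) (.var 0))))
  | .fst M => .banglet (cbvTm M) (.bang (.vfst (.var 0)))
  | .snd M => .banglet (cbvTm M) (.bang (.vsnd (.var 0)))
  | .lam σ M => .bang (.vlam (cbvT σ) (cbvTm M))
  | .app M N => .banglet (cbvTm M) (.banglet (Tm.shift (cbvTm N)) (.vapp (.var 1) (.var 0)))

/-- The call-by-name translation `σⁿ` on types. -/
def cbnT : STy → CType
  | .base a => assocC a
  | .unit => .cunit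
  | .prod σ τ => .cand (cbnT σ) (cbnT τ)
  | .arr σ τ => .carr (.comp (cbnT σ)) (cbnT τ)

/-- The call-by-name translation `Θⁿ` on contexts. -/
def cbnCtx (Θ : List STy) : List VType := Θ.map (fun σ => .comp (cbnT σ))

/-- The call-by-name translation on terms: `Θ ⊢ M : τ` is sent to
`Θⁿ ⊢ Mⁿ : τⁿ`, mimicking each construct by the corresponding
computation-type construct of EEC. -/
def cbnTm : LTm → Tm
  | .var n => .var n
  | .unit => .cunit
  | .pair M N => .cpair (cbnTm M) (cbnTm N)
  | .fst M => .cfst (cbnTm M)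
  | .snd M => .csnd (cbnTm M)
  | .lam σ M => .clam (.comp (cbnT σ)) (cbnTm M)
  | .app M N => .capp (cbnTm M) (cbnTm N)

/-! ## Hasegawa's linear-use CPS translations (Section 4) -/

/-- The call-by-value linear-use CPS translation `σᵛᶜ` on types. -/
def cbvcpsT (R : CType) : STy → VType
  | .base a => .base a
  | .unit => .unit
  | .prod σ τ => .prod (cbvcpsT R σ) (cbvcpsT R τ)
  | .arr σ τ => .arr (cbvcpsT R σ) (.lin (.carr (cbvcpsT R τ) R) R)

/-- `Θᵛᶜ`. -/
def cbvcpsCtx (R : CType) (Θ : List STy) : List VType := Θ.map (cbvcpsT R)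

/-- The call-by-value linear-use CPS translation on terms: `Θ ⊢ M : τ` is
sent to `Θᵛᶜ ⊢ Mᵛᶜ : (τᵛᶜ ⇒ R̲) ⊸ R̲`. -/
def cbvcps (R : CType) : {Θ : List STy} → {M : LTm} → {σ : STy} → LDeriv Θ M σ → Tm
  | _, _, _, .var _ n σ _ => .llam (.carr (cbvcpsT R σ) R) (.capp .svar (.var n))
  | _, _, _, .unit _ => .llam (.carr .unit R) (.capp .svar .unit)
  | _, _, _, .pair _ _ _ σ τ dM dN =>
      .llam (.carr (.prod (cbvcpsT R σ) (cbvcpsT R τ)) R)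
        (.lapp (cbvcps R dM)
          (.clam (cbvcpsT R σ)
            (.lapp (Tm.shift (cbvcps R dN))
              (.clam (cbvcpsT R τ) (.capp .svar (.vpair (.var 1) (.var 0)))))))
  | _, _, _, .fst _ _ σ τ dM =>
      .llam (.carr (cbvcpsT R σ) R)
        (.lapp (cbvcps R dM)
          (.clam (.prod (cbvcpsT R σ) (cbvcpsT R τ)) (.capp .svar (.vfst (.var 0)))))
  | _, _, _, .snd _ _ σ τ dM =>
      .llam (.carr (cbvcpsT R τ) R)
        (.lapp (cbvcps R dM)
          (.clam (.prod (cbvcpsT R σ) (cbvcpsT R τ)) (.capp .svar (.vsnd (.var 0)))))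
  | _, _, _, .lam _ _ σ τ dM =>
      .llam (.carr (.arr (cbvcpsT R σ) (.lin (.carr (cbvcpsT R τ) R) R)) R)
        (.capp .svar (.vlam (cbvcpsT R σ) (cbvcps R dM)))
  | _, _, _, .app _ _ _ σ τ dM dN =>
      .llam (.carr (cbvcpsT R τ) R)
        (.lapp (cbvcps R dM)
          (.clam (.arr (cbvcpsT R σ) (.lin (.carr (cbvcpsT R τ) R) R))
            (.lapp (Tm.shift (cbvcps R dN))
              (.clam (cbvcpsT R σ) (.lapp (.vapp (.var 1) (.var 0)) .svar)))))

/-- The call-by-name linear-use CPS translation `σⁿᶜ` on types. -/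
def cbncpsT (R : CType) : STy → CType
  | .base a => assocC a
  | .unit => .czero
  | .prod σ τ => .csum (cbncpsT R σ) (cbncpsT R τ)
  | .arr σ τ => .copow (.lin (cbncpsT R σ) R) (cbncpsT R τ)

/-- `Θⁿᶜ ⊸ R̲`, assigning each variable `xᵢ : σᵢ` the type `σᵢⁿᶜ ⊸ R̲`. -/
def cbncpsCtx (R : CType) (Θ : List STy) : List VType :=
  Θ.map (fun σ => .lin (cbncpsT R σ) R)

/-- The call-by-name linear-use CPS translation on terms: `Θ ⊢ M : τ` is
sent to `Θⁿᶜ ⊸ R̲ ⊢ Mⁿᶜ : τⁿᶜ ⊸ R̲`. -/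
def cbncps (R : CType) : {Θ : List STy} → {M : LTm} → {σ : STy} → LDeriv Θ M σ → Tm
  | _, _, _, .var _ n _ _ => .var n
  | _, _, _, .unit _ => .llam .czero (.cimage R .svar)
  | _, _, _, .pair _ _ _ σ τ dM dN =>
      .llam (.csum (cbncpsT R σ) (cbncpsT R τ))
        (.ccase .svar (.lapp (cbncps R dM) .svar) (.lapp (cbncps R dN) .svar))
  | _, _, _, .fst _ _ σ _τ dM => .llam (cbncpsT R σ) (.lapp (cbncps R dM) (.cinl .svar))
  | _, _, _, .snd _ _ _ τ dM => .llam (cbncpsT R τ) (.lapp (cbncps R dM) (.cinr .svar))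
  | _, _, _, .lam _ _ σ τ dM =>
      .llam (.copow (.lin (cbncpsT R σ) R) (cbncpsT R τ))
        (.copowlet .svar (.lapp (cbncps R dM) .svar))
  | _, _, _, .app _ _ _ σ τ dM dN =>
      .llam (cbncpsT R τ) (.lapp (cbncps R dM) (.copow (cbncps R dN) .svar))

end EEC

namespace EEC

namespace Tm

theorem liftN_comp (f g : ℕ → ℕ) : liftN g ∘ liftN f = liftN (g ∘ f) := by
  funext n; cases n <;> rfl

theorem rename_rename (f g : ℕ → ℕ) (t : Tm) : rename g (rename f t) = rename (g ∘ f) t := by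
  induction t generalizing f g <;> simp_all [rename, liftN_comp]

theorem liftS_comp_liftN (f : ℕ → ℕ) (σ : ℕ → Tm) : liftS σ ∘ liftN f = liftS (σ ∘ f) := by
  funext n; cases n <;> rfl

theorem psubst_rename (f : ℕ → ℕ) (σ : ℕ → Tm) (t : Tm) :
    psubst σ (rename f t) = psubst (σ ∘ f) t := by
  induction t generalizing f σ <;> simp_all [rename, psubst, liftS_comp_liftN]

theorem rename_comp_liftS (f : ℕ → ℕ) (σ : ℕ → Tm) :
    rename (liftN f) ∘ liftS σ = liftS (rename f ∘ σ) := by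
  funext n
  cases n
  · rfl
  · simp only [Function.comp, liftS, shift, rename_rename]; rfl

theorem rename_psubst (f : ℕ → ℕ) (σ : ℕ → Tm) (t : Tm) :
    rename f (psubst σ t) = psubst (rename f ∘ σ) t := by
  induction t generalizing f σ <;> simp_all [rename, psubst, rename_comp_liftS]

theorem psubst_shift (σ : ℕ → Tm) (t : Tm) : psubst (liftS σ) (shift t) = shift (psubst σ t) := by
  simp only [shift, psubst_rename, rename_psubst]; rfl

theorem psubst_comp_liftS (σ τ : ℕ → Tm) :
    psubst (liftS τ) ∘ liftS σ = liftS (psubst τ ∘ σ) := by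
  funext n
  cases n
  · rfl
  · exact psubst_shift _ _

theorem psubst_psubst (σ τ : ℕ → Tm) (t : Tm) :
    psubst τ (psubst σ t) = psubst (psubst τ ∘ σ) t := by
  induction t generalizing σ τ <;> simp_all [psubst, psubst_comp_liftS]

theorem liftS_var : liftS .var = .var := by
  funext n; cases n <;> rfl

theorem psubst_var (t : Tm) : psubst .var t = t := by
  induction t <;> simp_all [psubst, liftS_var]

theorem liftS_var_comp (f : ℕ → ℕ) : liftS (.var ∘ f) = .var ∘ liftN f := by
  funext n; cases n <;> rfl

theorem rename_eq_psubst (f : ℕ → ℕ) (t : Tm) : rename f t = psubst (.var ∘ f) t := by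
  induction t generalizing f <;> simp_all [rename, psubst, liftS_var_comp]

/-- The substitution instantiating the innermost value variable. -/
def inst (u : Tm) : ℕ → Tm
  | 0 => u
  | n + 1 => .var n

theorem subst0_eq (u t : Tm) : subst0 u t = psubst (inst u) t := by
  rw [subst0]; congr 1

theorem psubst_inst_shift (u t : Tm) : psubst (inst u) (shift t) = t := by
  rw [shift, psubst_rename]; exact psubst_var t

theorem psubst_subst0 (σ : ℕ → Tm) (u t : Tm) :
    psubst σ (subst0 u t) = subst0 (psubst σ u) (psubst (liftS σ) t) := by
  rw [subst0_eq, subst0_eq, psubst_psubst, psubst_psubst]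
  congr 1; funext n
  cases n
  · rfl
  · exact (psubst_inst_shift _ _).symm

/-- The stoup variable does not occur free. -/
def NoStoup : Tm → Prop
  | .var _ => True
  | .svar => False
  | .unit => True
  | .vpair t u => NoStoup t ∧ NoStoup u
  | .vfst t => NoStoup t
  | .vsnd t => NoStoup t
  | .vlam _ t => NoStoup t
  | .vapp s t => NoStoup s ∧ NoStoup t
  | .cunit => True
  | .cpair t u => NoStoup t ∧ NoStoup u
  | .cfst t => NoStoup t
  | .csnd t => NoStoup t
  | .clam _ t => NoStoup t
  | .capp s t => NoStoup s ∧ NoStoup t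
  | .top => True
  | .ilet t u => NoStoup t ∧ NoStoup u
  | .bang t => NoStoup t
  | .banglet t u => NoStoup t ∧ NoStoup u
  | .copow t u => NoStoup t ∧ NoStoup u
  | .copowlet s _ => NoStoup s
  | .cimage _ t => NoStoup t
  | .cinl t => NoStoup t
  | .cinr t => NoStoup t
  | .ccase s _ _ => NoStoup s
  | .llam _ _ => True
  | .lapp s t => NoStoup s ∧ NoStoup t

theorem NoStoup.ssubst {t : Tm} (h : NoStoup t) (u : Tm) : Tm.ssubst u t = t := by
  induction t generalizing u <;> simp_all [NoStoup, Tm.ssubst]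

theorem NoStoup.rename {t : Tm} (h : NoStoup t) (f : ℕ → ℕ) : NoStoup (Tm.rename f t) := by
  induction t generalizing f <;> simp_all [NoStoup, Tm.rename]

theorem NoStoup.liftS {σ : ℕ → Tm} (h : ∀ n, NoStoup (σ n)) (n : ℕ) :
    NoStoup (Tm.liftS σ n) := by
  cases n
  · trivial
  · exact (h _).rename _

theorem psubst_ssubst (σ : ℕ → Tm) (h : ∀ n, NoStoup (σ n)) (u t : Tm) :
    psubst σ (ssubst u t) = ssubst (psubst σ u) (psubst σ t) := by
  induction t generalizing σ u <;>
    simp_all [psubst, ssubst, NoStoup.liftS, psubst_shift, NoStoup.ssubst]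

theorem shift_ssubst (u t : Tm) : shift (ssubst u t) = ssubst (shift u) (shift t) := by
  simp only [shift, rename_eq_psubst]
  exact psubst_ssubst _ (fun _ => by trivial) _ _

theorem ssubst_ssubst (w u t : Tm) : ssubst w (ssubst u t) = ssubst (ssubst w u) t := by
  induction t generalizing w u <;> simp_all [ssubst, shift_ssubst]

theorem ssubst_svar (t : Tm) : ssubst .svar t = t := by
  induction t <;> simp_all [ssubst, shift, rename]

theorem NoStoup.inst {u : Tm} (h : NoStoup u) (n : ℕ) : NoStoup (Tm.inst u n) := by
  cases n
  · exact h
  · trivial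

theorem subst0_ssubst (w u t : Tm) (h : NoStoup u) :
    ssubst w (subst0 u t) = subst0 u (ssubst (shift w) t) := by
  rw [subst0_eq, subst0_eq, psubst_ssubst _ h.inst, psubst_inst_shift]

end Tm

/-- Typability, as a proposition. -/
def HasTy (Γ : List VType) (Δ : Option CType) (t : Tm) (A : VType) : Prop := Nonempty (Deriv Γ Δ t A)

theorem Deriv.noStoup {Γ Δ t A} (d : Deriv Γ Δ t A) (h : Δ = none) : t.NoStoup := by
  induction d <;> simp_all [Tm.NoStoup]

theorem HasTy.noStoup {Γ t A} (d : HasTy Γ none t A) : t.NoStoup := d.elim fun d => d.noStoup rfl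

theorem Deriv.rename {Γ Δ t A} (d : Deriv Γ Δ t A) : ∀ {Γ' : List VType} (f : ℕ → ℕ),
    (∀ n A, Γ[n]? = some A → Γ'[f n]? = some A) → HasTy Γ' Δ (t.rename f) A := by
  have lift : ∀ {Γ Γ' : List VType} {f : ℕ → ℕ} (B : VType),
      (∀ n A, Γ[n]? = some A → Γ'[f n]? = some A) →
      ∀ n A, (B :: Γ)[n]? = some A → (B :: Γ')[Tm.liftN f n]? = some A := by
    intro Γ Γ' f B h n A hn
    cases n
    · exact hn
    · exact h _ _ hn
  induction d <;> intro Γ' f hf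
  case var h => exact ⟨.var _ _ _ (hf _ _ h)⟩
  case vlam ih => exact (ih _ (lift _ hf)).elim fun d => ⟨.vlam _ _ _ _ d⟩
  case clam ih => exact (ih _ (lift _ hf)).elim fun d => ⟨.clam _ _ _ _ _ d⟩
  case banglet ih ih' =>
    obtain ⟨d⟩ := ih _ hf
    obtain ⟨d'⟩ := ih' _ (lift _ hf)
    exact ⟨.banglet _ _ _ _ _ _ d d'⟩
  case copowlet ih ih' =>
    obtain ⟨d⟩ := ih _ hf
    obtain ⟨d'⟩ := ih' _ (lift _ hf)
    exact ⟨.copowlet _ _ _ _ _ _ _ d d'⟩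
  case ccase ih ih' ih'' =>
    obtain ⟨d⟩ := ih _ hf
    obtain ⟨d'⟩ := ih' _ hf
    obtain ⟨d''⟩ := ih'' _ hf
    exact ⟨.ccase _ _ _ _ _ _ _ _ d d' d''⟩
  case svar | unit | cunit | top => exact ⟨by constructor⟩
  case vpair ih ih' | vapp ih ih' | cpair ih ih' | capp ih ih' | ilet ih ih' | copow ih ih' |
      lapp ih ih' =>
    obtain ⟨d⟩ := ih _ hf
    obtain ⟨d'⟩ := ih' _ hf
    exact ⟨by constructor <;> assumption⟩
  all_goals
    rename_i ih
    obtain ⟨d⟩ := ih _ hf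
    exact ⟨by constructor <;> assumption⟩

theorem HasTy.shift {Γ Δ t A} (d : HasTy Γ Δ t A) (B : VType) : HasTy (B :: Γ) Δ t.shift A :=
  d.elim fun d => d.rename _ fun _ _ h => h

/-- Well-typed raw substitutions. -/
def SubTy (Γ Γ' : List VType) (σ : ℕ → Tm) : Prop := ∀ n A, Γ[n]? = some A → HasTy Γ' none (σ n) A

theorem SubTy.lift {Γ Γ' σ} (h : SubTy Γ Γ' σ) (B : VType) :
    SubTy (B :: Γ) (B :: Γ') (Tm.liftS σ) := by
  intro n A hn
  cases n
  · exact ⟨.var _ _ _ hn⟩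
  · exact (h _ _ hn).shift B

theorem SubTy.inst {Γ u A} (h : HasTy Γ none u A) : SubTy (A :: Γ) Γ (Tm.inst u) := by
  intro n B hn
  cases n
  · cases hn; exact h
  · exact ⟨.var _ _ _ hn⟩

theorem Deriv.psubst {Γ Δ t A} (d : Deriv Γ Δ t A) : ∀ {Γ' : List VType} (σ : ℕ → Tm),
    SubTy Γ Γ' σ → HasTy Γ' Δ (t.psubst σ) A := by
  induction d <;> intro Γ' σ hf
  case var h => exact hf _ _ h
  case vlam ih => exact (ih _ (hf.lift _)).elim fun d => ⟨.vlam _ _ _ _ d⟩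
  case clam ih => exact (ih _ (hf.lift _)).elim fun d => ⟨.clam _ _ _ _ _ d⟩
  case banglet ih ih' =>
    obtain ⟨d⟩ := ih _ hf
    obtain ⟨d'⟩ := ih' _ (hf.lift _)
    exact ⟨.banglet _ _ _ _ _ _ d d'⟩
  case copowlet ih ih' =>
    obtain ⟨d⟩ := ih _ hf
    obtain ⟨d'⟩ := ih' _ (hf.lift _)
    exact ⟨.copowlet _ _ _ _ _ _ _ d d'⟩
  case ccase ih ih' ih'' =>
    obtain ⟨d⟩ := ih _ hf
    obtain ⟨d'⟩ := ih' _ hf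
    obtain ⟨d''⟩ := ih'' _ hf
    exact ⟨.ccase _ _ _ _ _ _ _ _ d d' d''⟩
  case svar | unit | cunit | top => exact ⟨by constructor⟩
  case vpair ih ih' | vapp ih ih' | cpair ih ih' | capp ih ih' | ilet ih ih' | copow ih ih' |
      lapp ih ih' =>
    obtain ⟨d⟩ := ih _ hf
    obtain ⟨d'⟩ := ih' _ hf
    exact ⟨by constructor <;> assumption⟩
  all_goals
    rename_i ih
    obtain ⟨d⟩ := ih _ hf
    exact ⟨by constructor <;> assumption⟩

theorem HasTy.psubst {Γ Γ' Δ t A σ} (d : HasTy Γ Δ t A) (h : SubTy Γ Γ' σ) :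
    HasTy Γ' Δ (t.psubst σ) A :=
  d.elim fun d => d.psubst σ h

/-- Stoup substitution preserves typability; a typing judgement whose stoup is empty is unaffected. -/
theorem Deriv.ssubst {Γ Δ t A} (d : Deriv Γ Δ t A) : ∀ {D : CType} {Δ' : Option CType} {u : Tm},
    Δ = some D → HasTy Γ Δ' u (.comp D) → HasTy Γ Δ' (Tm.ssubst u t) A := by
  induction d <;> intro D Δ' u hD hu
  case svar => cases hD; exact hu
  case cunit => exact ⟨.cunit _ _⟩
  case clam ih => exact (ih hD (hu.shift _)).elim fun d => ⟨.clam _ _ _ _ _ d⟩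
  case capp d' ih ih' =>
    obtain ⟨d⟩ := ih hD hu
    rw [Tm.ssubst, (d'.noStoup rfl).ssubst]
    exact ⟨.capp _ _ _ _ _ _ d d'⟩
  case ilet d' ih ih' =>
    obtain ⟨d⟩ := ih hD hu
    rw [Tm.ssubst, (d'.noStoup rfl).ssubst]
    exact ⟨.ilet _ _ _ _ _ d d'⟩
  case banglet d' ih ih' =>
    obtain ⟨d⟩ := ih hD hu
    rw [Tm.ssubst, (d'.noStoup rfl).ssubst]
    exact ⟨.banglet _ _ _ _ _ _ d d'⟩
  case copow d' _ ih ih' =>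
    obtain ⟨d⟩ := ih' hD hu
    rw [Tm.ssubst, (d'.noStoup rfl).ssubst]
    exact ⟨.copow _ _ _ _ _ _ d' d⟩
  case lapp d' _ ih ih' =>
    obtain ⟨d⟩ := ih' hD hu
    rw [Tm.ssubst, (d'.noStoup rfl).ssubst]
    exact ⟨.lapp _ _ _ _ _ _ d' d⟩
  case copowlet d' ih ih' =>
    obtain ⟨d⟩ := ih hD hu
    exact ⟨.copowlet _ _ _ _ _ _ _ d d'⟩
  case ccase d' d'' ih ih' ih'' =>
    obtain ⟨d⟩ := ih hD hu
    exact ⟨.ccase _ _ _ _ _ _ _ _ d d' d''⟩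
  case cpair ih ih' =>
    obtain ⟨d⟩ := ih hD hu
    obtain ⟨d'⟩ := ih' hD hu
    exact ⟨.cpair _ _ _ _ _ _ d d'⟩
  case cfst ih | csnd ih | cimage ih | cinl ih | cinr ih =>
    obtain ⟨d⟩ := ih hD hu
    exact ⟨by constructor <;> assumption⟩
  all_goals cases hD

theorem HasTy.ssubst {Γ Δ D t u A} (d : HasTy Γ (some D) t A) (hu : HasTy Γ Δ u (.comp D)) :
    HasTy Γ Δ (Tm.ssubst u t) A :=
  d.elim fun d => d.ssubst rfl hu

theorem EEq.psubst {Γ Δ t t' A} (e : EEq Γ Δ t t' A) : ∀ {Γ' : List VType} (σ : ℕ → Tm),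
    SubTy Γ Γ' σ → (∀ n, (σ n).NoStoup) → EEq Γ' Δ (t.psubst σ) (t'.psubst σ) A := by
  induction e <;> intro Γ' σ h hn
  case refl d => exact (d.psubst σ h).elim .refl
  case symm ih => exact (ih σ h hn).symm
  case trans ih ih' => exact (ih σ h hn).trans (ih' σ h hn)
  case vlam_cong ih => exact .vlam_cong (ih _ (h.lift _) (.liftS hn))
  case clam_cong ih => exact .clam_cong (ih _ (h.lift _) (.liftS hn))
  case banglet_cong ih ih' => exact .banglet_cong (ih _ h hn) (ih' _ (h.lift _) (.liftS hn))
  case copowlet_cong ih ih' => exact .copowlet_cong (ih _ h hn) (ih' _ (h.lift _) (.liftS hn))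
  case vpair_cong ih ih' => exact .vpair_cong (ih _ h hn) (ih' _ h hn)
  case vfst_cong ih => exact .vfst_cong (ih _ h hn)
  case vsnd_cong ih => exact .vsnd_cong (ih _ h hn)
  case vapp_cong ih ih' => exact .vapp_cong (ih _ h hn) (ih' _ h hn)
  case cpair_cong ih ih' => exact .cpair_cong (ih _ h hn) (ih' _ h hn)
  case cfst_cong ih => exact .cfst_cong (ih _ h hn)
  case csnd_cong ih => exact .csnd_cong (ih _ h hn)
  case capp_cong ih ih' => exact .capp_cong (ih _ h hn) (ih' _ h hn)
  case ilet_cong ih ih' => exact .ilet_cong (ih _ h hn) (ih' _ h hn)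
  case bang_cong ih => exact .bang_cong (ih _ h hn)
  case copow_cong ih ih' => exact .copow_cong (ih _ h hn) (ih' _ h hn)
  case cimage_cong ih => exact .cimage_cong (ih _ h hn)
  case cinl_cong ih => exact .cinl_cong (ih _ h hn)
  case cinr_cong ih => exact .cinr_cong (ih _ h hn)
  case ccase_cong ih ih' ih'' => exact .ccase_cong (ih _ h hn) (ih' _ h hn) (ih'' _ h hn)
  case llam_cong ih => exact .llam_cong (ih _ h hn)
  case lapp_cong ih ih' => exact .lapp_cong (ih _ h hn) (ih' _ h hn)
  case unit_eta d => exact (d.psubst σ h).elim .unit_eta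
  case vfst_beta d d' =>
    exact (d.psubst σ h).elim fun d => (d'.psubst σ h).elim fun d' => .vfst_beta d d'
  case vsnd_beta d d' =>
    exact (d.psubst σ h).elim fun d => (d'.psubst σ h).elim fun d' => .vsnd_beta d d'
  case vpair_eta d => exact (d.psubst σ h).elim .vpair_eta
  case vlam_beta d d' =>
    obtain ⟨d⟩ := d.psubst _ (h.lift _)
    obtain ⟨d'⟩ := d'.psubst σ h
    rw [Tm.psubst_subst0]
    exact .vlam_beta d d'
  case vlam_eta d =>
    obtain ⟨d⟩ := d.psubst σ h
    simp only [Tm.psubst, Tm.psubst_shift]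
    exact .vlam_eta d
  case cunit_eta d => exact (d.psubst σ h).elim .cunit_eta
  case cfst_beta d d' =>
    exact (d.psubst σ h).elim fun d => (d'.psubst σ h).elim fun d' => .cfst_beta d d'
  case csnd_beta d d' =>
    exact (d.psubst σ h).elim fun d => (d'.psubst σ h).elim fun d' => .csnd_beta d d'
  case cpair_eta d => exact (d.psubst σ h).elim .cpair_eta
  case clam_beta d d' =>
    obtain ⟨d⟩ := d.psubst _ (h.lift _)
    obtain ⟨d'⟩ := d'.psubst σ h
    rw [Tm.psubst_subst0]
    exact .clam_beta d d'
  case clam_eta d =>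
    obtain ⟨d⟩ := d.psubst σ h
    simp only [Tm.psubst, Tm.psubst_shift]
    exact .clam_eta d
  case ilet_beta d => exact (d.psubst σ h).elim .ilet_beta
  case ilet_eta d d' =>
    obtain ⟨d⟩ := d.psubst σ h
    obtain ⟨d'⟩ := d'.psubst σ h
    simp only [Tm.psubst, Tm.psubst_ssubst σ hn]
    exact .ilet_eta d d'
  case bang_beta d d' =>
    obtain ⟨d⟩ := d.psubst σ h
    obtain ⟨d'⟩ := d'.psubst _ (h.lift _)
    rw [Tm.psubst_subst0]
    exact .bang_beta d d'
  case bang_eta d d' =>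
    obtain ⟨d⟩ := d.psubst σ h
    obtain ⟨d'⟩ := d'.psubst σ h
    simp only [Tm.psubst, Tm.psubst_ssubst σ hn, Tm.psubst_ssubst _ (.liftS hn), Tm.psubst_shift]
    exact .bang_eta d d'
  case copow_beta d d' d'' =>
    obtain ⟨d⟩ := d.psubst σ h
    obtain ⟨d'⟩ := d'.psubst σ h
    obtain ⟨d''⟩ := d''.psubst _ (h.lift _)
    rw [Tm.psubst_ssubst σ hn, Tm.psubst_subst0]
    exact .copow_beta d d' d''
  case copow_eta d d' =>
    obtain ⟨d⟩ := d.psubst σ h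
    obtain ⟨d'⟩ := d'.psubst σ h
    simp only [Tm.psubst, Tm.psubst_ssubst σ hn, Tm.psubst_ssubst _ (.liftS hn), Tm.psubst_shift]
    exact .copow_eta d d'
  case czero_eta d d' =>
    obtain ⟨d⟩ := d.psubst σ h
    obtain ⟨d'⟩ := d'.psubst σ h
    rw [Tm.psubst_ssubst σ hn]
    exact .czero_eta d d'
  case csum_beta_inl d d' d'' =>
    obtain ⟨d⟩ := d.psubst σ h
    obtain ⟨d'⟩ := d'.psubst σ h
    obtain ⟨d''⟩ := d''.psubst σ h
    rw [Tm.psubst_ssubst σ hn]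
    exact .csum_beta_inl d d' d''
  case csum_beta_inr d d' d'' =>
    obtain ⟨d⟩ := d.psubst σ h
    obtain ⟨d'⟩ := d'.psubst σ h
    obtain ⟨d''⟩ := d''.psubst σ h
    rw [Tm.psubst_ssubst σ hn]
    exact .csum_beta_inr d d' d''
  case csum_eta d d' =>
    obtain ⟨d⟩ := d.psubst σ h
    obtain ⟨d'⟩ := d'.psubst σ h
    simp only [Tm.psubst, Tm.psubst_ssubst σ hn]
    exact .csum_eta d d'
  case llam_beta d d' =>
    obtain ⟨d⟩ := d.psubst σ h
    obtain ⟨d'⟩ := d'.psubst σ h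
    rw [Tm.psubst_ssubst σ hn]
    exact .llam_beta d d'
  case llam_eta d =>
    obtain ⟨d⟩ := d.psubst σ h
    exact .llam_eta d

theorem EEq.shift {Γ Δ t t' A} (e : EEq Γ Δ t t' A) (B : VType) :
    EEq (B :: Γ) Δ t.shift t'.shift A := by
  simp only [Tm.shift, Tm.rename_eq_psubst]
  exact e.psubst _ (fun _ _ h => ⟨.var _ _ _ h⟩) fun _ => trivial

/-- Well-typed pointwise equal raw substitutions. -/
def SubEq (Γ Γ' : List VType) (σ τ : ℕ → Tm) : Prop :=
  ∀ n A, Γ[n]? = some A → EEq Γ' none (σ n) (τ n) A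

theorem SubEq.lift {Γ Γ' σ τ} (h : SubEq Γ Γ' σ τ) (B : VType) :
    SubEq (B :: Γ) (B :: Γ') (Tm.liftS σ) (Tm.liftS τ) := by
  intro n A hn
  cases n
  · exact .refl (.var _ _ _ hn)
  · exact (h _ _ hn).shift B

theorem Deriv.psubst_congr {Γ Δ t A} (d : Deriv Γ Δ t A) : ∀ {Γ' : List VType} (σ τ : ℕ → Tm),
    SubEq Γ Γ' σ τ → EEq Γ' Δ (t.psubst σ) (t.psubst τ) A := by
  induction d <;> intro Γ' σ τ h
  case var hn => exact h _ _ hn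
  case svar => exact .refl (.svar _ _)
  case unit => exact .refl (.unit _)
  case cunit => exact .refl (.cunit _ _)
  case top => exact .refl (.top _)
  case vlam ih => exact .vlam_cong (ih _ _ (h.lift _))
  case clam ih => exact .clam_cong (ih _ _ (h.lift _))
  case banglet ih ih' => exact .banglet_cong (ih _ _ h) (ih' _ _ (h.lift _))
  case copowlet ih ih' => exact .copowlet_cong (ih _ _ h) (ih' _ _ (h.lift _))
  case vpair ih ih' => exact .vpair_cong (ih _ _ h) (ih' _ _ h)
  case vfst ih => exact .vfst_cong (ih _ _ h)
  case vsnd ih => exact .vsnd_cong (ih _ _ h)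
  case vapp ih ih' => exact .vapp_cong (ih _ _ h) (ih' _ _ h)
  case cpair ih ih' => exact .cpair_cong (ih _ _ h) (ih' _ _ h)
  case cfst ih => exact .cfst_cong (ih _ _ h)
  case csnd ih => exact .csnd_cong (ih _ _ h)
  case capp ih ih' => exact .capp_cong (ih _ _ h) (ih' _ _ h)
  case ilet ih ih' => exact .ilet_cong (ih _ _ h) (ih' _ _ h)
  case bang ih => exact .bang_cong (ih _ _ h)
  case copow ih ih' => exact .copow_cong (ih _ _ h) (ih' _ _ h)
  case cimage ih => exact .cimage_cong (ih _ _ h)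
  case cinl ih => exact .cinl_cong (ih _ _ h)
  case cinr ih => exact .cinr_cong (ih _ _ h)
  case ccase ih ih' ih'' => exact .ccase_cong (ih _ _ h) (ih' _ _ h) (ih'' _ _ h)
  case llam ih => exact .llam_cong (ih _ _ h)
  case lapp ih ih' => exact .lapp_cong (ih _ _ h) (ih' _ _ h)

theorem Deriv.ssubst_congr {Γ Δ t A} (d : Deriv Γ Δ t A) :
    ∀ {D : CType} {Δ' : Option CType} {u u' : Tm}, Δ = some D → EEq Γ Δ' u u' (.comp D) →
      EEq Γ Δ' (Tm.ssubst u t) (Tm.ssubst u' t) A := by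
  induction d <;> intro D Δ' u u' hD hu <;> simp only [Tm.ssubst]
  case svar => cases hD; exact hu
  case cunit => exact .refl (.cunit _ _)
  case clam ih => exact .clam_cong (ih hD (hu.shift _))
  case capp d' ih ih' =>
    rw [(d'.noStoup rfl).ssubst, (d'.noStoup rfl).ssubst]
    exact .capp_cong (ih hD hu) (.refl d')
  case ilet d' ih ih' =>
    rw [(d'.noStoup rfl).ssubst, (d'.noStoup rfl).ssubst]
    exact .ilet_cong (ih hD hu) (.refl d')
  case banglet d' ih ih' =>
    rw [(d'.noStoup rfl).ssubst, (d'.noStoup rfl).ssubst]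
    exact .banglet_cong (ih hD hu) (.refl d')
  case copow d' _ ih ih' =>
    rw [(d'.noStoup rfl).ssubst, (d'.noStoup rfl).ssubst]
    exact .copow_cong (.refl d') (ih' hD hu)
  case lapp d' _ ih ih' =>
    rw [(d'.noStoup rfl).ssubst, (d'.noStoup rfl).ssubst]
    exact .lapp_cong (.refl d') (ih' hD hu)
  case copowlet d' ih ih' => exact .copowlet_cong (ih hD hu) (.refl d')
  case ccase d' d'' ih ih' ih'' => exact .ccase_cong (ih hD hu) (.refl d') (.refl d'')
  case cpair ih ih' => exact .cpair_cong (ih hD hu) (ih' hD hu)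
  case cfst ih => exact .cfst_cong (ih hD hu)
  case csnd ih => exact .csnd_cong (ih hD hu)
  case cimage ih => exact .cimage_cong (ih hD hu)
  case cinl ih => exact .cinl_cong (ih hD hu)
  case cinr ih => exact .cinr_cong (ih hD hu)
  all_goals cases hD

theorem EEq.typed {Γ Δ t t' A} (e : EEq Γ Δ t t' A) : HasTy Γ Δ t A ∧ HasTy Γ Δ t' A := by
  induction e
  case refl d => exact ⟨⟨d⟩, ⟨d⟩⟩
  case symm ih => exact ih.symm
  case trans ih ih' => exact ⟨ih.1, ih'.2⟩
  case ccase_cong ih ih' ih'' =>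
    obtain ⟨⟨d⟩, ⟨e⟩⟩ := ih
    obtain ⟨⟨d'⟩, ⟨e'⟩⟩ := ih'
    obtain ⟨⟨d''⟩, ⟨e''⟩⟩ := ih''
    exact ⟨⟨.ccase _ _ _ _ _ _ _ _ d d' d''⟩, ⟨.ccase _ _ _ _ _ _ _ _ e e' e''⟩⟩
  case vpair_cong ih ih' | vapp_cong ih ih' | cpair_cong ih ih' | capp_cong ih ih' |
      ilet_cong ih ih' | banglet_cong ih ih' | copow_cong ih ih' | copowlet_cong ih ih' |
      lapp_cong ih ih' =>
    obtain ⟨⟨d⟩, ⟨e⟩⟩ := ih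
    obtain ⟨⟨d'⟩, ⟨e'⟩⟩ := ih'
    exact ⟨⟨by constructor <;> assumption⟩, ⟨by constructor <;> assumption⟩⟩
  case vfst_cong ih | vsnd_cong ih | vlam_cong ih | cfst_cong ih | csnd_cong ih | clam_cong ih |
      bang_cong ih | cimage_cong ih | cinl_cong ih | cinr_cong ih | llam_cong ih =>
    obtain ⟨⟨d⟩, ⟨e⟩⟩ := ih
    exact ⟨⟨by constructor <;> assumption⟩, ⟨by constructor <;> assumption⟩⟩
  case unit_eta d => exact ⟨⟨d⟩, ⟨.unit _⟩⟩
  case vfst_beta d d' => exact ⟨⟨.vfst _ _ _ _ (.vpair _ _ _ _ _ d d')⟩, ⟨d⟩⟩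
  case vsnd_beta d d' => exact ⟨⟨.vsnd _ _ _ _ (.vpair _ _ _ _ _ d d')⟩, ⟨d'⟩⟩
  case vpair_eta d => exact ⟨⟨.vpair _ _ _ _ _ (.vfst _ _ _ _ d) (.vsnd _ _ _ _ d)⟩, ⟨d⟩⟩
  case vlam_beta d d' =>
    refine ⟨⟨.vapp _ _ _ _ _ (.vlam _ _ _ _ d) d'⟩, ?_⟩
    rw [Tm.subst0_eq]; exact d.psubst _ (.inst ⟨d'⟩)
  case vlam_eta d =>
    obtain ⟨e⟩ := HasTy.shift ⟨d⟩ _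
    exact ⟨⟨.vlam _ _ _ _ (.vapp _ _ _ _ _ e (.var _ _ _ rfl))⟩, ⟨d⟩⟩
  case cunit_eta d => exact ⟨⟨d⟩, ⟨.cunit _ _⟩⟩
  case cfst_beta d d' => exact ⟨⟨.cfst _ _ _ _ _ (.cpair _ _ _ _ _ _ d d')⟩, ⟨d⟩⟩
  case csnd_beta d d' => exact ⟨⟨.csnd _ _ _ _ _ (.cpair _ _ _ _ _ _ d d')⟩, ⟨d'⟩⟩
  case cpair_eta d =>
    exact ⟨⟨.cpair _ _ _ _ _ _ (.cfst _ _ _ _ _ d) (.csnd _ _ _ _ _ d)⟩, ⟨d⟩⟩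
  case clam_beta d d' =>
    refine ⟨⟨.capp _ _ _ _ _ _ (.clam _ _ _ _ _ d) d'⟩, ?_⟩
    rw [Tm.subst0_eq]; exact d.psubst _ (.inst ⟨d'⟩)
  case clam_eta d =>
    obtain ⟨e⟩ := HasTy.shift ⟨d⟩ _
    exact ⟨⟨.clam _ _ _ _ _ (.capp _ _ _ _ _ _ e (.var _ _ _ rfl))⟩, ⟨d⟩⟩
  case ilet_beta d => exact ⟨⟨.ilet _ _ _ _ _ (.top _) d⟩, ⟨d⟩⟩
  case ilet_eta d d' =>
    obtain ⟨e⟩ := d'.ssubst rfl ⟨.top _⟩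
    exact ⟨⟨.ilet _ _ _ _ _ d e⟩, d'.ssubst rfl ⟨d⟩⟩
  case bang_beta d d' =>
    refine ⟨⟨.banglet _ _ _ _ _ _ (.bang _ _ _ d) d'⟩, ?_⟩
    rw [Tm.subst0_eq]; exact d'.psubst _ (.inst ⟨d⟩)
  case bang_eta d d' =>
    obtain ⟨e⟩ := HasTy.ssubst (HasTy.shift ⟨d'⟩ _) ⟨.bang _ _ _ (.var _ 0 _ rfl)⟩
    exact ⟨⟨.banglet _ _ _ _ _ _ d e⟩, d'.ssubst rfl ⟨d⟩⟩
  case copow_beta d d' d'' =>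
    refine ⟨⟨.copowlet _ _ _ _ _ _ _ (.copow _ _ _ _ _ _ d d') d''⟩, ?_⟩
    rw [Tm.subst0_eq]; exact (d''.psubst _ (.inst ⟨d⟩)).ssubst ⟨d'⟩
  case copow_eta d d' =>
    obtain ⟨e⟩ := HasTy.ssubst (HasTy.shift ⟨d'⟩ _)
      ⟨.copow _ _ _ _ _ _ (.var _ 0 _ rfl) (.svar _ _)⟩
    exact ⟨⟨.copowlet _ _ _ _ _ _ _ d e⟩, d'.ssubst rfl ⟨d⟩⟩
  case czero_eta d d' => exact ⟨⟨.cimage _ _ _ _ d⟩, d'.ssubst rfl ⟨d⟩⟩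
  case csum_beta_inl d d' d'' =>
    exact ⟨⟨.ccase _ _ _ _ _ _ _ _ (.cinl _ _ _ _ _ d'') d d'⟩, d.ssubst rfl ⟨d''⟩⟩
  case csum_beta_inr d d' d'' =>
    exact ⟨⟨.ccase _ _ _ _ _ _ _ _ (.cinr _ _ _ _ _ d'') d d'⟩, d'.ssubst rfl ⟨d''⟩⟩
  case csum_eta d d' =>
    obtain ⟨e⟩ := d'.ssubst rfl ⟨.cinl _ _ _ _ _ (.svar _ _)⟩
    obtain ⟨e'⟩ := d'.ssubst rfl ⟨.cinr _ _ _ _ _ (.svar _ _)⟩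
    exact ⟨⟨.ccase _ _ _ _ _ _ _ _ d e e'⟩, d'.ssubst rfl ⟨d⟩⟩
  case llam_beta d d' => exact ⟨⟨.lapp _ _ _ _ _ _ (.llam _ _ _ _ d) d'⟩, d.ssubst rfl ⟨d'⟩⟩
  case llam_eta d => exact ⟨⟨.llam _ _ _ _ (.lapp _ _ _ _ _ _ d (.svar _ _))⟩, ⟨d⟩⟩

theorem EEq.ssubst {Γ Δ t t' A} (e : EEq Γ Δ t t' A) :
    ∀ {D : CType} {Δ' : Option CType} {u : Tm}, Δ = some D → HasTy Γ Δ' u (.comp D) →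
      EEq Γ Δ' (Tm.ssubst u t) (Tm.ssubst u t') A := by
  induction e <;> intro D Δ' w hD hu
  case refl d => exact (d.ssubst hD hu).elim .refl
  case symm ih => exact (ih hD hu).symm
  case trans ih ih' => exact (ih hD hu).trans (ih' hD hu)
  all_goals first | (cases hD; done) | simp only [Tm.ssubst]
  case cpair_cong ih ih' => exact .cpair_cong (ih hD hu) (ih' hD hu)
  case cfst_cong ih => exact .cfst_cong (ih hD hu)
  case csnd_cong ih => exact .csnd_cong (ih hD hu)
  case clam_cong ih => exact .clam_cong (ih hD (hu.shift _))
  case capp_cong e ih ih' =>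
    rw [e.typed.1.noStoup.ssubst, e.typed.2.noStoup.ssubst]
    exact .capp_cong (ih hD hu) e
  case ilet_cong e ih ih' =>
    rw [e.typed.1.noStoup.ssubst, e.typed.2.noStoup.ssubst]
    exact .ilet_cong (ih hD hu) e
  case banglet_cong e ih ih' =>
    rw [e.typed.1.noStoup.ssubst, e.typed.2.noStoup.ssubst]
    exact .banglet_cong (ih hD hu) e
  case copow_cong e _ ih ih' =>
    rw [e.typed.1.noStoup.ssubst, e.typed.2.noStoup.ssubst]
    exact .copow_cong e (ih' hD hu)
  case lapp_cong e _ ih ih' =>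
    rw [e.typed.1.noStoup.ssubst, e.typed.2.noStoup.ssubst]
    exact .lapp_cong e (ih' hD hu)
  case copowlet_cong e ih ih' => exact .copowlet_cong (ih hD hu) e
  case cimage_cong ih => exact .cimage_cong (ih hD hu)
  case cinl_cong ih => exact .cinl_cong (ih hD hu)
  case cinr_cong ih => exact .cinr_cong (ih hD hu)
  case ccase_cong e e' ih ih' ih'' => exact .ccase_cong (ih hD hu) e e'
  case cunit_eta d => exact (d.ssubst hD hu).elim .cunit_eta
  case cfst_beta d d' =>
    exact (d.ssubst hD hu).elim fun d => (d'.ssubst hD hu).elim fun d' => .cfst_beta d d'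
  case csnd_beta d d' =>
    exact (d.ssubst hD hu).elim fun d => (d'.ssubst hD hu).elim fun d' => .csnd_beta d d'
  case cpair_eta d => exact (d.ssubst hD hu).elim .cpair_eta
  case clam_beta d d' =>
    obtain ⟨d⟩ := d.ssubst hD (hu.shift _)
    rw [Tm.subst0_ssubst _ _ _ (d'.noStoup rfl), (d'.noStoup rfl).ssubst]
    exact .clam_beta d d'
  case clam_eta d =>
    obtain ⟨d⟩ := d.ssubst hD hu
    rw [← Tm.shift_ssubst]
    exact .clam_eta d
  case ilet_eta d d' =>
    obtain ⟨d⟩ := d.ssubst hD hu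
    simp only [Tm.ssubst_ssubst]
    exact .ilet_eta d d'
  case bang_eta d d' =>
    obtain ⟨d⟩ := d.ssubst hD hu
    simp only [Tm.ssubst_ssubst]
    exact .bang_eta d d'
  case copow_beta d d' d'' =>
    obtain ⟨d'⟩ := d'.ssubst hD hu
    rw [Tm.ssubst_ssubst, (d.noStoup rfl).ssubst]
    exact .copow_beta d d' d''
  case copow_eta d d' =>
    obtain ⟨d⟩ := d.ssubst hD hu
    simp only [Tm.ssubst_ssubst]
    exact .copow_eta d d'
  case czero_eta d d' =>
    obtain ⟨d⟩ := d.ssubst hD hu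
    rw [Tm.ssubst_ssubst]
    exact .czero_eta d d'
  case csum_beta_inl d d' d'' =>
    obtain ⟨d''⟩ := d''.ssubst hD hu
    rw [Tm.ssubst_ssubst]
    exact .csum_beta_inl d d' d''
  case csum_beta_inr d d' d'' =>
    obtain ⟨d''⟩ := d''.ssubst hD hu
    rw [Tm.ssubst_ssubst]
    exact .csum_beta_inr d d' d''
  case csum_eta d d' =>
    obtain ⟨d⟩ := d.ssubst hD hu
    rw [Tm.ssubst_ssubst]
    exact .csum_eta d d'
  case llam_beta d d' =>
    obtain ⟨d'⟩ := d'.ssubst hD hu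
    rw [Tm.ssubst_ssubst]
    exact .llam_beta d d'

/-- Terms of a given type in a given context up to provable equality. -/
def tmSetoid (Γ : List VType) (Δ : Option CType) (A : VType) : Setoid {t // HasTy Γ Δ t A} where
  r t u := EEq Γ Δ t.1 u.1 A
  iseqv := ⟨fun t => t.2.elim .refl, .symm, .trans⟩

/-- Terms of a given type in a given context up to provable equality. -/
def Q (Γ : List VType) (Δ : Option CType) (A : VType) : Type := Quotient (tmSetoid Γ Δ A)

namespace Q

variable {Γ Γ' Γ'' : List VType} {Δ : Option CType} {A B : VType} {C D X : CType}

def mk (t : Tm) (h : HasTy Γ Δ t A) : Q Γ Δ A := Quotient.mk (tmSetoid Γ Δ A) ⟨t, h⟩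

theorem sound {t u : Tm} (e : EEq Γ Δ t u A) : (mk t e.typed.1 : Q Γ Δ A) = mk u e.typed.2 :=
  Quotient.sound (s := tmSetoid Γ Δ A) e

theorem exact {t u : Tm} {h : HasTy Γ Δ t A} {h' : HasTy Γ Δ u A} (e : mk t h = mk u h') :
    EEq Γ Δ t u A := Quotient.exact (s := tmSetoid Γ Δ A) e

theorem mk_congr {t u : Tm} {h : HasTy Γ Δ t A} {h' : HasTy Γ Δ u A} (e : t = u) :
    mk t h = mk u h' := by subst e; rfl

theorem ind {p : Q Γ Δ A → Prop} (h : ∀ t ht, p (mk t ht)) (q : Q Γ Δ A) : p q :=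
  Quotient.ind (fun t => h t.1 t.2) q

/-- A raw representative. -/
noncomputable def out (q : Q Γ Δ A) : Tm := (Quotient.out q).1

theorem out_ty (q : Q Γ Δ A) : HasTy Γ Δ q.out A := (Quotient.out q).2

theorem mk_out (q : Q Γ Δ A) : mk q.out q.out_ty = q := Quotient.out_eq q

def var (n : ℕ) (A : VType) (h : Γ[n]? = some A) : Q Γ none A := mk (.var n) ⟨.var _ _ _ h⟩
def v0 : Q (A :: Γ) none A := var 0 A rfl
def svar : Q Γ (some C) (.comp C) := mk .svar ⟨.svar _ _⟩
def unit : Q Γ none .unit := mk .unit ⟨.unit _⟩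
def vpair : Q Γ none A → Q Γ none B → Q Γ none (.prod A B) :=
  Quotient.map₂ (fun t u => ⟨.vpair t.1 u.1, t.2.elim fun d => u.2.elim fun e => ⟨.vpair _ _ _ _ _ d e⟩⟩)
    fun _ _ e _ _ e' => EEq.vpair_cong e e'
def vfst : Q Γ none (.prod A B) → Q Γ none A :=
  Quotient.map (fun t => ⟨.vfst t.1, t.2.elim fun d => ⟨.vfst _ _ _ _ d⟩⟩)
    fun _ _ e => EEq.vfst_cong e
def vsnd : Q Γ none (.prod A B) → Q Γ none B :=
  Quotient.map (fun t => ⟨.vsnd t.1, t.2.elim fun d => ⟨.vsnd _ _ _ _ d⟩⟩)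
    fun _ _ e => EEq.vsnd_cong e
def vlam : Q (A :: Γ) none B → Q Γ none (.arr A B) :=
  Quotient.map (fun t => ⟨.vlam A t.1, t.2.elim fun d => ⟨.vlam _ _ _ _ d⟩⟩)
    fun _ _ e => EEq.vlam_cong e
def vapp : Q Γ none (.arr A B) → Q Γ none A → Q Γ none B :=
  Quotient.map₂ (fun t u => ⟨.vapp t.1 u.1, t.2.elim fun d => u.2.elim fun e => ⟨.vapp _ _ _ _ _ d e⟩⟩)
    fun _ _ e _ _ e' => EEq.vapp_cong e e'
def cunit : Q Γ Δ (.comp .cunit) := mk .cunit ⟨.cunit _ _⟩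
def cpair : Q Γ Δ (.comp C) → Q Γ Δ (.comp D) → Q Γ Δ (.comp (.cand C D)) :=
  Quotient.map₂ (fun t u => ⟨.cpair t.1 u.1, t.2.elim fun d => u.2.elim fun e => ⟨.cpair _ _ _ _ _ _ d e⟩⟩)
    fun _ _ e _ _ e' => EEq.cpair_cong e e'
def cfst : Q Γ Δ (.comp (.cand C D)) → Q Γ Δ (.comp C) :=
  Quotient.map (fun t => ⟨.cfst t.1, t.2.elim fun d => ⟨.cfst _ _ _ _ _ d⟩⟩)
    fun _ _ e => EEq.cfst_cong e
def csnd : Q Γ Δ (.comp (.cand C D)) → Q Γ Δ (.comp D) :=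
  Quotient.map (fun t => ⟨.csnd t.1, t.2.elim fun d => ⟨.csnd _ _ _ _ _ d⟩⟩)
    fun _ _ e => EEq.csnd_cong e
def clam : Q (A :: Γ) Δ (.comp C) → Q Γ Δ (.comp (.carr A C)) :=
  Quotient.map (fun t => ⟨.clam A t.1, t.2.elim fun d => ⟨.clam _ _ _ _ _ d⟩⟩)
    fun _ _ e => EEq.clam_cong e
def capp : Q Γ Δ (.comp (.carr A C)) → Q Γ none A → Q Γ Δ (.comp C) :=
  Quotient.map₂ (fun t u => ⟨.capp t.1 u.1, t.2.elim fun d => u.2.elim fun e => ⟨.capp _ _ _ _ _ _ d e⟩⟩)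
    fun _ _ e _ _ e' => EEq.capp_cong e e'
def top : Q Γ none (.comp .iunit) := mk .top ⟨.top _⟩
def ilet : Q Γ Δ (.comp .iunit) → Q Γ none (.comp C) → Q Γ Δ (.comp C) :=
  Quotient.map₂ (fun t u => ⟨.ilet t.1 u.1, t.2.elim fun d => u.2.elim fun e => ⟨.ilet _ _ _ _ _ d e⟩⟩)
    fun _ _ e _ _ e' => EEq.ilet_cong e e'
def bang : Q Γ none A → Q Γ none (.comp (.bang A)) :=
  Quotient.map (fun t => ⟨.bang t.1, t.2.elim fun d => ⟨.bang _ _ _ d⟩⟩)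
    fun _ _ e => EEq.bang_cong e
def banglet : Q Γ Δ (.comp (.bang A)) → Q (A :: Γ) none (.comp C) → Q Γ Δ (.comp C) :=
  Quotient.map₂ (fun t u => ⟨.banglet t.1 u.1, t.2.elim fun d => u.2.elim fun e => ⟨.banglet _ _ _ _ _ _ d e⟩⟩)
    fun _ _ e _ _ e' => EEq.banglet_cong e e'
def copow : Q Γ none A → Q Γ Δ (.comp C) → Q Γ Δ (.comp (.copow A C)) :=
  Quotient.map₂ (fun t u => ⟨.copow t.1 u.1, t.2.elim fun d => u.2.elim fun e => ⟨.copow _ _ _ _ _ _ d e⟩⟩)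
    fun _ _ e _ _ e' => EEq.copow_cong e e'
def copowlet : Q Γ Δ (.comp (.copow A C)) → Q (A :: Γ) (some C) (.comp D) → Q Γ Δ (.comp D) :=
  Quotient.map₂ (fun t u => ⟨.copowlet t.1 u.1, t.2.elim fun d => u.2.elim fun e => ⟨.copowlet _ _ _ _ _ _ _ d e⟩⟩)
    fun _ _ e _ _ e' => EEq.copowlet_cong e e'
def cimage : Q Γ Δ (.comp .czero) → Q Γ Δ (.comp C) :=
  Quotient.map (fun t => ⟨.cimage C t.1, t.2.elim fun d => ⟨.cimage _ _ _ _ d⟩⟩)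
    fun _ _ e => EEq.cimage_cong e
def cinl : Q Γ Δ (.comp C) → Q Γ Δ (.comp (.csum C D)) :=
  Quotient.map (fun t => ⟨.cinl t.1, t.2.elim fun d => ⟨.cinl _ _ _ _ _ d⟩⟩)
    fun _ _ e => EEq.cinl_cong e
def cinr : Q Γ Δ (.comp D) → Q Γ Δ (.comp (.csum C D)) :=
  Quotient.map (fun t => ⟨.cinr t.1, t.2.elim fun d => ⟨.cinr _ _ _ _ _ d⟩⟩)
    fun _ _ e => EEq.cinr_cong e
def ccase (s : Q Γ Δ (.comp (.csum C D))) (t : Q Γ (some C) (.comp X)) (u : Q Γ (some D) (.comp X)) :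
    Q Γ Δ (.comp X) :=
  Quotient.liftOn s (fun s => Quotient.liftOn₂ t u (fun t u => mk (.ccase s.1 t.1 u.1)
    (s.2.elim fun d => t.2.elim fun e => u.2.elim fun f => ⟨.ccase _ _ _ _ _ _ _ _ d e f⟩))
    fun _ _ _ _ e e' => sound (EEq.ccase_cong (s.2.elim .refl) e e'))
    fun _ _ e => by
      induction t using ind with | _ t ht
      induction u using ind with | _ u hu
      exact sound (EEq.ccase_cong e (ht.elim .refl) (hu.elim .refl))
def llam : Q Γ (some C) (.comp D) → Q Γ none (.lin C D) :=
  Quotient.map (fun t => ⟨.llam C t.1, t.2.elim fun d => ⟨.llam _ _ _ _ d⟩⟩)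
    fun _ _ e => EEq.llam_cong e
def lapp : Q Γ none (.lin C D) → Q Γ Δ (.comp C) → Q Γ Δ (.comp D) :=
  Quotient.map₂ (fun t u => ⟨.lapp t.1 u.1, t.2.elim fun d => u.2.elim fun e => ⟨.lapp _ _ _ _ _ _ d e⟩⟩)
    fun _ _ e _ _ e' => EEq.lapp_cong e e'

/-- Stoup substitution. -/
def ss : Q Γ Δ (.comp C) → Q Γ (some C) A → Q Γ Δ A :=
  Quotient.map₂ (fun u t => ⟨Tm.ssubst u.1 t.1, t.2.ssubst u.2⟩) fun u _ e t _ e' =>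
    (u.2.elim fun _ => t.2.elim fun d => (d.ssubst_congr rfl e).trans (e'.ssubst rfl e.typed.2))

end Q

/-- Substitutions up to provable equality. -/
def Sub (Γ Γ' : List VType) : Type :=
  ∀ (n : ℕ) (A : VType), Γ[n]? = some A → Q Γ' none A

namespace Sub

variable {Γ Γ' Γ'' : List VType} {A : VType}

/-- A raw representative. -/
noncomputable def raw (σ : Sub Γ Γ') (n : ℕ) : Tm :=
  match h : Γ[n]? with
  | some A => (σ n A h).out
  | none => .unit

theorem raw_eq (σ : Sub Γ Γ') (n : ℕ) (A : VType) (h : Γ[n]? = some A) :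
    σ.raw n = (σ n A h).out := by
  unfold raw
  split
  · rename_i B h'
    cases h.symm.trans h'
    rfl
  · rename_i h'
    cases h.symm.trans h'

theorem raw_ty (σ : Sub Γ Γ') : SubTy Γ Γ' σ.raw := by
  intro n A h
  rw [raw_eq _ _ _ h]
  exact Q.out_ty _

theorem raw_noStoup (σ : Sub Γ Γ') (n : ℕ) : (σ.raw n).NoStoup := by
  rcases h : Γ[n]? with _ | A
  · unfold raw
    split
    · rename_i h'
      cases h.symm.trans h'
    · trivial
  · exact (σ.raw_ty n A h).noStoup

def id : Sub Γ Γ := Q.var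
def wk : Sub Γ (A :: Γ) := fun n B h => Q.var (n + 1) B h
def cons (a : Q Γ' none A) (σ : Sub Γ Γ') : Sub (A :: Γ) Γ'
  | 0, _, h => Option.some.inj h ▸ a
  | n + 1, B, h => σ n B h

@[simp] theorem cons_zero (a : Q Γ' none A) (σ : Sub Γ Γ') : cons a σ 0 A rfl = a := rfl

end Sub

namespace Q
variable {Γ Γ' Γ'' : List VType} {Δ : Option CType} {A B : VType} {C D X Y : CType}

noncomputable def sub (σ : Sub Γ Γ') : Q Γ Δ A → Q Γ' Δ A :=
  Quotient.map (fun t => ⟨t.1.psubst σ.raw, t.2.psubst σ.raw_ty⟩)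
    fun _ _ e => EEq.psubst e _ σ.raw_ty σ.raw_noStoup

/-- Weakening by one value variable. -/
noncomputable abbrev up (B : VType) (q : Q Γ Δ A) : Q (B :: Γ) Δ A := sub Sub.wk q

end Q

namespace Sub
variable {Γ Γ' Γ'' Γ₃ : List VType} {A : VType}

noncomputable def comp (σ : Sub Γ Γ') (τ : Sub Γ' Γ'') : Sub Γ Γ'' := fun n A h => (σ n A h).sub τ
noncomputable def lift (A : VType) (σ : Sub Γ Γ') : Sub (A :: Γ) (A :: Γ') := cons Q.v0 (σ.comp wk)
def inst (a : Q Γ none A) : Sub (A :: Γ) Γ := cons a id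

/-- A raw substitution representing `σ`. -/
def Rep (σ : Sub Γ Γ') (s : ℕ → Tm) : Prop :=
  ∀ n A h, ∃ hs : HasTy Γ' none (s n) A, σ n A h = Q.mk (s n) hs

theorem rep_raw (σ : Sub Γ Γ') : σ.Rep σ.raw := by
  intro n A h
  refine ⟨σ.raw_ty n A h, ?_⟩
  have : ∀ t (ht : HasTy Γ' none t A), t = (σ n A h).out → σ n A h = Q.mk t ht := by
    rintro _ _ rfl
    exact (Q.mk_out _).symm
  exact this _ _ (raw_eq _ _ _ h)

theorem Rep.ty {σ : Sub Γ Γ'} {s} (h : σ.Rep s) : SubTy Γ Γ' s := fun n A hn => (h n A hn).1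

end Sub

namespace Q
variable {Γ Γ' Γ'' : List VType} {Δ : Option CType} {A B : VType} {C D X Y : CType}

theorem sub_mk {σ : Sub Γ Γ'} {s : ℕ → Tm} (hs : σ.Rep s) (t : Tm) (ht : HasTy Γ Δ t A) :
    sub σ (mk t ht) = mk (t.psubst s) (ht.psubst hs.ty) := by
  refine sound (ht.elim fun d => d.psubst_congr _ _ fun n A h => ?_)
  obtain ⟨h1, h2⟩ := hs n A h
  obtain ⟨h3, h4⟩ := σ.rep_raw n A h
  exact exact (h4.symm.trans h2)

theorem sub_mk_raw (σ : Sub Γ Γ') (t : Tm) (ht : HasTy Γ Δ t A) :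
    sub σ (mk t ht) = mk (t.psubst σ.raw) (ht.psubst σ.raw_ty) := rfl

end Q

namespace Sub
variable {Γ Γ' Γ'' Γ₃ : List VType} {A : VType}

theorem rep_id : (id : Sub Γ Γ).Rep .var := fun _ _ h => ⟨⟨.var _ _ _ h⟩, rfl⟩
theorem rep_wk : (wk : Sub Γ (A :: Γ)).Rep (fun n => .var (n + 1)) :=
  fun _ _ h => ⟨⟨.var _ _ _ h⟩, rfl⟩
theorem Rep.inst (t : Tm) (ht : HasTy Γ none t A) : (inst (Q.mk t ht)).Rep (Tm.inst t) := by
  intro n B h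
  cases n
  · cases h; exact ⟨ht, rfl⟩
  · exact ⟨⟨.var _ _ _ h⟩, rfl⟩

end Sub

theorem Tm.psubst_wk (t : Tm) : t.psubst (fun n => .var (n + 1)) = t.shift := by
  rw [Tm.shift, Tm.rename_eq_psubst]; rfl

namespace Q
variable {Γ Γ' Γ'' : List VType} {Δ : Option CType} {A B : VType} {C D X Y : CType}

theorem up_mk (t : Tm) (ht : HasTy Γ Δ t A) : up B (mk t ht) = mk t.shift (ht.shift B) := by
  rw [up, sub_mk Sub.rep_wk]; simp only [Tm.psubst_wk]

end Q

namespace Sub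
variable {Γ Γ' Γ'' Γ₃ : List VType} {A : VType}

theorem Rep.lift {σ : Sub Γ Γ'} {s} (h : σ.Rep s) (B : VType) : (σ.lift B).Rep (Tm.liftS s) := by
  intro n A hn
  cases n
  · cases hn; exact ⟨⟨.var _ _ _ rfl⟩, rfl⟩
  · obtain ⟨h1, h2⟩ := h _ _ hn
    refine ⟨h1.shift _, ?_⟩
    change Q.sub wk (σ _ A hn) = _
    rw [h2]
    exact Q.up_mk _ _

end Sub

namespace Q
variable {Γ Γ' Γ'' : List VType} {Δ : Option CType} {A B : VType} {C D X Y : CType}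

@[simp] theorem sub_var (σ : Sub Γ Γ') (n h) : sub σ (var n A h) = σ n A h := by
  obtain ⟨h1, h2⟩ := σ.rep_raw n A h
  rw [h2]; rfl
@[simp] theorem sub_v0 (σ : Sub (A :: Γ) Γ') : sub σ v0 = σ 0 A rfl := sub_var ..
@[simp] theorem sub_id (q : Q Γ Δ A) : sub .id q = q := by
  induction q using ind; rw [sub_mk Sub.rep_id]; simp only [Tm.psubst_var]
@[simp] theorem sub_sub (σ : Sub Γ Γ') (τ : Sub Γ' Γ'') (q : Q Γ Δ A) :
    sub τ (sub σ q) = sub (σ.comp τ) q := by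
  induction q using ind
  rw [sub_mk_raw, sub_mk_raw, sub_mk (s := Tm.psubst τ.raw ∘ σ.raw)]
  · simp only [Tm.psubst_psubst]
  · intro n A h
    obtain ⟨h1, h2⟩ := σ.rep_raw n A h
    refine ⟨h1.psubst τ.raw_ty, ?_⟩
    rw [Sub.comp, h2]; rfl
@[simp] theorem sub_svar (σ : Sub Γ Γ') : sub σ (svar : Q Γ (some C) _) = svar := rfl
@[simp] theorem sub_unit (σ : Sub Γ Γ') : sub σ unit = unit := rfl
@[simp] theorem sub_cunit (σ : Sub Γ Γ') : sub σ (cunit : Q Γ Δ _) = cunit := rfl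
@[simp] theorem sub_top (σ : Sub Γ Γ') : sub σ top = top := rfl
@[simp] theorem sub_vpair (σ : Sub Γ Γ') (a : Q Γ none A) (b : Q Γ none B) :
    sub σ (vpair a b) = vpair (sub σ a) (sub σ b) := by
  induction a using ind; induction b using ind; rfl
@[simp] theorem sub_vfst (σ : Sub Γ Γ') (a : Q Γ none (.prod A B)) :
    sub σ (vfst a) = vfst (sub σ a) := by induction a using ind; rfl
@[simp] theorem sub_vsnd (σ : Sub Γ Γ') (a : Q Γ none (.prod A B)) :
    sub σ (vsnd a) = vsnd (sub σ a) := by induction a using ind; rfl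
@[simp] theorem sub_vlam (σ : Sub Γ Γ') (a : Q (A :: Γ) none B) :
    sub σ (vlam a) = vlam (sub (σ.lift A) a) := by
  induction a using ind; rw [sub_mk (σ.rep_raw.lift A)]; rfl
@[simp] theorem sub_vapp (σ : Sub Γ Γ') (a : Q Γ none (.arr A B)) (b : Q Γ none A) :
    sub σ (vapp a b) = vapp (sub σ a) (sub σ b) := by
  induction a using ind; induction b using ind; rfl
@[simp] theorem sub_cpair (σ : Sub Γ Γ') (a : Q Γ Δ (.comp C)) (b : Q Γ Δ (.comp D)) :
    sub σ (cpair a b) = cpair (sub σ a) (sub σ b) := by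
  induction a using ind; induction b using ind; rfl
@[simp] theorem sub_cfst (σ : Sub Γ Γ') (a : Q Γ Δ (.comp (.cand C D))) :
    sub σ (cfst a) = cfst (sub σ a) := by induction a using ind; rfl
@[simp] theorem sub_csnd (σ : Sub Γ Γ') (a : Q Γ Δ (.comp (.cand C D))) :
    sub σ (csnd a) = csnd (sub σ a) := by induction a using ind; rfl
@[simp] theorem sub_clam (σ : Sub Γ Γ') (a : Q (A :: Γ) Δ (.comp C)) :
    sub σ (clam a) = clam (sub (σ.lift A) a) := by
  induction a using ind; rw [sub_mk (σ.rep_raw.lift A)]; rfl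
@[simp] theorem sub_capp (σ : Sub Γ Γ') (a : Q Γ Δ (.comp (.carr A C))) (b : Q Γ none A) :
    sub σ (capp a b) = capp (sub σ a) (sub σ b) := by
  induction a using ind; induction b using ind; rfl
@[simp] theorem sub_ilet (σ : Sub Γ Γ') (a : Q Γ Δ (.comp .iunit)) (b : Q Γ none (.comp C)) :
    sub σ (ilet a b) = ilet (sub σ a) (sub σ b) := by
  induction a using ind; induction b using ind; rfl
@[simp] theorem sub_bang (σ : Sub Γ Γ') (a : Q Γ none A) :
    sub σ (bang a) = bang (sub σ a) := by induction a using ind; rfl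
@[simp] theorem sub_banglet (σ : Sub Γ Γ') (a : Q Γ Δ (.comp (.bang A)))
    (b : Q (A :: Γ) none (.comp C)) :
    sub σ (banglet a b) = banglet (sub σ a) (sub (σ.lift A) b) := by
  induction a using ind; induction b using ind; rw [sub_mk (σ.rep_raw.lift A)]; rfl
@[simp] theorem sub_copow (σ : Sub Γ Γ') (a : Q Γ none A) (b : Q Γ Δ (.comp C)) :
    sub σ (copow a b) = copow (sub σ a) (sub σ b) := by
  induction a using ind; induction b using ind; rfl
@[simp] theorem sub_copowlet (σ : Sub Γ Γ') (a : Q Γ Δ (.comp (.copow A C)))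
    (b : Q (A :: Γ) (some C) (.comp D)) :
    sub σ (copowlet a b) = copowlet (sub σ a) (sub (σ.lift A) b) := by
  induction a using ind; induction b using ind; rw [sub_mk (σ.rep_raw.lift A)]; rfl
@[simp] theorem sub_cimage (σ : Sub Γ Γ') (a : Q Γ Δ (.comp .czero)) :
    sub σ (cimage a : Q Γ Δ (.comp C)) = cimage (sub σ a) := by induction a using ind; rfl
@[simp] theorem sub_cinl (σ : Sub Γ Γ') (a : Q Γ Δ (.comp C)) :
    sub σ (cinl a : Q Γ Δ (.comp (.csum C D))) = cinl (sub σ a) := by induction a using ind; rfl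
@[simp] theorem sub_cinr (σ : Sub Γ Γ') (a : Q Γ Δ (.comp D)) :
    sub σ (cinr a : Q Γ Δ (.comp (.csum C D))) = cinr (sub σ a) := by induction a using ind; rfl
@[simp] theorem sub_ccase (σ : Sub Γ Γ') (a : Q Γ Δ (.comp (.csum C D)))
    (b : Q Γ (some C) (.comp X)) (c : Q Γ (some D) (.comp X)) :
    sub σ (ccase a b c) = ccase (sub σ a) (sub σ b) (sub σ c) := by
  induction a using ind; induction b using ind; induction c using ind; rfl
@[simp] theorem sub_llam (σ : Sub Γ Γ') (a : Q Γ (some C) (.comp D)) :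
    sub σ (llam a) = llam (sub σ a) := by induction a using ind; rfl
@[simp] theorem sub_lapp (σ : Sub Γ Γ') (a : Q Γ none (.lin C D)) (b : Q Γ Δ (.comp C)) :
    sub σ (lapp a b) = lapp (sub σ a) (sub σ b) := by
  induction a using ind; induction b using ind; rfl
@[simp] theorem sub_ss (σ : Sub Γ Γ') (a : Q Γ Δ (.comp C)) (b : Q Γ (some C) A) :
    sub σ (ss a b) = ss (sub σ a) (sub σ b) := by
  induction a using ind; induction b using ind
  exact mk_congr (Tm.psubst_ssubst _ σ.raw_noStoup _ _)

end Q

namespace Sub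
variable {Γ Γ' Γ'' Γ₃ : List VType} {A : VType}

@[simp] theorem id_apply (n h) : (id : Sub Γ Γ) n A h = Q.var n A h := rfl
@[simp] theorem comp_apply (σ : Sub Γ Γ') (τ : Sub Γ' Γ'') (n h) :
    σ.comp τ n A h = (σ n A h).sub τ := rfl
@[simp] theorem lift_zero (σ : Sub Γ Γ') : σ.lift A 0 A rfl = Q.v0 := rfl
@[simp] theorem inst_zero (a : Q Γ none A) : inst a 0 A rfl = a := rfl
@[simp] theorem comp_id (σ : Sub Γ Γ') : σ.comp id = σ := by
  funext n A h; simp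
@[simp] theorem comp_comp (σ : Sub Γ Γ') (τ : Sub Γ' Γ'') (ρ : Sub Γ'' Γ₃) :
    (σ.comp τ).comp ρ = σ.comp (τ.comp ρ) := by
  funext n A h; simp
@[simp] theorem wk_cons (a : Q Γ' none A) (σ : Sub Γ Γ') : wk.comp (cons a σ) = σ := by
  funext n A h
  exact Q.sub_var _ _ _
@[simp] theorem wk_lift (σ : Sub Γ Γ') : wk.comp (σ.lift A) = σ.comp wk := wk_cons _ _
@[simp] theorem wk_inst (a : Q Γ none A) : wk.comp (inst a) = id := wk_cons _ _
theorem cons_comp (a : Q Γ' none A) (σ : Sub Γ Γ') (τ : Sub Γ' Γ'') :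
    (cons a σ).comp τ = cons (a.sub τ) (σ.comp τ) := by
  funext n B h
  cases n
  · cases h; rfl
  · rfl
@[simp] theorem lift_cons (a : Q Γ'' none A) (σ : Sub Γ Γ') (τ : Sub Γ' Γ'') :
    (σ.lift A).comp (cons a τ) = cons a (σ.comp τ) := by
  rw [lift, cons_comp]; simp
@[simp] theorem lift_inst (a : Q Γ' none A) (σ : Sub Γ Γ') :
    (σ.lift A).comp (inst a) = cons a σ := by simp [inst]
@[simp] theorem lift_lift (σ : Sub Γ Γ') (τ : Sub Γ' Γ'') :
    (σ.lift A).comp (τ.lift A) = (σ.comp τ).lift A := by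
  show (cons Q.v0 (σ.comp wk)).comp (τ.lift A) = cons Q.v0 ((σ.comp τ).comp wk)
  rw [cons_comp]; simp [lift]
@[simp] theorem cons_v0_wk : cons Q.v0 wk = (id : Sub (A :: Γ) (A :: Γ)) := by
  funext n B h
  cases n
  · cases h; rfl
  · rfl

end Sub

namespace Q
variable {Γ Γ' Γ'' : List VType} {Δ : Option CType} {A B : VType} {C D X Y : CType}

@[simp] theorem ss_svar (a : Q Γ Δ (.comp C)) : ss a svar = a := by
  induction a using ind; rfl
@[simp] theorem svar_ss (a : Q Γ (some C) A) : ss svar a = a := by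
  induction a using ind; exact mk_congr (Tm.ssubst_svar _)
@[simp] theorem ss_ss (a : Q Γ Δ (.comp C)) (b : Q Γ (some C) (.comp D)) (c : Q Γ (some D) A) :
    ss a (ss b c) = ss (ss a b) c := by
  induction a using ind; induction b using ind; induction c using ind
  exact mk_congr (Tm.ssubst_ssubst _ _ _)
@[simp] theorem ss_cunit (a : Q Γ Δ (.comp C)) : ss a cunit = cunit := by
  induction a using ind; rfl
@[simp] theorem ss_cpair (s : Q Γ Δ (.comp X)) (a : Q Γ (some X) (.comp C)) (b : Q Γ (some X) (.comp D)) :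
    ss s (cpair a b) = cpair (ss s a) (ss s b) := by
  induction s using ind; induction a using ind; induction b using ind; rfl
@[simp] theorem ss_cfst (s : Q Γ Δ (.comp X)) (a : Q Γ (some X) (.comp (.cand C D))) :
    ss s (cfst a) = cfst (ss s a) := by induction s using ind; induction a using ind; rfl
@[simp] theorem ss_csnd (s : Q Γ Δ (.comp X)) (a : Q Γ (some X) (.comp (.cand C D))) :
    ss s (csnd a) = csnd (ss s a) := by induction s using ind; induction a using ind; rfl
@[simp] theorem ss_clam (s : Q Γ Δ (.comp X)) (a : Q (A :: Γ) (some X) (.comp C)) :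
    ss s (clam a) = clam (ss (up A s) a) := by
  induction s using ind; induction a using ind; rw [up_mk]; rfl
@[simp] theorem ss_capp (s : Q Γ Δ (.comp X)) (a : Q Γ (some X) (.comp (.carr A C))) (b : Q Γ none A) :
    ss s (capp a b) = capp (ss s a) b := by
  induction s using ind; induction a using ind; induction b using ind
  rename_i h
  exact mk_congr (by rw [Tm.ssubst, h.noStoup.ssubst])
@[simp] theorem ss_ilet (s : Q Γ Δ (.comp X)) (a : Q Γ (some X) (.comp .iunit)) (b : Q Γ none (.comp C)) :
    ss s (ilet a b) = ilet (ss s a) b := by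
  induction s using ind; induction a using ind; induction b using ind
  rename_i h
  exact mk_congr (by rw [Tm.ssubst, h.noStoup.ssubst])
@[simp] theorem ss_banglet (s : Q Γ Δ (.comp X)) (a : Q Γ (some X) (.comp (.bang A)))
    (b : Q (A :: Γ) none (.comp C)) : ss s (banglet a b) = banglet (ss s a) b := by
  induction s using ind; induction a using ind; induction b using ind
  rename_i h
  exact mk_congr (by rw [Tm.ssubst, h.noStoup.ssubst])
@[simp] theorem ss_copow (s : Q Γ Δ (.comp X)) (a : Q Γ none A) (b : Q Γ (some X) (.comp C)) :
    ss s (copow a b) = copow a (ss s b) := by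
  induction s using ind; induction a using ind; induction b using ind
  rename_i h _ _
  exact mk_congr (by rw [Tm.ssubst, h.noStoup.ssubst])
@[simp] theorem ss_copowlet (s : Q Γ Δ (.comp X)) (a : Q Γ (some X) (.comp (.copow A C)))
    (b : Q (A :: Γ) (some C) (.comp D)) : ss s (copowlet a b) = copowlet (ss s a) b := by
  induction s using ind; induction a using ind; induction b using ind; rfl
@[simp] theorem ss_cimage (s : Q Γ Δ (.comp X)) (a : Q Γ (some X) (.comp .czero)) :
    ss s (cimage a : Q _ _ (.comp C)) = cimage (ss s a) := by
  induction s using ind; induction a using ind; rfl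
@[simp] theorem ss_cinl (s : Q Γ Δ (.comp X)) (a : Q Γ (some X) (.comp C)) :
    ss s (cinl a : Q _ _ (.comp (.csum C D))) = cinl (ss s a) := by
  induction s using ind; induction a using ind; rfl
@[simp] theorem ss_cinr (s : Q Γ Δ (.comp X)) (a : Q Γ (some X) (.comp D)) :
    ss s (cinr a : Q _ _ (.comp (.csum C D))) = cinr (ss s a) := by
  induction s using ind; induction a using ind; rfl
@[simp] theorem ss_ccase (s : Q Γ Δ (.comp Y)) (a : Q Γ (some Y) (.comp (.csum C D)))
    (b : Q Γ (some C) (.comp X)) (c : Q Γ (some D) (.comp X)) :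
    ss s (ccase a b c) = ccase (ss s a) b c := by
  induction s using ind; induction a using ind; induction b using ind; induction c using ind; rfl
@[simp] theorem ss_lapp (s : Q Γ Δ (.comp X)) (a : Q Γ none (.lin C D)) (b : Q Γ (some X) (.comp C)) :
    ss s (lapp a b) = lapp a (ss s b) := by
  induction s using ind; induction a using ind; induction b using ind
  rename_i h _ _
  exact mk_congr (by rw [Tm.ssubst, h.noStoup.ssubst])

end Q

namespace Q
variable {Γ Γ' Γ'' : List VType} {Δ : Option CType} {A B : VType} {C D X Y : CType}

theorem sub_inst_mk (t u : Tm) (ht : HasTy Γ none t A) (hu : HasTy (A :: Γ) Δ u B) :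
    sub (.inst (mk t ht)) (mk u hu) = mk (Tm.subst0 t u) (by
      rw [Tm.subst0_eq]; exact hu.psubst (Sub.Rep.inst t ht).ty) := by
  rw [sub_mk (Sub.Rep.inst t ht)]
  exact mk_congr (by rw [Tm.subst0_eq])

theorem unit_eta (a : Q Γ none .unit) : a = unit := by
  induction a using ind with | _ t h
  exact h.elim fun d => sound (.unit_eta d)
@[simp] theorem vfst_vpair (a : Q Γ none A) (b : Q Γ none B) : vfst (vpair a b) = a := by
  induction a using ind with | _ t h
  induction b using ind with | _ u h'
  exact h.elim fun d => h'.elim fun d' => sound (.vfst_beta d d')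
@[simp] theorem vsnd_vpair (a : Q Γ none A) (b : Q Γ none B) : vsnd (vpair a b) = b := by
  induction a using ind with | _ t h
  induction b using ind with | _ u h'
  exact h.elim fun d => h'.elim fun d' => sound (.vsnd_beta d d')
@[simp] theorem vpair_eta (a : Q Γ none (.prod A B)) : vpair (vfst a) (vsnd a) = a := by
  induction a using ind with | _ t h
  exact h.elim fun d => sound (.vpair_eta d)
@[simp] theorem vapp_vlam (b : Q (A :: Γ) none B) (a : Q Γ none A) :
    vapp (vlam b) a = sub (.inst a) b := by
  induction a using ind with | _ t h
  induction b using ind with | _ u h'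
  rw [sub_inst_mk]
  exact h.elim fun d => h'.elim fun d' => sound (.vlam_beta d' d)
theorem vlam_eta (a : Q Γ none (.arr A B)) : vlam (vapp (up A a) v0) = a := by
  induction a using ind with | _ t h
  rw [up_mk]
  exact h.elim fun d => sound (.vlam_eta d)
theorem cunit_eta (a : Q Γ Δ (.comp .cunit)) : a = cunit := by
  induction a using ind with | _ t h
  exact h.elim fun d => sound (.cunit_eta d)
@[simp] theorem cfst_cpair (a : Q Γ Δ (.comp C)) (b : Q Γ Δ (.comp D)) : cfst (cpair a b) = a := by
  induction a using ind with | _ t h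
  induction b using ind with | _ u h'
  exact h.elim fun d => h'.elim fun d' => sound (.cfst_beta d d')
@[simp] theorem csnd_cpair (a : Q Γ Δ (.comp C)) (b : Q Γ Δ (.comp D)) : csnd (cpair a b) = b := by
  induction a using ind with | _ t h
  induction b using ind with | _ u h'
  exact h.elim fun d => h'.elim fun d' => sound (.csnd_beta d d')
@[simp] theorem cpair_eta (a : Q Γ Δ (.comp (.cand C D))) : cpair (cfst a) (csnd a) = a := by
  induction a using ind with | _ t h
  exact h.elim fun d => sound (.cpair_eta d)
@[simp] theorem capp_clam (b : Q (A :: Γ) Δ (.comp C)) (a : Q Γ none A) :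
    capp (clam b) a = sub (.inst a) b := by
  induction a using ind with | _ t h
  induction b using ind with | _ u h'
  rw [sub_inst_mk]
  exact h.elim fun d => h'.elim fun d' => sound (.clam_beta d' d)
theorem clam_eta (a : Q Γ Δ (.comp (.carr A C))) : clam (capp (up A a) v0) = a := by
  induction a using ind with | _ t h
  rw [up_mk]
  exact h.elim fun d => sound (.clam_eta d)
@[simp] theorem ilet_top (a : Q Γ none (.comp C)) : ilet top a = a := by
  induction a using ind with | _ t h
  exact h.elim fun d => sound (.ilet_beta d)
theorem ilet_eta (a : Q Γ Δ (.comp .iunit)) (b : Q Γ (some .iunit) (.comp C)) :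
    ilet a (ss top b) = ss a b := by
  induction a using ind with | _ t h
  induction b using ind with | _ u h'
  exact h.elim fun d => h'.elim fun d' => sound (.ilet_eta d d')
@[simp] theorem banglet_bang (a : Q Γ none A) (b : Q (A :: Γ) none (.comp C)) :
    banglet (bang a) b = sub (.inst a) b := by
  induction a using ind with | _ t h
  induction b using ind with | _ u h'
  rw [sub_inst_mk]
  exact h.elim fun d => h'.elim fun d' => sound (.bang_beta d d')
theorem banglet_eta (a : Q Γ Δ (.comp (.bang A))) (b : Q Γ (some (.bang A)) (.comp C)) :
    banglet a (ss (bang v0) (up A b)) = ss a b := by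
  induction a using ind with | _ t h
  induction b using ind with | _ u h'
  rw [up_mk]
  exact h.elim fun d => h'.elim fun d' => sound (.bang_eta d d')
@[simp] theorem copowlet_copow (a : Q Γ none A) (s : Q Γ Δ (.comp C))
    (b : Q (A :: Γ) (some C) (.comp D)) : copowlet (copow a s) b = ss s (sub (.inst a) b) := by
  induction a using ind with | _ t h
  induction s using ind with | _ s hs
  induction b using ind with | _ u h'
  rw [sub_inst_mk]
  exact h.elim fun d => hs.elim fun ds => h'.elim fun d' => sound (.copow_beta d ds d')
theorem copowlet_eta (a : Q Γ Δ (.comp (.copow A C))) (b : Q Γ (some (.copow A C)) (.comp D)) :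
    copowlet a (ss (copow v0 svar) (up A b)) = ss a b := by
  induction a using ind with | _ t h
  induction b using ind with | _ u h'
  rw [up_mk]
  exact h.elim fun d => h'.elim fun d' => sound (.copow_eta d d')
theorem czero_eta (a : Q Γ Δ (.comp .czero)) (b : Q Γ (some .czero) (.comp C)) :
    cimage a = ss a b := by
  induction a using ind with | _ t h
  induction b using ind with | _ u h'
  exact h.elim fun d => h'.elim fun d' => sound (.czero_eta d d')
@[simp] theorem ccase_cinl (a : Q Γ Δ (.comp C)) (b : Q Γ (some C) (.comp X))
    (c : Q Γ (some D) (.comp X)) : ccase (cinl a) b c = ss a b := by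
  induction a using ind with | _ t h
  induction b using ind with | _ u h'
  induction c using ind with | _ v h''
  exact h.elim fun d => h'.elim fun d' => h''.elim fun d'' => sound (.csum_beta_inl d' d'' d)
@[simp] theorem ccase_cinr (a : Q Γ Δ (.comp D)) (b : Q Γ (some C) (.comp X))
    (c : Q Γ (some D) (.comp X)) : ccase (cinr a) b c = ss a c := by
  induction a using ind with | _ t h
  induction b using ind with | _ u h'
  induction c using ind with | _ v h''
  exact h.elim fun d => h'.elim fun d' => h''.elim fun d'' => sound (.csum_beta_inr d' d'' d)
theorem ccase_eta (a : Q Γ Δ (.comp (.csum C D))) (b : Q Γ (some (.csum C D)) (.comp X)) :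
    ccase a (ss (cinl svar) b) (ss (cinr svar) b) = ss a b := by
  induction a using ind with | _ t h
  induction b using ind with | _ u h'
  exact h.elim fun d => h'.elim fun d' => sound (.csum_eta d d')
@[simp] theorem lapp_llam (b : Q Γ (some C) (.comp D)) (a : Q Γ Δ (.comp C)) :
    lapp (llam b) a = ss a b := by
  induction a using ind with | _ t h
  induction b using ind with | _ u h'
  exact h.elim fun d => h'.elim fun d' => sound (.llam_beta d' d)
@[simp] theorem llam_eta (a : Q Γ none (.lin C D)) : llam (lapp a svar) = a := by
  induction a using ind with | _ t h
  exact h.elim fun d => sound (.llam_eta d)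

theorem ss_ccase_left (k : Q Γ Δ (.comp (.csum C D))) (u : Q Γ (some C) (.comp X))
    (w : Q Γ (some D) (.comp X)) (o : Q Γ (some X) (.comp Y)) :
    ss (ccase k u w) o = ccase k (ss u o) (ss w o) := by
  have := ccase_eta k (ss (ccase svar u w) o)
  simpa using this.symm
theorem ss_copowlet_left (k : Q Γ Δ (.comp (.copow A C))) (e : Q (A :: Γ) (some C) (.comp X))
    (o : Q Γ (some X) (.comp Y)) : ss (copowlet k e) o = copowlet k (ss e (up A o)) := by
  have := copowlet_eta k (ss (copowlet svar e) o)
  simpa using this.symm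
theorem ss_banglet_left (k : Q Γ Δ (.comp (.bang A))) (e : Q (A :: Γ) none (.comp X))
    (o : Q Γ (some X) (.comp Y)) : ss (banglet k e) o = banglet k (ss e (up A o)) := by
  have := banglet_eta k (ss (banglet svar e) o)
  simpa using this.symm
theorem ss_ilet_left (k : Q Γ Δ (.comp .iunit)) (e : Q Γ none (.comp X))
    (o : Q Γ (some X) (.comp Y)) : ss (ilet k e) o = ilet k (ss e o) := by
  have := ilet_eta k (ss (ilet svar e) o)
  simpa using this.symm
theorem ss_cimage_left (k : Q Γ Δ (.comp .czero)) (o : Q Γ (some X) (.comp Y)) :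
    ss (cimage k) o = cimage k := by
  have := czero_eta k (ss (cimage svar) o)
  simpa using this.symm

end Q

/-- The stoup of the translation of a judgement `Γ | Δ ⊢ t : A`. -/
def csrc (R : CType) : Option CType → VType → Option CType
  | some _, .comp B => some (cpsC R B)
  | _, _ => none
/-- The type of the translation of a judgement `Γ | Δ ⊢ t : A`. -/
def ctgt (R : CType) : Option CType → VType → VType
  | some D, _ => .comp (cpsC R D)
  | none, A => cpsV R A

theorem cpsCtx_getElem? (R : CType) {Γ : List VType} {n : ℕ} {A : VType} (h : Γ[n]? = some A) :
    (cpsCtx R Γ)[n]? = some (cpsV R A) := by simp [cpsCtx, h]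

section
variable {Γ : List VType} {Δ : Option CType} {t s u : Tm} {A B : VType} {C D E X : CType}

theorem HasTy.llam (h : HasTy Γ (some C) t (.comp D)) : HasTy Γ none (.llam C t) (.lin C D) :=
  h.elim fun d => ⟨.llam _ _ _ _ d⟩
theorem HasTy.lapp (h : HasTy Γ none s (.lin C D)) (h' : HasTy Γ Δ t (.comp C)) :
    HasTy Γ Δ (.lapp s t) (.comp D) :=
  h.elim fun d => h'.elim fun d' => ⟨.lapp _ _ _ _ _ _ d d'⟩
theorem HasTy.svar : HasTy Γ (some C) .svar (.comp C) := ⟨.svar _ _⟩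
theorem HasTy.ccase (h : HasTy Γ Δ s (.comp (.csum C D))) (h' : HasTy Γ (some C) t (.comp X))
    (h'' : HasTy Γ (some D) u (.comp X)) : HasTy Γ Δ (.ccase s t u) (.comp X) :=
  h.elim fun d => h'.elim fun d' => h''.elim fun d'' => ⟨.ccase _ _ _ _ _ _ _ _ d d' d''⟩
theorem HasTy.copowlet (h : HasTy Γ Δ s (.comp (.copow A D)))
    (h' : HasTy (A :: Γ) (some D) t (.comp X)) : HasTy Γ Δ (.copowlet s t) (.comp X) :=
  h.elim fun d => h'.elim fun d' => ⟨.copowlet _ _ _ _ _ _ _ d d'⟩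
theorem HasTy.copow (h : HasTy Γ none s A) (h' : HasTy Γ Δ t (.comp X)) :
    HasTy Γ Δ (.copow s t) (.comp (.copow A X)) :=
  h.elim fun d => h'.elim fun d' => ⟨.copow _ _ _ _ _ _ d d'⟩
theorem HasTy.capp (h : HasTy Γ Δ s (.comp (.carr A X))) (h' : HasTy Γ none t A) :
    HasTy Γ Δ (.capp s t) (.comp X) :=
  h.elim fun d => h'.elim fun d' => ⟨.capp _ _ _ _ _ _ d d'⟩
theorem HasTy.clam (h : HasTy (A :: Γ) Δ s (.comp X)) : HasTy Γ Δ (.clam A s) (.comp (.carr A X)) :=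
  h.elim fun d => ⟨.clam _ _ _ _ _ d⟩
theorem HasTy.cpair (h : HasTy Γ Δ s (.comp C)) (h' : HasTy Γ Δ t (.comp D)) :
    HasTy Γ Δ (.cpair s t) (.comp (.cand C D)) :=
  h.elim fun d => h'.elim fun d' => ⟨.cpair _ _ _ _ _ _ d d'⟩
theorem HasTy.cfst (h : HasTy Γ Δ s (.comp (.cand C D))) : HasTy Γ Δ (.cfst s) (.comp C) :=
  h.elim fun d => ⟨.cfst _ _ _ _ _ d⟩
theorem HasTy.csnd (h : HasTy Γ Δ s (.comp (.cand C D))) : HasTy Γ Δ (.csnd s) (.comp D) :=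
  h.elim fun d => ⟨.csnd _ _ _ _ _ d⟩
theorem HasTy.cinl (h : HasTy Γ Δ s (.comp C)) : HasTy Γ Δ (.cinl s) (.comp (.csum C D)) :=
  h.elim fun d => ⟨.cinl _ _ _ _ _ d⟩
theorem HasTy.cinr (h : HasTy Γ Δ s (.comp D)) : HasTy Γ Δ (.cinr s) (.comp (.csum C D)) :=
  h.elim fun d => ⟨.cinr _ _ _ _ _ d⟩
theorem HasTy.cimage (h : HasTy Γ Δ s (.comp .czero)) : HasTy Γ Δ (.cimage C s) (.comp C) :=
  h.elim fun d => ⟨.cimage _ _ _ _ d⟩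
theorem HasTy.ilet (h : HasTy Γ Δ s (.comp .iunit)) (h' : HasTy Γ none t (.comp D)) :
    HasTy Γ Δ (.ilet s t) (.comp D) :=
  h.elim fun d => h'.elim fun d' => ⟨.ilet _ _ _ _ _ d d'⟩
theorem HasTy.vlam (h : HasTy (A :: Γ) none s B) : HasTy Γ none (.vlam A s) (.arr A B) :=
  h.elim fun d => ⟨.vlam _ _ _ _ d⟩
theorem HasTy.vapp (h : HasTy Γ none s (.arr A B)) (h' : HasTy Γ none t A) :
    HasTy Γ none (.vapp s t) B :=
  h.elim fun d => h'.elim fun d' => ⟨.vapp _ _ _ _ _ d d'⟩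
theorem HasTy.vpair (h : HasTy Γ none s A) (h' : HasTy Γ none t B) :
    HasTy Γ none (.vpair s t) (.prod A B) :=
  h.elim fun d => h'.elim fun d' => ⟨.vpair _ _ _ _ _ d d'⟩
theorem HasTy.vfst (h : HasTy Γ none s (.prod A B)) : HasTy Γ none (.vfst s) A :=
  h.elim fun d => ⟨.vfst _ _ _ _ d⟩
theorem HasTy.vsnd (h : HasTy Γ none s (.prod A B)) : HasTy Γ none (.vsnd s) B :=
  h.elim fun d => ⟨.vsnd _ _ _ _ d⟩
theorem HasTy.bang (h : HasTy Γ none s A) : HasTy Γ none (.bang s) (.comp (.bang A)) :=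
  h.elim fun d => ⟨.bang _ _ _ d⟩
theorem HasTy.banglet (h : HasTy Γ Δ s (.comp (.bang A))) (h' : HasTy (A :: Γ) none t (.comp D)) :
    HasTy Γ Δ (.banglet s t) (.comp D) :=
  h.elim fun d => h'.elim fun d' => ⟨.banglet _ _ _ _ _ _ d d'⟩

end

/-- The self-translation preserves typing. -/
theorem cps_ty (R : CType) {Γ : List VType} {Δ : Option CType} {t : Tm} {A : VType}
    (d : Deriv Γ Δ t A) : HasTy (cpsCtx R Γ) (csrc R Δ A) (cps R d) (ctgt R Δ A) := by
  induction d with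
  | var Γ n A h => exact ⟨.var _ _ _ (cpsCtx_getElem? R h)⟩
  | svar => exact .svar
  | unit => exact ⟨.unit _⟩
  | vpair _ _ _ _ _ _ _ h1 h2 => exact h1.vpair h2
  | vfst _ _ _ _ _ h => exact h.vfst
  | vsnd _ _ _ _ _ h => exact h.vsnd
  | vlam _ _ _ _ _ h => exact h.vlam
  | vapp _ _ _ _ _ _ _ h1 h2 => exact h1.vapp h2
  | cunit Γ Δ => cases Δ with
    | none => exact HasTy.svar.cimage.llam
    | some => exact HasTy.svar.cimage
  | cpair Γ Δ _ _ _ _ _ _ h1 h2 => cases Δ with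
    | none => exact (HasTy.svar.ccase (h1.lapp .svar) (h2.lapp .svar)).llam
    | some => exact HasTy.svar.ccase h1 h2
  | cfst Γ Δ _ _ _ _ h => cases Δ with
    | none => exact (h.lapp HasTy.svar.cinl).llam
    | some => exact h.ssubst HasTy.svar.cinl
  | csnd Γ Δ _ _ _ _ h => cases Δ with
    | none => exact (h.lapp HasTy.svar.cinr).llam
    | some => exact h.ssubst HasTy.svar.cinr
  | clam Γ Δ _ _ _ _ h => cases Δ with
    | none => exact (HasTy.svar.copowlet (h.lapp .svar)).llam
    | some => exact HasTy.svar.copowlet h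
  | capp Γ Δ _ _ _ _ _ _ h1 h2 => cases Δ with
    | none => exact (h1.lapp (h2.copow .svar)).llam
    | some => exact h1.ssubst (h2.copow .svar)
  | top => exact HasTy.svar.llam
  | ilet Γ Δ _ _ _ _ _ h1 h2 => cases Δ with
    | none => exact (h1.lapp (h2.lapp .svar)).llam
    | some => exact h1.ssubst (h2.lapp .svar)
  | bang _ _ _ _ h => exact (HasTy.svar.capp h).llam
  | banglet Γ Δ _ _ _ _ _ _ h1 h2 => cases Δ with
    | none => exact (h1.lapp (HasTy.clam (h2.lapp .svar))).llam
    | some => exact h1.ssubst (HasTy.clam (h2.lapp .svar))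
  | copow Γ Δ _ _ _ _ _ _ h1 h2 => cases Δ with
    | none => exact (h2.lapp (HasTy.svar.capp h1)).llam
    | some => exact h2.ssubst (HasTy.svar.capp h1)
  | copowlet Γ Δ _ _ _ _ _ _ _ h1 h2 => cases Δ with
    | none => exact (h1.lapp (HasTy.clam h2)).llam
    | some => exact h1.ssubst (HasTy.clam h2)
  | cimage Γ Δ _ _ _ h => cases Δ with
    | none => exact (h.lapp ⟨.cunit _ _⟩).llam
    | some => exact h.ssubst ⟨.cunit _ _⟩
  | cinl Γ Δ _ _ _ _ h => cases Δ with
    | none => exact (h.lapp HasTy.svar.cfst).llam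
    | some => exact h.ssubst HasTy.svar.cfst
  | cinr Γ Δ _ _ _ _ h => cases Δ with
    | none => exact (h.lapp HasTy.svar.csnd).llam
    | some => exact h.ssubst HasTy.svar.csnd
  | ccase Γ Δ _ _ _ _ _ _ _ _ _ h1 h2 h3 => cases Δ with
    | none => exact (h1.lapp (h2.cpair h3)).llam
    | some => exact h1.ssubst (h2.cpair h3)
  | llam _ _ _ _ _ h => exact h.llam
  | lapp Γ Δ _ _ _ _ _ _ h1 h2 => cases Δ with
    | none => exact (h2.lapp (h1.lapp .svar)).llam
    | some => exact h2.ssubst (h1.lapp .svar)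

/-- The self-translation of a derivation, up to provable equality. -/
def cpsQ (R : CType) {Γ : List VType} {Δ : Option CType} {t : Tm} {A : VType}
    (d : Deriv Γ Δ t A) : Q (cpsCtx R Γ) (csrc R Δ A) (ctgt R Δ A) :=
  Q.mk (cps R d) (cps_ty R d)

/-- The computation type of the result of running a translated computation. -/
def ans (R : CType) : Option CType → CType
  | none => R
  | some D => cpsC R D

section
variable {R : CType} {Γ G G' : List VType} {Δ Δ' : Option CType} {t s u : Tm} {A B : VType}
  {C D E X : CType}

/-- The translation of a value. -/
def cpsVal (R : CType) (d : Deriv Γ none t A) : Q (cpsCtx R Γ) none (cpsV R A) := cpsQ R d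
/-- The translation of a computation with empty stoup. -/
def cpsComp (R : CType) (d : Deriv Γ none t (.comp C)) :
    Q (cpsCtx R Γ) none (.lin (cpsC R C) R) := cpsQ R d
/-- The translation of a computation with a stoup. -/
def cpsLin (R : CType) (d : Deriv Γ (some D) t (.comp C)) :
    Q (cpsCtx R Γ) (some (cpsC R C)) (.comp (cpsC R D)) := cpsQ R d

/-- Run the translation of a computation on a continuation. -/
noncomputable def run : {Δ : Option CType} → (d : Deriv Γ Δ t (.comp C)) → Sub (cpsCtx R Γ) G →
    Q G Δ' (.comp (cpsC R C)) → Q G Δ' (.comp (ans R Δ))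
  | none, d, σ, k => Q.lapp (Q.sub σ (cpsComp R d)) k
  | some _, d, σ, k => Q.ss k (Q.sub σ (cpsLin R d))

/-- The translation of a value in an environment. -/
noncomputable def val (d : Deriv Γ none t A) (σ : Sub (cpsCtx R Γ) G) : Q G none (cpsV R A) :=
  Q.sub σ (cpsVal R d)

theorem run_none (d : Deriv Γ none t (.comp C)) (σ : Sub (cpsCtx R Γ) G)
    (k : Q G Δ' (.comp (cpsC R C))) :
    run d σ k = Q.lapp (D := R) (Q.sub σ (cpsComp R d)) k := rfl
theorem run_some (d : Deriv Γ (some D) t (.comp C)) (σ : Sub (cpsCtx R Γ) G)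
    (k : Q G Δ' (.comp (cpsC R C))) :
    run d σ k = Q.ss (A := .comp (cpsC R D)) k (Q.sub σ (cpsLin R d)) := rfl
theorem run_val (d : Deriv Γ none t (.comp C)) (σ : Sub (cpsCtx R Γ) G)
    (k : Q G Δ' (.comp (cpsC R C))) :
    run d σ k = Q.lapp (D := R) (C := cpsC R C) (val d σ) k := rfl

theorem sub_run (d : Deriv Γ Δ t (.comp C)) (σ : Sub (cpsCtx R Γ) G)
    (k : Q G Δ' (.comp (cpsC R C))) (τ : Sub G G') :
    Q.sub τ (run d σ k) = run d (σ.comp τ) (Q.sub τ k) := by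
  cases Δ with
  | none => rw [run_none, run_none, ← Q.sub_sub]; exact Q.sub_lapp ..
  | some => rw [run_some, run_some, ← Q.sub_sub]; exact Q.sub_ss ..

theorem sub_val (d : Deriv Γ none t A) (σ : Sub (cpsCtx R Γ) G) (τ : Sub G G') :
    Q.sub τ (val d σ) = val d (σ.comp τ) := Q.sub_sub ..

theorem ss_run (d : Deriv Γ Δ t (.comp C)) (σ : Sub (cpsCtx R Γ) G)
    (k : Q G (some X) (.comp (cpsC R C))) (r : Q G Δ' (.comp X)) :
    Q.ss r (run d σ k) = run d σ (Q.ss r k) := by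
  cases Δ with
  | none => rw [run_none, run_none]; exact Q.ss_lapp ..
  | some => rw [run_some, run_some]; exact Q.ss_ss ..

theorem run_svar (σ : Sub (cpsCtx R Γ) G) (k : Q G Δ' (.comp (cpsC R C))) :
    run (.svar Γ C) σ k = k := Q.ss_svar k

theorem run_cunit (σ : Sub (cpsCtx R Γ) G) (k : Q G Δ' (.comp .czero)) :
    run (.cunit Γ Δ) σ k = Q.cimage k := by
  cases Δ with
  | none =>
    change Q.lapp (D := R) (Q.sub σ (Q.llam (Q.cimage Q.svar))) k = _
    simp; rfl
  | some D =>
    change Q.ss k (Q.sub σ (Q.cimage (C := cpsC R D) Q.svar)) = _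
    simp; rfl

theorem run_cpair (d : Deriv Γ Δ t (.comp C)) (e : Deriv Γ Δ u (.comp D)) (σ : Sub (cpsCtx R Γ) G)
    (k : Q G Δ' (.comp (.csum (cpsC R C) (cpsC R D)))) :
    run (.cpair _ _ _ _ _ _ d e) σ k = Q.ccase k (run d σ .svar) (run e σ .svar) := by
  cases Δ with
  | none =>
    change Q.lapp (D := R) (Q.sub σ (Q.llam (Q.ccase .svar
      (Q.lapp (cpsComp R d) .svar) (Q.lapp (cpsComp R e) .svar)))) k = _
    simp [run_none]; rfl
  | some =>
    change Q.ss k (Q.sub σ (Q.ccase .svar (cpsLin R d) (cpsLin R e))) = _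
    simp [run_some]; rfl


theorem Q.ss_sub_cinl {Γ : List VType} (σ : Sub Γ G) (k : Q G Δ' (.comp C)) :
    Q.ss k (Q.sub σ (Q.cinl (D := D) Q.svar)) = Q.cinl k := by simp
theorem Q.ss_sub_cinr {Γ : List VType} (σ : Sub Γ G) (k : Q G Δ' (.comp D)) :
    Q.ss k (Q.sub σ (Q.cinr (C := C) Q.svar)) = Q.cinr k := by simp
theorem Q.ss_sub_cfst {Γ : List VType} (σ : Sub Γ G) (k : Q G Δ' (.comp (.cand C D))) :
    Q.ss k (Q.sub σ (Q.cfst Q.svar)) = Q.cfst k := by simp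
theorem Q.ss_sub_csnd {Γ : List VType} (σ : Sub Γ G) (k : Q G Δ' (.comp (.cand C D))) :
    Q.ss k (Q.sub σ (Q.csnd Q.svar)) = Q.csnd k := by simp
theorem Q.ss_sub_copow {Γ : List VType} (σ : Sub Γ G) (a : Q Γ none A) (k : Q G Δ' (.comp C)) :
    Q.ss k (Q.sub σ (Q.copow a Q.svar)) = Q.copow (Q.sub σ a) k := by simp
theorem Q.ss_sub_capp {Γ : List VType} (σ : Sub Γ G) (a : Q Γ none A)
    (k : Q G Δ' (.comp (.carr A C))) :
    Q.ss k (Q.sub σ (Q.capp Q.svar a)) = Q.capp k (Q.sub σ a) := by simp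
theorem Q.ss_sub_lapp {Γ : List VType} (σ : Sub Γ G) (a : Q Γ none (.lin C D))
    (k : Q G Δ' (.comp C)) :
    Q.ss k (Q.sub σ (Q.lapp a Q.svar)) = Q.lapp (Q.sub σ a) k := by simp
theorem Q.ss_sub_clam {Γ : List VType} (σ : Sub Γ G) (a : Q (A :: Γ) (some D) (.comp C))
    (k : Q G Δ' (.comp D)) :
    Q.ss k (Q.sub σ (Q.clam a)) = Q.clam (Q.ss (Q.up A k) (Q.sub (σ.lift A) a)) := by simp
theorem Q.ss_sub_clam_lapp {Γ : List VType} (σ : Sub Γ G) (a : Q (A :: Γ) none (.lin D C))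
    (k : Q G Δ' (.comp D)) :
    Q.ss k (Q.sub σ (Q.clam (Q.lapp a .svar))) =
      Q.clam (Q.lapp (Q.sub (σ.lift A) a) (Q.up A k)) := by simp
theorem Q.ss_sub_cpair {Γ : List VType} (σ : Sub Γ G) (a : Q Γ (some X) (.comp C))
    (b : Q Γ (some X) (.comp D)) (k : Q G Δ' (.comp X)) :
    Q.ss k (Q.sub σ (Q.cpair a b)) = Q.cpair (Q.ss k (Q.sub σ a)) (Q.ss k (Q.sub σ b)) := by simp
theorem Q.ss_sub_copowlet {Γ : List VType} (σ : Sub Γ G) (a : Q (A :: Γ) (some D) (.comp C))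
    (k : Q G Δ' (.comp (.copow A D))) :
    Q.ss k (Q.sub σ (Q.copowlet .svar a)) = Q.copowlet k (Q.sub (σ.lift A) a) := by simp
theorem Q.lapp_sub_llam {Γ : List VType} (σ : Sub Γ G) (a : Q Γ (some C) (.comp D))
    (k : Q G Δ' (.comp C)) :
    Q.lapp (Q.sub σ (Q.llam a)) k = Q.ss k (Q.sub σ a) := by simp
theorem Q.sub_lapp_svar {Γ : List VType} (σ : Sub Γ G) (a : Q Γ none (.lin C D)) :
    Q.sub σ (Q.lapp a .svar) = Q.lapp (Q.sub σ a) .svar := by simp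

/-- The translation of `d'` is that of `d` precomposed with `x`. -/
def IsPre (d : Deriv Γ Δ t (.comp C)) (d' : Deriv Γ Δ s (.comp D))
    (x : Q (cpsCtx R Γ) (some (cpsC R D)) (.comp (cpsC R C))) : Prop :=
  match Δ, d, d' with
  | none, d, d' => cpsComp R d' = Q.llam (Q.lapp (cpsComp R d) x)
  | some _, d, d' => cpsLin R d' = Q.ss x (cpsLin R d)

theorem IsPre.run_eq {d : Deriv Γ Δ t (.comp C)} {d' : Deriv Γ Δ s (.comp D)}
    {x : Q (cpsCtx R Γ) (some (cpsC R D)) (.comp (cpsC R C))} (h : IsPre d d' x)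
    (σ : Sub (cpsCtx R Γ) G) {k : Q G Δ' (.comp (cpsC R D))} {k' : Q G Δ' (.comp (cpsC R C))}
    (hk : Q.ss k (Q.sub σ x) = k') : run d' σ k = run d σ k' := by
  subst hk
  cases Δ with
  | none =>
    change cpsComp R d' = _ at h
    rw [run_none, run_none, h]; simp; rfl
  | some =>
    change cpsLin R d' = _ at h
    rw [run_some, run_some, h]; simp; rfl

theorem run_cfst (d : Deriv Γ Δ t (.comp (.cand C D))) (σ : Sub (cpsCtx R Γ) G)
    (k : Q G Δ' (.comp (cpsC R C))) :
    run (.cfst _ _ _ _ _ d) σ k = run d σ (Q.cinl (C := cpsC R C) (D := cpsC R D) k) :=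
  IsPre.run_eq (d := d) (d' := (.cfst _ _ _ _ _ d)) (x := Q.cinl (C := cpsC R C) (D := cpsC R D) .svar)
    (by cases Δ <;> rfl) σ (Q.ss_sub_cinl σ k)

theorem run_csnd (d : Deriv Γ Δ t (.comp (.cand C D))) (σ : Sub (cpsCtx R Γ) G)
    (k : Q G Δ' (.comp (cpsC R D))) :
    run (.csnd _ _ _ _ _ d) σ k = run d σ (Q.cinr (C := cpsC R C) (D := cpsC R D) k) :=
  IsPre.run_eq (d := d) (d' := (.csnd _ _ _ _ _ d)) (x := Q.cinr (C := cpsC R C) (D := cpsC R D) .svar)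
    (by cases Δ <;> rfl) σ (Q.ss_sub_cinr σ k)

theorem run_clam (d : Deriv (A :: Γ) Δ t (.comp C)) (σ : Sub (cpsCtx R Γ) G)
    (k : Q G Δ' (.comp (.copow (cpsV R A) (cpsC R C)))) :
    run (.clam _ _ _ _ _ d) σ k = Q.copowlet k (run d (σ.lift (cpsV R A)) .svar) := by
  cases Δ with
  | none =>
    exact (Q.lapp_sub_llam (C := .copow (cpsV R A) (cpsC R C)) σ (Q.copowlet (A := cpsV R A) .svar
      (Q.lapp (cpsComp R d) .svar)) k).trans ((Q.ss_sub_copowlet _ _ _).trans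
      (congrArg _ (Q.sub_lapp_svar (σ.lift (cpsV R A)) (cpsComp R d))))
  | some =>
    exact (Q.ss_sub_copowlet (A := cpsV R A) σ (cpsLin R d) k).trans
      (congrArg _ (Q.svar_ss (Q.sub (σ.lift (cpsV R A)) (cpsLin R d))).symm)

theorem run_capp (d : Deriv Γ Δ t (.comp (.carr A C))) (e : Deriv Γ none u A) (σ : Sub (cpsCtx R Γ) G)
    (k : Q G Δ' (.comp (cpsC R C))) :
    run (.capp _ _ _ _ _ _ d e) σ k = run d σ (Q.copow (val e σ) k) :=
  IsPre.run_eq (d := d) (d' := (.capp _ _ _ _ _ _ d e)) (x := Q.copow (cpsVal R e) .svar)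
    (by cases Δ <;> rfl) σ (Q.ss_sub_copow σ (cpsVal R e) k)

theorem run_top (σ : Sub (cpsCtx R Γ) G) (k : Q G Δ' (.comp R)) :
    run (.top Γ) σ k = k := by
  change Q.lapp (D := R) (Q.sub σ (Q.llam (C := R) Q.svar)) k = _
  simp

theorem run_bang (d : Deriv Γ none t A) (σ : Sub (cpsCtx R Γ) G)
    (k : Q G Δ' (.comp (.carr (cpsV R A) R))) :
    run (.bang _ _ _ d) σ k = Q.capp k (val d σ) := by
  change Q.lapp (D := R) (Q.sub σ (Q.llam (Q.capp (C := R) Q.svar (cpsVal R d)))) k = _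
  simp; rfl

theorem run_ilet (d : Deriv Γ Δ t (.comp .iunit)) (e : Deriv Γ none u (.comp C)) (σ : Sub (cpsCtx R Γ) G)
    (k : Q G Δ' (.comp (cpsC R C))) :
    run (.ilet _ _ _ _ _ d e) σ k = run d σ (run e σ k) :=
  IsPre.run_eq (d := d) (d' := (.ilet _ _ _ _ _ d e)) (x := Q.lapp (D := R) (cpsComp R e) .svar)
    (by cases Δ <;> rfl) σ (Q.ss_sub_lapp σ (cpsComp R e) k)

theorem run_banglet (d : Deriv Γ Δ t (.comp (.bang A))) (e : Deriv (A :: Γ) none u (.comp C)) (σ : Sub (cpsCtx R Γ) G)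
    (k : Q G Δ' (.comp (cpsC R C))) :
    run (.banglet _ _ _ _ _ _ d e) σ k = run d σ (Q.clam (A := cpsV R A) (C := R) (run e (σ.lift (cpsV R A)) (Q.up (cpsV R A) k))) :=
  IsPre.run_eq (d := d) (d' := (.banglet _ _ _ _ _ _ d e)) (x := Q.clam (A := cpsV R A) (C := R) (Q.lapp (cpsComp R e) .svar))
    (by cases Δ <;> rfl) σ (Q.ss_sub_clam_lapp (A := cpsV R A) σ (cpsComp R e) k)

theorem run_copow (e : Deriv Γ none u A) (d : Deriv Γ Δ t (.comp C)) (σ : Sub (cpsCtx R Γ) G)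
    (k : Q G Δ' (.comp (.carr (cpsV R A) (cpsC R C)))) :
    run (.copow _ _ _ _ _ _ e d) σ k = run d σ (Q.capp k (val e σ)) :=
  IsPre.run_eq (d := d) (d' := (.copow _ _ _ _ _ _ e d)) (x := Q.capp (A := cpsV R A) (C := cpsC R C) .svar (cpsVal R e))
    (by cases Δ <;> rfl) σ (Q.ss_sub_capp σ (cpsVal R e) k)

theorem run_copowlet (d : Deriv Γ Δ t (.comp (.copow A D))) (e : Deriv (A :: Γ) (some D) u (.comp C)) (σ : Sub (cpsCtx R Γ) G)
    (k : Q G Δ' (.comp (cpsC R C))) :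
    run (.copowlet _ _ _ _ _ _ _ d e) σ k = run d σ (Q.clam (A := cpsV R A) (C := cpsC R D) (run e (σ.lift (cpsV R A)) (Q.up (cpsV R A) k))) :=
  IsPre.run_eq (d := d) (d' := (.copowlet _ _ _ _ _ _ _ d e)) (x := Q.clam (A := cpsV R A) (C := cpsC R D) (cpsLin R e))
    (by cases Δ <;> rfl) σ (Q.ss_sub_clam (A := cpsV R A) σ (cpsLin R e) k)

theorem run_cimage (d : Deriv Γ Δ t (.comp .czero)) (σ : Sub (cpsCtx R Γ) G)
    (k : Q G Δ' (.comp (cpsC R C))) :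
    run (.cimage _ _ _ C d) σ k = run d σ Q.cunit :=
  IsPre.run_eq (d := d) (d' := (.cimage _ _ _ C d)) (x := Q.cunit)
    (by cases Δ <;> rfl) σ (Q.ss_cunit _)

theorem run_cinl (d : Deriv Γ Δ t (.comp C)) (σ : Sub (cpsCtx R Γ) G)
    (k : Q G Δ' (.comp (.cand (cpsC R C) (cpsC R D)))) :
    run (.cinl _ _ _ C D d) σ k = run d σ (Q.cfst k) :=
  IsPre.run_eq (d := d) (d' := (.cinl _ _ _ C D d)) (x := Q.cfst (C := cpsC R C) (D := cpsC R D) .svar)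
    (by cases Δ <;> rfl) σ (Q.ss_sub_cfst σ k)

theorem run_cinr (d : Deriv Γ Δ t (.comp D)) (σ : Sub (cpsCtx R Γ) G)
    (k : Q G Δ' (.comp (.cand (cpsC R C) (cpsC R D)))) :
    run (.cinr _ _ _ C D d) σ k = run d σ (Q.csnd k) :=
  IsPre.run_eq (d := d) (d' := (.cinr _ _ _ C D d)) (x := Q.csnd (C := cpsC R C) (D := cpsC R D) .svar)
    (by cases Δ <;> rfl) σ (Q.ss_sub_csnd σ k)

theorem run_ccase (d : Deriv Γ Δ t (.comp (.csum C D))) (e : Deriv Γ (some C) s (.comp X)) (f : Deriv Γ (some D) u (.comp X)) (σ : Sub (cpsCtx R Γ) G)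
    (k : Q G Δ' (.comp (cpsC R X))) :
    run (.ccase _ _ _ _ _ _ _ _ d e f) σ k = run d σ (Q.cpair (C := cpsC R C) (D := cpsC R D) (run e σ k) (run f σ k)) :=
  IsPre.run_eq (d := d) (d' := (.ccase _ _ _ _ _ _ _ _ d e f)) (x := Q.cpair (cpsLin R e) (cpsLin R f))
    (by cases Δ <;> rfl) σ (Q.ss_sub_cpair σ (cpsLin R e) (cpsLin R f) k)

theorem run_lapp (e : Deriv Γ none s (.lin C D)) (d : Deriv Γ Δ t (.comp C)) (σ : Sub (cpsCtx R Γ) G)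
    (k : Q G Δ' (.comp (cpsC R D))) :
    run (.lapp _ _ _ _ _ _ e d) σ k = run d σ (Q.lapp (C := cpsC R D) (D := cpsC R C) (val e σ) k) :=
  IsPre.run_eq (d := d) (d' := (.lapp _ _ _ _ _ _ e d)) (x := Q.lapp (C := cpsC R D) (D := cpsC R C) (cpsVal R e) .svar)
    (by cases Δ <;> rfl) σ (Q.ss_sub_lapp (C := cpsC R D) (D := cpsC R C) σ (cpsVal R e) k)

theorem val_var (n : ℕ) (h : Γ[n]? = some A) (σ : Sub (cpsCtx R Γ) G) :
    val (.var _ _ _ h) σ = σ n (cpsV R A) (cpsCtx_getElem? R h) := Q.sub_var ..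
theorem val_vpair (d : Deriv Γ none t A) (e : Deriv Γ none u B) (σ : Sub (cpsCtx R Γ) G) :
    val (.vpair _ _ _ _ _ d e) σ = Q.vpair (val d σ) (val e σ) := Q.sub_vpair σ (cpsVal R d) (cpsVal R e)
theorem val_vfst (d : Deriv Γ none t (.prod A B)) (σ : Sub (cpsCtx R Γ) G) :
    val (.vfst _ _ _ _ d) σ = Q.vfst (A := cpsV R A) (B := cpsV R B) (val d σ) := Q.sub_vfst (A := cpsV R A) (B := cpsV R B) σ (cpsVal R d)
theorem val_vsnd (d : Deriv Γ none t (.prod A B)) (σ : Sub (cpsCtx R Γ) G) :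
    val (.vsnd _ _ _ _ d) σ = Q.vsnd (A := cpsV R A) (B := cpsV R B) (val d σ) := Q.sub_vsnd (A := cpsV R A) (B := cpsV R B) σ (cpsVal R d)
theorem val_vlam (d : Deriv (A :: Γ) none t B) (σ : Sub (cpsCtx R Γ) G) :
    val (.vlam _ _ _ _ d) σ = Q.vlam (val d (σ.lift (cpsV R A))) := Q.sub_vlam (A := cpsV R A) σ (cpsVal R d)
theorem val_vapp (d : Deriv Γ none t (.arr A B)) (e : Deriv Γ none u A)
    (σ : Sub (cpsCtx R Γ) G) :
    val (.vapp _ _ _ _ _ d e) σ = Q.vapp (A := cpsV R A) (B := cpsV R B) (val d σ) (val e σ) :=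
  Q.sub_vapp (A := cpsV R A) (B := cpsV R B) σ (cpsVal R d) (cpsVal R e)
theorem val_llam (d : Deriv Γ (some C) t (.comp D)) (σ : Sub (cpsCtx R Γ) G) :
    val (.llam _ _ _ _ d) σ = Q.llam (C := cpsC R D) (D := cpsC R C) (run d σ .svar) := by
  rw [run_some]
  exact (Q.sub_llam σ (cpsLin R d)).trans (congrArg _ (Q.svar_ss _).symm)

end

mutual
/-- Kripke logical relation between translated values. -/
def VRel (R : CType) : (A₁ A₂ : VType) → (Γ : List VType) →
    Q Γ none (cpsV R A₁) → Q Γ none (cpsV R A₂) → Prop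
  | .base a, A₂ => match A₂ with
    | .base b => fun _ v w => a = b → HEq v w
    | _ => fun _ _ _ => True
  | .unit, _ => fun _ _ _ => True
  | .prod A B, A₂ => match A₂ with
    | .prod A' B' => fun Γ v w =>
      VRel R A A' Γ (Q.vfst (A := cpsV R A) (B := cpsV R B) v)
        (Q.vfst (A := cpsV R A') (B := cpsV R B') w) ∧
      VRel R B B' Γ (Q.vsnd (A := cpsV R A) (B := cpsV R B) v)
        (Q.vsnd (A := cpsV R A') (B := cpsV R B') w)
    | _ => fun _ _ _ => True
  | .arr A B, A₂ => match A₂ with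
    | .arr A' B' => fun Γ v w => ∀ (G : List VType) (ρ : Sub Γ G) (a : Q G none (cpsV R A))
        (a' : Q G none (cpsV R A')), VRel R A A' G a a' →
      VRel R B B' G (Q.vapp (A := cpsV R A) (B := cpsV R B) (Q.sub ρ v) a)
        (Q.vapp (A := cpsV R A') (B := cpsV R B') (Q.sub ρ w) a')
    | _ => fun _ _ _ => True
  | .comp C, A₂ => match A₂ with
    | .comp C' => fun Γ v w => ∀ (G : List VType) (ρ : Sub Γ G) (Δ : Option CType)
        (k : Q G Δ (.comp (cpsC R C))) (k' : Q G Δ (.comp (cpsC R C'))), CRel R C C' G Δ k k' →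
      Q.lapp (C := cpsC R C) (D := R) (Q.sub ρ v) k = Q.lapp (C := cpsC R C') (Q.sub ρ w) k'
    | _ => fun _ _ _ => True
  | .lin C D, A₂ => match A₂ with
    | .lin C' D' => fun Γ v w => ∀ (G : List VType) (ρ : Sub Γ G) (Δ : Option CType)
        (k : Q G Δ (.comp (cpsC R D))) (k' : Q G Δ (.comp (cpsC R D'))), CRel R D D' G Δ k k' →
      CRel R C C' G Δ (Q.lapp (C := cpsC R D) (D := cpsC R C) (Q.sub ρ v) k)
        (Q.lapp (C := cpsC R D') (D := cpsC R C') (Q.sub ρ w) k')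
    | _ => fun _ _ _ => True
/-- Kripke logical relation between continuations. -/
def CRel (R : CType) : (C₁ C₂ : CType) → (Γ : List VType) → (Δ : Option CType) →
    Q Γ Δ (.comp (cpsC R C₁)) → Q Γ Δ (.comp (cpsC R C₂)) → Prop
  | .base a, C₂ => match C₂ with
    | .base b => fun _ _ v w => a = b → HEq v w
    | _ => fun _ _ _ _ => True
  | .cunit, C₂ => match C₂ with
    | .cunit => fun _ _ v w => v = w
    | _ => fun _ _ _ _ => True
  | .iunit, C₂ => match C₂ with
    | .iunit => fun _ _ v w => v = w
    | _ => fun _ _ _ _ => True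
  | .czero, C₂ => match C₂ with
    | .czero => fun _ _ v w => v = w
    | _ => fun _ _ _ _ => True
  | .cand C D, C₂ => match C₂ with
    | .cand C' D' => fun Γ _ k k' => ∀ (G : List VType) (ρ : Sub Γ G) (X : CType)
        (o : Q G (some (.csum (cpsC R C) (cpsC R D))) (.comp X))
        (o' : Q G (some (.csum (cpsC R C') (cpsC R D'))) (.comp X)),
      (∀ (G' : List VType) (ρ' : Sub G G') (Δ' : Option CType) (l : Q G' Δ' (.comp (cpsC R C)))
        (l' : Q G' Δ' (.comp (cpsC R C'))), CRel R C C' G' Δ' l l' →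
        Q.ss (Q.cinl l) (Q.sub ρ' o) = Q.ss (Q.cinl l') (Q.sub ρ' o')) →
      (∀ (G' : List VType) (ρ' : Sub G G') (Δ' : Option CType) (l : Q G' Δ' (.comp (cpsC R D)))
        (l' : Q G' Δ' (.comp (cpsC R D'))), CRel R D D' G' Δ' l l' →
        Q.ss (Q.cinr l) (Q.sub ρ' o) = Q.ss (Q.cinr l') (Q.sub ρ' o')) →
      Q.ss (C := .csum (cpsC R C) (cpsC R D)) (Q.sub ρ k) o =
        Q.ss (C := .csum (cpsC R C') (cpsC R D')) (Q.sub ρ k') o'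
    | _ => fun _ _ _ _ => True
  | .carr A C, C₂ => match C₂ with
    | .carr A' C' => fun Γ _ k k' => ∀ (G : List VType) (ρ : Sub Γ G) (X : CType)
        (o : Q G (some (.copow (cpsV R A) (cpsC R C))) (.comp X))
        (o' : Q G (some (.copow (cpsV R A') (cpsC R C'))) (.comp X)),
      (∀ (G' : List VType) (ρ' : Sub G G') (Δ' : Option CType) (a : Q G' none (cpsV R A))
        (a' : Q G' none (cpsV R A')) (l : Q G' Δ' (.comp (cpsC R C)))
        (l' : Q G' Δ' (.comp (cpsC R C'))), VRel R A A' G' a a' → CRel R C C' G' Δ' l l' →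
        Q.ss (Q.copow a l) (Q.sub ρ' o) = Q.ss (Q.copow a' l') (Q.sub ρ' o')) →
      Q.ss (C := .copow (cpsV R A) (cpsC R C)) (Q.sub ρ k) o =
        Q.ss (C := .copow (cpsV R A') (cpsC R C')) (Q.sub ρ k') o'
    | _ => fun _ _ _ _ => True
  | .bang A, C₂ => match C₂ with
    | .bang A' => fun Γ _ k k' => ∀ (G : List VType) (ρ : Sub Γ G) (a : Q G none (cpsV R A))
        (a' : Q G none (cpsV R A')), VRel R A A' G a a' →
      Q.capp (A := cpsV R A) (C := R) (Q.sub ρ k) a = Q.capp (A := cpsV R A') (Q.sub ρ k') a'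
    | _ => fun _ _ _ _ => True
  | .copow A C, C₂ => match C₂ with
    | .copow A' C' => fun Γ Δ k k' => ∀ (G : List VType) (ρ : Sub Γ G) (a : Q G none (cpsV R A))
        (a' : Q G none (cpsV R A')), VRel R A A' G a a' →
      CRel R C C' G Δ (Q.capp (A := cpsV R A) (C := cpsC R C) (Q.sub ρ k) a)
        (Q.capp (A := cpsV R A') (C := cpsC R C') (Q.sub ρ k') a')
    | _ => fun _ _ _ _ => True
  | .csum C D, C₂ => match C₂ with
    | .csum C' D' => fun Γ Δ k k' =>
      CRel R C C' Γ Δ (Q.cfst (C := cpsC R C) (D := cpsC R D) k)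
        (Q.cfst (C := cpsC R C') (D := cpsC R D') k') ∧
      CRel R D D' Γ Δ (Q.csnd (C := cpsC R C) (D := cpsC R D) k)
        (Q.csnd (C := cpsC R C') (D := cpsC R D') k')
    | _ => fun _ _ _ _ => True
end

section
variable {R : CType} {Γ G G' : List VType} {Δ Δ' : Option CType} {A B A' B' : VType}
  {C D C' D' X : CType}

theorem VRel.sub_arr {v : Q Γ none (.arr (cpsV R A) (cpsV R B))}
    {w : Q Γ none (.arr (cpsV R A') (cpsV R B'))} (h : VRel R (.arr A B) (.arr A' B') Γ v w)
    (ρ : Sub Γ G) : VRel R (.arr A B) (.arr A' B') G (Q.sub ρ v) (Q.sub ρ w) := by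
  intro G' ρ' a a' ha
  dsimp only [cpsV, cpsC]
  rw [Q.sub_sub, Q.sub_sub]
  exact h _ _ _ _ ha
theorem VRel.sub_comp {v : Q Γ none (.lin (cpsC R C) R)} {w : Q Γ none (.lin (cpsC R C') R)}
    (h : VRel R (.comp C) (.comp C') Γ v w) (ρ : Sub Γ G) :
    VRel R (.comp C) (.comp C') G (Q.sub ρ v) (Q.sub ρ w) := by
  intro G' ρ' Δ k k' hk
  dsimp only [cpsV, cpsC]
  rw [Q.sub_sub, Q.sub_sub]
  exact h _ _ _ _ _ hk
theorem VRel.sub_lin {v : Q Γ none (.lin (cpsC R D) (cpsC R C))}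
    {w : Q Γ none (.lin (cpsC R D') (cpsC R C'))} (h : VRel R (.lin C D) (.lin C' D') Γ v w)
    (ρ : Sub Γ G) : VRel R (.lin C D) (.lin C' D') G (Q.sub ρ v) (Q.sub ρ w) := by
  intro G' ρ' Δ k k' hk
  dsimp only [cpsV, cpsC]
  rw [Q.sub_sub, Q.sub_sub]
  exact h _ _ _ _ _ hk

theorem VRel.sub : (A A' : VType) → {v : Q Γ none (cpsV R A)} → {v' : Q Γ none (cpsV R A')} →
    VRel R A A' Γ v v' → (ρ : Sub Γ G) → VRel R A A' G (Q.sub ρ v) (Q.sub ρ v')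
  | .base a, A', v, v', h, ρ => by
    cases A' <;> first | trivial | skip
    intro e; cases e; cases h rfl; rfl
  | .unit, A', v, v', h, ρ => trivial
  | .prod A B, A', v, v', h, ρ => by
    cases A' <;> first | trivial | skip
    rename_i A' B'
    have H := fun (v : Q Γ none (.prod (cpsV R A) (cpsV R B)))
      (w : Q Γ none (.prod (cpsV R A') (cpsV R B')))
      (h1 : VRel R A A' G (Q.sub ρ (Q.vfst v)) (Q.sub ρ (Q.vfst w)))
      (h2 : VRel R B B' G (Q.sub ρ (Q.vsnd v)) (Q.sub ρ (Q.vsnd w))) =>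
      show VRel R (.prod A B) (.prod A' B') G (Q.sub ρ v) (Q.sub ρ w) from
        ⟨by rwa [Q.sub_vfst, Q.sub_vfst] at h1, by rwa [Q.sub_vsnd, Q.sub_vsnd] at h2⟩
    exact H _ _ (VRel.sub A A' h.1 ρ) (VRel.sub B B' h.2 ρ)
  | .arr A B, A', v, v', h, ρ => by
    cases A' <;> first | trivial | exact h.sub_arr ρ
  | .comp A, A', v, v', h, ρ => by
    cases A' <;> first | trivial | exact h.sub_comp ρ
  | .lin A B, A', v, v', h, ρ => by
    cases A' <;> first | trivial | exact h.sub_lin ρ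

theorem CRel.sub_cand {v : Q Γ Δ (.comp (.csum (cpsC R C) (cpsC R D)))}
    {w : Q Γ Δ (.comp (.csum (cpsC R C') (cpsC R D')))}
    (h : CRel R (.cand C D) (.cand C' D') Γ Δ v w)
    (ρ : Sub Γ G) : CRel R (.cand C D) (.cand C' D') G Δ (Q.sub ρ v) (Q.sub ρ w) := by
  intro G' ρ' X o o' h1 h2
  dsimp only [cpsV, cpsC]
  rw [Q.sub_sub, Q.sub_sub]
  exact h _ _ _ _ _ h1 h2
theorem CRel.sub_carr {v : Q Γ Δ (.comp (.copow (cpsV R A) (cpsC R D)))}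
    {w : Q Γ Δ (.comp (.copow (cpsV R A') (cpsC R D')))}
    (h : CRel R (.carr A D) (.carr A' D') Γ Δ v w)
    (ρ : Sub Γ G) : CRel R (.carr A D) (.carr A' D') G Δ (Q.sub ρ v) (Q.sub ρ w) := by
  intro G' ρ' X o o' h1
  dsimp only [cpsV, cpsC]
  rw [Q.sub_sub, Q.sub_sub]
  exact h _ _ _ _ _ h1
theorem CRel.sub_bang {v : Q Γ Δ (.comp (.carr (cpsV R A) R))}
    {w : Q Γ Δ (.comp (.carr (cpsV R A') R))}
    (h : CRel R (.bang A) (.bang A') Γ Δ v w)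
    (ρ : Sub Γ G) : CRel R (.bang A) (.bang A') G Δ (Q.sub ρ v) (Q.sub ρ w) := by
  intro G' ρ' X o h1
  dsimp only [cpsV, cpsC]
  rw [Q.sub_sub, Q.sub_sub]
  exact h _ _ _ _ h1
theorem CRel.sub_copow {v : Q Γ Δ (.comp (.carr (cpsV R A) (cpsC R D)))}
    {w : Q Γ Δ (.comp (.carr (cpsV R A') (cpsC R D')))}
    (h : CRel R (.copow A D) (.copow A' D') Γ Δ v w)
    (ρ : Sub Γ G) : CRel R (.copow A D) (.copow A' D') G Δ (Q.sub ρ v) (Q.sub ρ w) := by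
  intro G' ρ' X o h1
  dsimp only [cpsV, cpsC]
  rw [Q.sub_sub, Q.sub_sub]
  exact h _ _ _ _ h1

theorem CRel.sub : (C C' : CType) → {v : Q Γ Δ (.comp (cpsC R C))} →
    {v' : Q Γ Δ (.comp (cpsC R C'))} →
    CRel R C C' Γ Δ v v' → (ρ : Sub Γ G) → CRel R C C' G Δ (Q.sub ρ v) (Q.sub ρ v')
  | .base a, A', v, v', h, ρ => by
    cases A' <;> first | trivial | skip
    intro e; cases e; cases h rfl; rfl
  | .cunit, A', v, v', h, ρ => by
    cases A' <;> first | trivial | exact congrArg (Q.sub ρ) h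
  | .iunit, A', v, v', h, ρ => by
    cases A' <;> first | trivial | exact congrArg (Q.sub ρ) h
  | .czero, A', v, v', h, ρ => by
    cases A' <;> first | trivial | exact congrArg (Q.sub ρ) h
  | .csum A B, A', v, v', h, ρ => by
    cases A' <;> first | trivial | skip
    rename_i A' B'
    have H := fun (v : Q Γ Δ (.comp (.cand (cpsC R A) (cpsC R B))))
      (w : Q Γ Δ (.comp (.cand (cpsC R A') (cpsC R B'))))
      (h1 : CRel R A A' G Δ (Q.sub ρ (Q.cfst v)) (Q.sub ρ (Q.cfst w)))
      (h2 : CRel R B B' G Δ (Q.sub ρ (Q.csnd v)) (Q.sub ρ (Q.csnd w))) =>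
      show CRel R (.csum A B) (.csum A' B') G Δ (Q.sub ρ v) (Q.sub ρ w) from
        ⟨by rwa [Q.sub_cfst, Q.sub_cfst] at h1, by rwa [Q.sub_csnd, Q.sub_csnd] at h2⟩
    exact H _ _ (CRel.sub A A' h.1 ρ) (CRel.sub B B' h.2 ρ)
  | .cand A B, A', v, v', h, ρ => by
    cases A' <;> first | trivial | exact h.sub_cand ρ
  | .carr A B, A', v, v', h, ρ => by
    cases A' <;> first | trivial | exact h.sub_carr ρ
  | .bang A, A', v, v', h, ρ => by
    cases A' <;> first | trivial | exact h.sub_bang ρ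
  | .copow A B, A', v, v', h, ρ => by
    cases A' <;> first | trivial | exact h.sub_copow ρ

/-- Two observations agree on related continuations. -/
def Obs (R : CType) (C C' X : CType) (G : List VType) (o : Q G (some (cpsC R C)) (.comp X))
    (o' : Q G (some (cpsC R C')) (.comp X)) : Prop :=
  ∀ (G' : List VType) (ρ : Sub G G') (Δ : Option CType) (l : Q G' Δ (.comp (cpsC R C)))
    (l' : Q G' Δ (.comp (cpsC R C'))), CRel R C C' G' Δ l l' →
    Q.ss l (Q.sub ρ o) = Q.ss l' (Q.sub ρ o')

theorem Obs.sub {o : Q G (some (cpsC R C)) (.comp X)}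
    {o' : Q G (some (cpsC R C')) (.comp X)} (h : Obs R C C' X G o o') (ρ : Sub G G') :
    Obs R C C' X G' (Q.sub ρ o) (Q.sub ρ o') := by
  intro G'' ρ' Δ l l' hl
  rw [Q.sub_sub, Q.sub_sub]
  exact h _ _ _ _ _ hl

theorem Obs.ss_eq {o : Q G (some (cpsC R C)) (.comp X)}
    {o' : Q G (some (cpsC R C')) (.comp X)} (h : Obs R C C' X G o o')
    {l : Q G Δ (.comp (cpsC R C))} {l' : Q G Δ (.comp (cpsC R C'))} (hl : CRel R C C' G Δ l l') :
    Q.ss l o = Q.ss l' o' := by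
  have := h _ .id _ _ _ hl
  rwa [Q.sub_id, Q.sub_id] at this

/-- Continuations that no pair of matching observations can tell apart. -/
def Indist (R : CType) (C C' : CType) (Γ : List VType) (Δ : Option CType)
    (k : Q Γ Δ (.comp (cpsC R C))) (k' : Q Γ Δ (.comp (cpsC R C'))) : Prop :=
  ∀ (G : List VType) (ρ : Sub Γ G) (X : CType) (o : Q G (some (cpsC R C)) (.comp X))
    (o' : Q G (some (cpsC R C')) (.comp X)), Obs R C C' X G o o' →
    Q.ss (Q.sub ρ k) o = Q.ss (Q.sub ρ k') o'

theorem obs_svar (h : ∀ (G' : List VType) (Δ : Option CType) (l l' : Q G' Δ (.comp (cpsC R C))),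
    CRel R C C G' Δ l l' → l = l') : Obs R C C (cpsC R C) G .svar .svar := by
  intro G' ρ Δ l l' hl
  cases h _ _ _ _ hl; rfl

theorem Indist.eq {k k' : Q Γ Δ (.comp (cpsC R C))} (h : Indist R C C Γ Δ k k')
    (h' : ∀ (G' : List VType) (Δ : Option CType) (l l' : Q G' Δ (.comp (cpsC R C))),
      CRel R C C G' Δ l l' → l = l') : k = k' := by
  have := h _ .id _ _ _ (obs_svar h')
  rwa [Q.ss_svar, Q.ss_svar, Q.sub_id, Q.sub_id] at this

theorem Indist.cand {v : Q Γ Δ (.comp (.csum (cpsC R C) (cpsC R D)))}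
    {w : Q Γ Δ (.comp (.csum (cpsC R C') (cpsC R D')))}
    (h : Indist R (.cand C D) (.cand C' D') Γ Δ v w) :
    CRel R (.cand C D) (.cand C' D') Γ Δ v w := by
  intro G ρ X o o' h1 h2
  refine h G ρ X o o' ?_
  intro G' ρ' Δ' l l' hl
  have H := fun (l : Q G' Δ' (.comp (.csum (cpsC R C) (cpsC R D))))
      (l' : Q G' Δ' (.comp (.csum (cpsC R C') (cpsC R D'))))
      (hl : CRel R (.cand C D) (.cand C' D') G' Δ' l l') => hl _ .id X (Q.sub ρ' o) (Q.sub ρ' o')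
    (by intro G'' ρ'' Δ'' m m' hm; rw [Q.sub_sub, Q.sub_sub]; exact h1 _ _ _ _ _ hm)
    (by intro G'' ρ'' Δ'' m m' hm; rw [Q.sub_sub, Q.sub_sub]; exact h2 _ _ _ _ _ hm)
  simp only [Q.sub_id] at H
  exact H _ _ hl

theorem Indist.carr {v : Q Γ Δ (.comp (.copow (cpsV R A) (cpsC R D)))}
    {w : Q Γ Δ (.comp (.copow (cpsV R A') (cpsC R D')))}
    (h : Indist R (.carr A D) (.carr A' D') Γ Δ v w) :
    CRel R (.carr A D) (.carr A' D') Γ Δ v w := by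
  intro G ρ X o o' h1
  refine h G ρ X o o' ?_
  intro G' ρ' Δ' l l' hl
  have H := fun (l : Q G' Δ' (.comp (.copow (cpsV R A) (cpsC R D))))
      (l' : Q G' Δ' (.comp (.copow (cpsV R A') (cpsC R D'))))
      (hl : CRel R (.carr A D) (.carr A' D') G' Δ' l l') => hl _ .id X (Q.sub ρ' o) (Q.sub ρ' o')
    (by intro G'' ρ'' Δ'' a a' m m' ha hm; rw [Q.sub_sub, Q.sub_sub]; exact h1 _ _ _ _ _ _ _ ha hm)
  simp only [Q.sub_id] at H
  exact H _ _ hl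

theorem Q.ss_capp_svar (k : Q G Δ (.comp (.carr A C))) (a : Q G none A) :
    Q.ss k (Q.capp .svar a) = Q.capp k a := by simp

theorem CRel.bang_app {v : Q Γ Δ (.comp (.carr (cpsV R A) R))}
    {w : Q Γ Δ (.comp (.carr (cpsV R A') R))} (h : CRel R (.bang A) (.bang A') Γ Δ v w)
    {a : Q Γ none (cpsV R A)} {a' : Q Γ none (cpsV R A')} (ha : VRel R A A' Γ a a') :
    Q.capp v a = Q.capp w a' := by
  have := h _ .id _ _ ha
  rwa [Q.sub_id, Q.sub_id] at this

theorem CRel.copow_app {v : Q Γ Δ (.comp (.carr (cpsV R A) (cpsC R C)))}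
    {w : Q Γ Δ (.comp (.carr (cpsV R A') (cpsC R C')))}
    (h : CRel R (.copow A C) (.copow A' C') Γ Δ v w)
    {a : Q Γ none (cpsV R A)} {a' : Q Γ none (cpsV R A')} (ha : VRel R A A' Γ a a') :
    CRel R C C' Γ Δ (Q.capp v a) (Q.capp w a') := by
  have := h _ .id _ _ ha
  rwa [Q.sub_id, Q.sub_id] at this

theorem Indist.bang {v : Q Γ Δ (.comp (.carr (cpsV R A) R))}
    {w : Q Γ Δ (.comp (.carr (cpsV R A') R))}
    (h : Indist R (.bang A) (.bang A') Γ Δ v w) :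
    CRel R (.bang A) (.bang A') Γ Δ v w := by
  intro G ρ a a' ha
  refine (Q.ss_capp_svar (Q.sub ρ v) a).symm.trans
    ((h G ρ R (Q.capp (C := R) .svar a) (Q.capp (C := R) .svar a') ?_).trans
      (Q.ss_capp_svar (Q.sub ρ w) a'))
  intro G' ρ' Δ' l l' hl
  exact (Q.ss_sub_capp ρ' a l).trans ((hl.bang_app (ha.sub _ _ ρ')).trans
    (Q.ss_sub_capp ρ' a' l').symm)

theorem Indist.copow {v : Q Γ Δ (.comp (.carr (cpsV R A) (cpsC R C)))}
    {w : Q Γ Δ (.comp (.carr (cpsV R A') (cpsC R C')))}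
    (h : Indist R (.copow A C) (.copow A' C') Γ Δ v w)
    {a : Q G none (cpsV R A)} {a' : Q G none (cpsV R A')} (ha : VRel R A A' G a a')
    (ρ : Sub Γ G) : Indist R C C' G Δ (Q.capp (Q.sub ρ v) a) (Q.capp (Q.sub ρ w) a') := by
  intro G' ρ' X o o' ho
  have H := h G' (ρ.comp ρ') X (Q.ss (Q.capp .svar (Q.sub ρ' a)) o)
    (Q.ss (Q.capp .svar (Q.sub ρ' a')) o') ?_
  · dsimp only [cpsV, cpsC] at H
    simpa using H
  · intro G'' ρ'' Δ' l l' hl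
    dsimp only [cpsV, cpsC] at l l' ⊢
    have := ho.sub ρ'' |>.ss_eq (hl.copow_app ((ha.sub _ _ ρ').sub _ _ ρ''))
    simpa using this

theorem Indist.cfst {v : Q Γ Δ (.comp (.cand (cpsC R C) (cpsC R D)))}
    {w : Q Γ Δ (.comp (.cand (cpsC R C') (cpsC R D')))}
    (h : Indist R (.csum C D) (.csum C' D') Γ Δ v w) :
    Indist R C C' Γ Δ (Q.cfst v) (Q.cfst w) := by
  intro G' ρ' X o o' ho
  have H := h G' ρ' X (Q.ss (Q.cfst .svar) o) (Q.ss (Q.cfst .svar) o') ?_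
  · dsimp only [cpsV, cpsC] at H
    simpa using H
  · intro G'' ρ'' Δ' l l' hl
    dsimp only [cpsV, cpsC] at l l' ⊢
    have := ho.sub ρ'' |>.ss_eq hl.1
    simpa using this

theorem Indist.csnd {v : Q Γ Δ (.comp (.cand (cpsC R C) (cpsC R D)))}
    {w : Q Γ Δ (.comp (.cand (cpsC R C') (cpsC R D')))}
    (h : Indist R (.csum C D) (.csum C' D') Γ Δ v w) :
    Indist R D D' Γ Δ (Q.csnd v) (Q.csnd w) := by
  intro G' ρ' X o o' ho
  have H := h G' ρ' X (Q.ss (Q.csnd .svar) o) (Q.ss (Q.csnd .svar) o') ?_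
  · dsimp only [cpsV, cpsC] at H
    simpa using H
  · intro G'' ρ'' Δ' l l' hl
    dsimp only [cpsV, cpsC] at l l' ⊢
    have := ho.sub ρ'' |>.ss_eq hl.2
    simpa using this

/-- The relation on continuations is closed under observational equivalence. -/
theorem Indist.rel : (C C' : CType) → {Γ : List VType} → {v : Q Γ Δ (.comp (cpsC R C))} →
    {w : Q Γ Δ (.comp (cpsC R C'))} → Indist R C C' Γ Δ v w → CRel R C C' Γ Δ v w
  | .base a, C', _, v, w, h => by
    cases C' <;> first | trivial | skip
    rintro rfl
    exact heq_of_eq (h.eq fun _ _ _ _ hl => eq_of_heq (hl rfl))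
  | .cunit, C', _, v, w, h => by
    cases C' <;> first | trivial | exact h.eq fun _ _ _ _ hl => hl
  | .iunit, C', _, v, w, h => by
    cases C' <;> first | trivial | exact h.eq fun _ _ _ _ hl => hl
  | .czero, C', _, v, w, h => by
    cases C' <;> first | trivial | exact h.eq fun _ _ _ _ hl => hl
  | .csum C D, C', _, v, w, h => by
    cases C' <;> first | trivial | exact ⟨Indist.rel _ _ h.cfst, Indist.rel _ _ h.csnd⟩
  | .cand C D, C', _, v, w, h => by cases C' <;> first | trivial | exact h.cand
  | .carr C D, C', _, v, w, h => by cases C' <;> first | trivial | exact h.carr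
  | .bang C, C', _, v, w, h => by cases C' <;> first | trivial | exact h.bang
  | .copow C D, C', _, v, w, h => by
    cases C' <;> first | trivial | exact fun G ρ a a' ha => Indist.rel _ _ (h.copow ha ρ)

mutual
theorem VRel.eq : (A : VType) → {Γ : List VType} → {v w : Q Γ none (cpsV R A)} →
    VRel R A A Γ v w → v = w
  | .base _, _, _, _, h => eq_of_heq (h rfl)
  | .unit, _, v, w, _ => (Q.unit_eta v).trans (Q.unit_eta w).symm
  | .prod A B, _, v, w, h => (Q.vpair_eta (A := cpsV R A) (B := cpsV R B) v).symm.trans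
    ((congrArg₂ _ (VRel.eq A h.1) (VRel.eq B h.2)).trans (Q.vpair_eta _))
  | .arr A B, _, v, w, h => (Q.vlam_eta (A := cpsV R A) (B := cpsV R B) v).symm.trans
    ((congrArg Q.vlam (VRel.eq B (h _ .wk .v0 .v0 (VRel.refl A _)))).trans (Q.vlam_eta _))
  | .comp C, _, v, w, h => by
    have := h _ .id _ .svar .svar (CRel.refl C _)
    dsimp only [cpsV] at v w this
    have e := congrArg Q.llam this
    simp only [Q.sub_id, Q.llam_eta] at e
    exact e
  | .lin C D, _, v, w, h => by
    have := CRel.eq C (h _ .id _ .svar .svar (CRel.refl D _))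
    dsimp only [cpsV] at v w this
    have e := congrArg Q.llam this
    simp only [Q.sub_id, Q.llam_eta] at e
    exact e
theorem VRel.refl : (A : VType) → {Γ : List VType} → (v : Q Γ none (cpsV R A)) →
    VRel R A A Γ v v
  | .base _, _, _ => fun _ => HEq.rfl
  | .unit, _, _ => trivial
  | .prod A B, _, _ => ⟨VRel.refl A _, VRel.refl B _⟩
  | .arr A B, _, _ => fun _ _ a a' h => by cases VRel.eq A h; exact VRel.refl B _
  | .comp C, _, _ => fun _ _ _ k k' h => by cases CRel.eq C h; rfl
  | .lin C D, _, _ => fun _ _ _ k k' h => by cases CRel.eq D h; exact CRel.refl C _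
theorem CRel.eq : (C : CType) → {Γ : List VType} → {Δ : Option CType} →
    {v w : Q Γ Δ (.comp (cpsC R C))} → CRel R C C Γ Δ v w → v = w
  | .base _, _, _, _, _, h => eq_of_heq (h rfl)
  | .cunit, _, _, _, _, h => h
  | .iunit, _, _, _, _, h => h
  | .czero, _, _, _, _, h => h
  | .cand C D, _, _, v, w, h => by
    have := h _ .id _ .svar .svar
      (fun _ _ _ _ _ hl => by cases CRel.eq C hl; rfl)
      (fun _ _ _ _ _ hl => by cases CRel.eq D hl; rfl)
    dsimp only [cpsC] at v w this
    simp only [Q.sub_id, Q.ss_svar] at this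
    exact this
  | .carr A D, _, _, v, w, h => by
    have := h _ .id _ .svar .svar
      (fun _ _ _ _ _ _ _ ha hl => by cases VRel.eq A ha; cases CRel.eq D hl; rfl)
    dsimp only [cpsC] at v w this
    simp only [Q.sub_id, Q.ss_svar] at this
    exact this
  | .bang A, _, _, v, w, h =>  (Q.clam_eta (A := cpsV R A) (C := R) v).symm.trans
    ((congrArg Q.clam (h _ .wk .v0 .v0 (VRel.refl A _))).trans (Q.clam_eta _))
  | .copow A C, _, _, v, w, h => (Q.clam_eta (A := cpsV R A) (C := cpsC R C) v).symm.trans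
    ((congrArg Q.clam (CRel.eq C (h _ .wk .v0 .v0 (VRel.refl A _)))).trans (Q.clam_eta _))
  | .csum C D, _, _, v, w, h => (Q.cpair_eta (C := cpsC R C) (D := cpsC R D) v).symm.trans
    ((congrArg₂ _ (CRel.eq C h.1) (CRel.eq D h.2)).trans (Q.cpair_eta _))
theorem CRel.refl : (C : CType) → {Γ : List VType} → {Δ : Option CType} →
    (v : Q Γ Δ (.comp (cpsC R C))) → CRel R C C Γ Δ v v
  | .base _, _, _, _ => fun _ => HEq.rfl
  | .cunit, _, _, _ => rfl
  | .iunit, _, _, _ => rfl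
  | .czero, _, _, _ => rfl
  | .cand C D, _, _, v => fun G ρ X o o' h1 h2 => by
    have e1 := h1 _ .id _ .svar .svar (CRel.refl C _)
    have e2 := h2 _ .id _ .svar .svar (CRel.refl D _)
    rw [Q.sub_id, Q.sub_id] at e1 e2
    refine (Q.ccase_eta (Q.sub ρ v) o).symm.trans (Eq.trans ?_ (Q.ccase_eta (Q.sub ρ v) o'))
    rw [e1, e2]
  | .carr A D, _, _, v => fun G ρ X o o' h => by
    have e := h _ .wk _ .v0 .v0 .svar .svar (VRel.refl A _) (CRel.refl D _)
    exact (Q.copowlet_eta (Q.sub ρ v) o).symm.trans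
      ((congrArg _ e).trans (Q.copowlet_eta (Q.sub ρ v) o'))
  | .bang A, _, _, v => fun _ _ a a' h => by cases VRel.eq A h; rfl
  | .copow A C, _, _, v => fun _ _ a a' h => by cases VRel.eq A h; exact CRel.refl C _
  | .csum C D, _, _, v => ⟨CRel.refl C _, CRel.refl D _⟩
end

end

section
variable {R : CType} {Γ Γ' G G' : List VType} {Δ Δ' Δ₁ Δ₂ : Option CType} {t u : Tm}
  {A B A' B' : VType} {C D C' D' X : CType}

/-- Pointwise related environments. -/
def SRel (R : CType) (Γ Γ' G : List VType) (σ : Sub (cpsCtx R Γ) G) (σ' : Sub (cpsCtx R Γ') G) :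
    Prop :=
  ∀ n A A' (h : Γ[n]? = some A) (h' : Γ'[n]? = some A'),
    VRel R A A' G (σ n _ (cpsCtx_getElem? R h)) (σ' n _ (cpsCtx_getElem? R h'))

theorem SRel.sub {σ : Sub (cpsCtx R Γ) G} {σ' : Sub (cpsCtx R Γ') G} (h : SRel R Γ Γ' G σ σ')
    (ρ : Sub G G') : SRel R Γ Γ' G' (σ.comp ρ) (σ'.comp ρ) :=
  fun n A A' h1 h2 => VRel.sub _ _ (h n A A' h1 h2) ρ

theorem SRel.cons {σ : Sub (cpsCtx R Γ) G} {σ' : Sub (cpsCtx R Γ') G} (h : SRel R Γ Γ' G σ σ')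
    {a : Q G none (cpsV R A)} {a' : Q G none (cpsV R A')} (ha : VRel R A A' G a a') :
    SRel R (A :: Γ) (A' :: Γ') G (Sub.cons a σ) (Sub.cons a' σ')
  | 0, _, _, h1, h2 => by cases h1; cases h2; exact ha
  | n + 1, _, _, h1, h2 => h n _ _ h1 h2

/-- Relation between the results of running two computations. -/
def ARel (R : CType) : (Δ₁ Δ₂ : Option CType) → (G : List VType) → (Δ : Option CType) →
    Q G Δ (.comp (ans R Δ₁)) → Q G Δ (.comp (ans R Δ₂)) → Prop
  | none, none => fun _ _ x y => x = y
  | some D, some D' => CRel R D D'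
  | _, _ => fun _ _ _ _ => True

theorem ARel.of_obs {x : Q G Δ (.comp (ans R Δ₁))} {y : Q G Δ (.comp (ans R Δ₂))}
    (h : ∀ (G' : List VType) (ρ : Sub G G') (X : CType) (o : Q G' (some (ans R Δ₁)) (.comp X))
      (o' : Q G' (some (ans R Δ₂)) (.comp X)),
      (∀ (G'' : List VType) (ρ' : Sub G' G'') (Δ' : Option CType)
        (l : Q G'' Δ' (.comp (ans R Δ₁))) (l' : Q G'' Δ' (.comp (ans R Δ₂))),
        ARel R Δ₁ Δ₂ G'' Δ' l l' → Q.ss l (Q.sub ρ' o) = Q.ss l' (Q.sub ρ' o')) →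
      Q.ss (Q.sub ρ x) o = Q.ss (Q.sub ρ y) o') : ARel R Δ₁ Δ₂ G Δ x y := by
  cases Δ₁ <;> cases Δ₂
  · have := h _ .id _ .svar .svar fun _ _ _ _ _ h => by cases h; rfl
    simp only [Q.sub_id, Q.ss_svar] at this
    exact this
  · trivial
  · trivial
  · exact Indist.rel _ _ h

/-- Two derivations of computations act alike on related inputs. -/
def CohComp (R : CType) (d : Deriv Γ Δ₁ t (.comp C)) (d' : Deriv Γ' Δ₂ u (.comp C')) : Prop :=
  ∀ (G : List VType) (Δ : Option CType) (σ : Sub (cpsCtx R Γ) G) (σ' : Sub (cpsCtx R Γ') G),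
    SRel R Γ Γ' G σ σ' → ∀ (k : Q G Δ (.comp (cpsC R C))) (k' : Q G Δ (.comp (cpsC R C'))),
    CRel R C C' G Δ k k' → ARel R Δ₁ Δ₂ G Δ (run d σ k) (run d' σ' k')

/-- Two derivations of values act alike on related inputs. -/
def CohVal (R : CType) (d : Deriv Γ none t A) (d' : Deriv Γ' none u A') : Prop :=
  ∀ (G : List VType) (σ : Sub (cpsCtx R Γ) G) (σ' : Sub (cpsCtx R Γ') G),
    SRel R Γ Γ' G σ σ' → VRel R A A' G (val d σ) (val d' σ')

theorem CohVal.comp {d : Deriv Γ none t (.comp C)} {d' : Deriv Γ' none u (.comp C')}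
    (h : CohVal R d d') : CohComp R d d' := by
  intro G Δ σ σ' hσ k k' hk
  have := h G σ σ' hσ _ .id _ _ _ hk
  have e := Q.sub_id (A := .lin (cpsC R C) R) (val d σ)
  have e' := Q.sub_id (A := .lin (cpsC R C') R) (val d' σ')
  exact (congrArg (Q.lapp (D := R) · k) e).symm.trans
    (this.trans (congrArg (Q.lapp (D := R) · k') e'))

theorem CohComp.val {d : Deriv Γ none t (.comp C)} {d' : Deriv Γ' none u (.comp C')}
    (h : CohComp R d d') : CohVal R d d' := by
  intro G σ σ' hσ G' ρ Δ k k' hk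
  have := h G' Δ _ _ (hσ.sub ρ) k k' hk
  change run d _ k = run d' _ k' at this
  rw [run_val, run_val, ← sub_val, ← sub_val] at this
  exact this

/-- Two derivations act alike on related inputs. -/
def Coh (R : CType) (d : Deriv Γ Δ₁ t A) (d' : Deriv Γ' Δ₂ u A') : Prop :=
  match Δ₁, A, Δ₂, A', d, d' with
  | _, .comp _, _, .comp _, d, d' => CohComp R d d'
  | none, _, none, _, d, d' => CohVal R d d'
  | _, _, _, _, _, _ => True

theorem Coh.of_val {d : Deriv Γ none t A} {d' : Deriv Γ' none u A'} (h : CohVal R d d') :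
    Coh R d d' := by
  cases A <;> cases A' <;> first | exact h.comp | exact h

theorem Coh.val {d : Deriv Γ none t A} {d' : Deriv Γ' none u A'} (h : Coh R d d') :
    CohVal R d d' := by
  cases A <;> cases A' <;> first | exact CohComp.val h | exact h


theorem CRel.cinl {k : Q G Δ (.comp (cpsC R C))} {k' : Q G Δ (.comp (cpsC R C'))}
    (h : CRel R C C' G Δ k k') : CRel R (.cand C D) (.cand C' D') G Δ
      (Q.cinl (C := cpsC R C) (D := cpsC R D) k) (Q.cinl (C := cpsC R C') (D := cpsC R D') k') := by
  intro G' ρ X o o' h1 _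
  have := h1 _ .id _ _ _ (h.sub _ _ ρ)
  rw [Q.sub_id, Q.sub_id, ← Q.sub_cinl, ← Q.sub_cinl] at this
  exact this

theorem CRel.cinr {k : Q G Δ (.comp (cpsC R D))} {k' : Q G Δ (.comp (cpsC R D'))}
    (h : CRel R D D' G Δ k k') : CRel R (.cand C D) (.cand C' D') G Δ
      (Q.cinr (C := cpsC R C) (D := cpsC R D) k) (Q.cinr (C := cpsC R C') (D := cpsC R D') k') := by
  intro G' ρ X o o' _ h1
  have := h1 _ .id _ _ _ (h.sub _ _ ρ)
  rw [Q.sub_id, Q.sub_id, ← Q.sub_cinr, ← Q.sub_cinr] at this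
  exact this

theorem CRel.pair_copow {a : Q G none (cpsV R A)} {a' : Q G none (cpsV R A')}
    (ha : VRel R A A' G a a') {k : Q G Δ (.comp (cpsC R C))} {k' : Q G Δ (.comp (cpsC R C'))}
    (h : CRel R C C' G Δ k k') : CRel R (.carr A C) (.carr A' C') G Δ
      (Q.copow a k) (Q.copow a' k') := by
  intro G' ρ X o o' h1
  have := h1 _ .id _ _ _ _ _ (ha.sub _ _ ρ) (h.sub _ _ ρ)
  rw [Q.sub_id, Q.sub_id, ← Q.sub_copow, ← Q.sub_copow] at this
  exact this

theorem CRel.cand_obs {k : Q G Δ (.comp (.csum (cpsC R C) (cpsC R D)))}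
    {k' : Q G Δ (.comp (.csum (cpsC R C') (cpsC R D')))}
    (h : CRel R (.cand C D) (.cand C' D') G Δ k k')
    {a : Q G (some (cpsC R C)) (.comp (ans R Δ₁))} {b : Q G (some (cpsC R D)) (.comp (ans R Δ₁))}
    {a' : Q G (some (cpsC R C')) (.comp (ans R Δ₂))}
    {b' : Q G (some (cpsC R D')) (.comp (ans R Δ₂))}
    (ha : ∀ (G' : List VType) (ρ : Sub G G') (Δ' : Option CType) (l : Q G' Δ' (.comp (cpsC R C)))
      (l' : Q G' Δ' (.comp (cpsC R C'))), CRel R C C' G' Δ' l l' →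
      ARel R Δ₁ Δ₂ G' Δ' (Q.ss l (Q.sub ρ a)) (Q.ss l' (Q.sub ρ a')))
    (hb : ∀ (G' : List VType) (ρ : Sub G G') (Δ' : Option CType) (l : Q G' Δ' (.comp (cpsC R D)))
      (l' : Q G' Δ' (.comp (cpsC R D'))), CRel R D D' G' Δ' l l' →
      ARel R Δ₁ Δ₂ G' Δ' (Q.ss l (Q.sub ρ b)) (Q.ss l' (Q.sub ρ b'))) :
    ARel R Δ₁ Δ₂ G Δ (Q.ccase k a b) (Q.ccase k' a' b') := by
  refine ARel.of_obs fun G' ρ X o o' ho => ?_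
  have := h G' ρ X (Q.ccase .svar (Q.ss (Q.sub ρ a) o) (Q.ss (Q.sub ρ b) o))
    (Q.ccase .svar (Q.ss (Q.sub ρ a') o') (Q.ss (Q.sub ρ b') o')) ?_ ?_
  · rw [Q.sub_ccase, Q.sub_ccase, Q.ss_ccase_left, Q.ss_ccase_left]
    simpa using this
  · intro G'' ρ' Δ' l l' hl
    simpa using ho _ ρ' _ _ _ (ha _ (ρ.comp ρ') _ _ _ hl)
  · intro G'' ρ' Δ' l l' hl
    simpa using ho _ ρ' _ _ _ (hb _ (ρ.comp ρ') _ _ _ hl)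

theorem CRel.carr_obs {k : Q G Δ (.comp (.copow (cpsV R A) (cpsC R C)))}
    {k' : Q G Δ (.comp (.copow (cpsV R A') (cpsC R C')))}
    (h : CRel R (.carr A C) (.carr A' C') G Δ k k')
    {b : Q (cpsV R A :: G) (some (cpsC R C)) (.comp (ans R Δ₁))}
    {b' : Q (cpsV R A' :: G) (some (cpsC R C')) (.comp (ans R Δ₂))}
    (hb : ∀ (G' : List VType) (ρ : Sub G G') (Δ' : Option CType) (a : Q G' none (cpsV R A))
      (a' : Q G' none (cpsV R A')) (l : Q G' Δ' (.comp (cpsC R C)))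
      (l' : Q G' Δ' (.comp (cpsC R C'))), VRel R A A' G' a a' → CRel R C C' G' Δ' l l' →
      ARel R Δ₁ Δ₂ G' Δ' (Q.ss l (Q.sub (.cons a ρ) b)) (Q.ss l' (Q.sub (.cons a' ρ) b'))) :
    ARel R Δ₁ Δ₂ G Δ (Q.copowlet k b) (Q.copowlet k' b') := by
  refine ARel.of_obs fun G' ρ X o o' ho => ?_
  have := h G' ρ X (Q.copowlet .svar (Q.ss (Q.sub (ρ.lift _) b) (Q.up _ o)))
    (Q.copowlet .svar (Q.ss (Q.sub (ρ.lift _) b') (Q.up _ o'))) ?_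
  · rw [Q.sub_copowlet, Q.sub_copowlet, Q.ss_copowlet_left, Q.ss_copowlet_left]
    simpa using this
  · intro G'' ρ' Δ' a a' l l' ha hl
    simpa using ho _ ρ' _ _ _ (hb _ (ρ.comp ρ') _ _ _ _ _ ha hl)

theorem CRel.bang_clam {b : Q (cpsV R A :: G) Δ (.comp R)} {b' : Q (cpsV R A' :: G) Δ (.comp R)}
    (h : ∀ (G' : List VType) (ρ : Sub G G') (a : Q G' none (cpsV R A)) (a' : Q G' none (cpsV R A')),
      VRel R A A' G' a a' → Q.sub (.cons a ρ) b = Q.sub (.cons a' ρ) b') :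
    CRel R (.bang A) (.bang A') G Δ (Q.clam b) (Q.clam b') := by
  intro G' ρ a a' ha
  have := h G' ρ a a' ha
  simpa using this

theorem CRel.copow_clam {b : Q (cpsV R A :: G) Δ (.comp (cpsC R C))}
    {b' : Q (cpsV R A' :: G) Δ (.comp (cpsC R C'))}
    (h : ∀ (G' : List VType) (ρ : Sub G G') (a : Q G' none (cpsV R A)) (a' : Q G' none (cpsV R A')),
      VRel R A A' G' a a' → CRel R C C' G' Δ (Q.sub (.cons a ρ) b) (Q.sub (.cons a' ρ) b')) :
    CRel R (.copow A C) (.copow A' C') G Δ (Q.clam b) (Q.clam b') := by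
  intro G' ρ a a' ha
  have := h G' ρ a a' ha
  simpa using this

theorem VRel.arr_vlam {b : Q (cpsV R A :: G) none (cpsV R B)}
    {b' : Q (cpsV R A' :: G) none (cpsV R B')}
    (h : ∀ (G' : List VType) (ρ : Sub G G') (a : Q G' none (cpsV R A)) (a' : Q G' none (cpsV R A')),
      VRel R A A' G' a a' → VRel R B B' G' (Q.sub (.cons a ρ) b) (Q.sub (.cons a' ρ) b')) :
    VRel R (.arr A B) (.arr A' B') G (Q.vlam b) (Q.vlam b') := by
  intro G' ρ a a' ha
  have := h G' ρ a a' ha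
  simpa using this

theorem VRel.lin_llam {b : Q G (some (cpsC R D)) (.comp (cpsC R C))}
    {b' : Q G (some (cpsC R D')) (.comp (cpsC R C'))}
    (h : ∀ (G' : List VType) (ρ : Sub G G') (Δ : Option CType) (k : Q G' Δ (.comp (cpsC R D)))
      (k' : Q G' Δ (.comp (cpsC R D'))), CRel R D D' G' Δ k k' →
      CRel R C C' G' Δ (Q.ss k (Q.sub ρ b)) (Q.ss k' (Q.sub ρ b'))) :
    VRel R (.lin C D) (.lin C' D') G (Q.llam b) (Q.llam b') := by
  intro G' ρ Δ k k' hk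
  have := h G' ρ Δ k k' hk
  simpa using this

theorem VRel.prod_vpair {a : Q G none (cpsV R A)} {a' : Q G none (cpsV R A')}
    {b : Q G none (cpsV R B)} {b' : Q G none (cpsV R B')}
    (ha : VRel R A A' G a a') (hb : VRel R B B' G b b') :
    VRel R (.prod A B) (.prod A' B') G (Q.vpair a b) (Q.vpair a' b') := by
  refine ⟨?_, ?_⟩
  · rw [Q.vfst_vpair, Q.vfst_vpair]; exact ha
  · rw [Q.vsnd_vpair, Q.vsnd_vpair]; exact hb

theorem CRel.csum_cpair {a : Q G Δ (.comp (cpsC R C))} {a' : Q G Δ (.comp (cpsC R C'))}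
    {b : Q G Δ (.comp (cpsC R D))} {b' : Q G Δ (.comp (cpsC R D'))}
    (ha : CRel R C C' G Δ a a') (hb : CRel R D D' G Δ b b') :
    CRel R (.csum C D) (.csum C' D') G Δ (Q.cpair a b) (Q.cpair a' b') := by
  refine ⟨?_, ?_⟩
  · rw [Q.cfst_cpair, Q.cfst_cpair]; exact ha
  · rw [Q.csnd_cpair, Q.csnd_cpair]; exact hb

theorem VRel.arr_app {v : Q G none (.arr (cpsV R A) (cpsV R B))}
    {w : Q G none (.arr (cpsV R A') (cpsV R B'))} (h : VRel R (.arr A B) (.arr A' B') G v w)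
    {a : Q G none (cpsV R A)} {a' : Q G none (cpsV R A')} (ha : VRel R A A' G a a') :
    VRel R B B' G (Q.vapp v a) (Q.vapp w a') := by
  have := h _ .id _ _ ha
  rwa [Q.sub_id, Q.sub_id] at this

theorem VRel.lin_app {v : Q G none (.lin (cpsC R D) (cpsC R C))}
    {w : Q G none (.lin (cpsC R D') (cpsC R C'))} (h : VRel R (.lin C D) (.lin C' D') G v w)
    {a : Q G Δ (.comp (cpsC R D))} {a' : Q G Δ (.comp (cpsC R D'))} (ha : CRel R D D' G Δ a a') :
    CRel R C C' G Δ (Q.lapp v a) (Q.lapp w a') := by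
  have := h _ .id _ _ _ ha
  rwa [Q.sub_id, Q.sub_id] at this

theorem ARel.cimage (k : Q G Δ (.comp .czero)) :
    ARel R Δ₁ Δ₂ G Δ (Q.cimage k) (Q.cimage k) := by
  refine ARel.of_obs fun G' ρ X o o' _ => ?_
  rw [Q.sub_cimage, Q.sub_cimage, Q.ss_cimage_left, Q.ss_cimage_left]

theorem Q.sub_cons_up (ρ : Sub G G') (a : Q G' none A) (q : Q G Δ B) :
    Q.sub (.cons a ρ) (Q.up A q) = Q.sub ρ q := by
  rw [Q.sub_sub, Sub.wk_cons]

theorem ARel.congr {x x' : Q G Δ (.comp (ans R Δ₁))} {y y' : Q G Δ (.comp (ans R Δ₂))}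
    (hx : x = x') (hy : y = y') (h : ARel R Δ₁ Δ₂ G Δ x' y') : ARel R Δ₁ Δ₂ G Δ x y := by
  subst hx hy; exact h

theorem CRel.congr {x x' : Q G Δ (.comp (cpsC R C))} {y y' : Q G Δ (.comp (cpsC R C'))}
    (hx : x = x') (hy : y = y') (h : CRel R C C' G Δ x' y') : CRel R C C' G Δ x y := by
  subst hx hy; exact h

theorem VRel.congr {x x' : Q G none (cpsV R A)} {y y' : Q G none (cpsV R A')}
    (hx : x = x') (hy : y = y') (h : VRel R A A' G x' y') : VRel R A A' G x y := by
  subst hx hy; exact h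

theorem sub_run_lift (d : Deriv (A :: Γ) Δ t (.comp C)) (σ : Sub (cpsCtx R Γ) G)
    (k : Q (cpsV R A :: G) Δ' (.comp (cpsC R C))) (a : Q G' none (cpsV R A)) (ρ : Sub G G') :
    Q.sub (.cons a ρ) (run d (σ.lift (cpsV R A)) k) =
      run d (.cons a (σ.comp ρ)) (Q.sub (.cons a ρ) k) :=
  (sub_run d _ k _).trans
    (congrArg (run d · (Q.sub (.cons a ρ) k)) (Sub.lift_cons a σ ρ))

theorem sub_val_lift (d : Deriv (A :: Γ) none t B) (σ : Sub (cpsCtx R Γ) G)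
    (a : Q G' none (cpsV R A)) (ρ : Sub G G') :
    Q.sub (.cons a ρ) (val d (σ.lift (cpsV R A))) = val d (.cons a (σ.comp ρ)) :=
  (sub_val d _ _).trans (congrArg (val d ·) (Sub.lift_cons a σ ρ))

theorem ss_sub_run_svar (d : Deriv Γ Δ t (.comp C)) (σ : Sub (cpsCtx R Γ) G) (ρ : Sub G G')
    (k : Q G' Δ' (.comp (cpsC R C))) :
    Q.ss k (Q.sub ρ (run d σ .svar)) = run d (σ.comp ρ) k := by
  rw [sub_run, ss_run, Q.sub_svar, Q.ss_svar]

theorem ss_sub_run_lift_svar (d : Deriv (A :: Γ) Δ t (.comp C)) (σ : Sub (cpsCtx R Γ) G)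
    (ρ : Sub G G') (a : Q G' none (cpsV R A)) (k : Q G' Δ' (.comp (cpsC R C))) :
    Q.ss k (Q.sub (.cons a ρ) (run d (σ.lift (cpsV R A)) .svar)) =
      run d (.cons a (σ.comp ρ)) k :=
  (congrArg (Q.ss k) (sub_run_lift d σ .svar a ρ)).trans
    ((ss_run d _ _ k).trans (by rw [Q.sub_svar, Q.ss_svar]))

theorem fundamental (d : Deriv Γ Δ₁ t A) : ∀ {Γ' : List VType} {Δ₂ : Option CType} {A' : VType}
    (d' : Deriv Γ' Δ₂ t A'), Coh R d d' := by
  induction d with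
  | var Γ n A h =>
    intro _ _ _ d'
    cases d' with
    | var _ _ _ h' =>
    refine Coh.of_val fun G σ σ' hσ => ?_
    exact .congr (val_var _ _ _) (val_var _ _ _) (hσ n _ _ h h')
  | svar Γ C =>
    intro _ _ _ d'
    cases d' with
    | svar =>
    intro G Δ σ σ' hσ k k' hk
    refine .congr (run_svar σ k) (run_svar σ' k') ?_
    exact hk
  | unit Γ =>
    intro _ _ _ d'
    cases d'
    exact fun G σ σ' hσ => trivial
  | vpair _ _ _ _ _ d e ihd ihe =>
    intro _ _ _ d'
    cases d' with
    | vpair _ _ _ _ _ d' e' =>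
    refine Coh.of_val fun G σ σ' hσ => ?_
    refine .congr (val_vpair d e σ) (val_vpair d' e' σ') ?_
    exact .prod_vpair ((ihd d').val _ _ _ hσ) ((ihe e').val _ _ _ hσ)
  | vfst _ _ _ _ d ihd =>
    intro _ _ _ d'
    cases d' with
    | vfst _ _ _ _ d' =>
    refine Coh.of_val fun G σ σ' hσ => ?_
    refine .congr (val_vfst d σ) (val_vfst d' σ') ?_
    exact ((ihd d').val _ _ _ hσ).1
  | vsnd _ _ _ _ d ihd =>
    intro _ _ _ d'
    cases d' with
    | vsnd _ _ _ _ d' =>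
    refine Coh.of_val fun G σ σ' hσ => ?_
    refine .congr (val_vsnd d σ) (val_vsnd d' σ') ?_
    exact ((ihd d').val _ _ _ hσ).2
  | vlam _ _ _ _ d ihd =>
    intro _ _ _ d'
    cases d' with
    | vlam _ _ _ _ d' =>
    refine Coh.of_val fun G σ σ' hσ => ?_
    refine .congr (val_vlam d σ) (val_vlam d' σ') ?_
    refine .arr_vlam fun G' ρ a a' ha => ?_
    rw [sub_val_lift, sub_val_lift]
    exact (ihd d').val _ _ _ ((hσ.sub ρ).cons ha)
  | vapp _ _ _ _ _ d e ihd ihe =>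
    intro _ _ _ d'
    cases d' with
    | vapp _ _ _ _ _ d' e' =>
    refine Coh.of_val fun G σ σ' hσ => ?_
    refine .congr (val_vapp d e σ) (val_vapp d' e' σ') ?_
    exact ((ihd d').val _ _ _ hσ).arr_app ((ihe e').val _ _ _ hσ)
  | cunit Γ Δ =>
    intro _ _ _ d'
    cases d' with
    | cunit =>
    intro G Δ σ σ' hσ k k' hk
    cases hk
    refine .congr (run_cunit σ k) (run_cunit σ' k) ?_
    exact ARel.cimage k
  | cpair _ _ _ _ _ _ d e ihd ihe =>
    intro _ _ _ d'
    cases d' with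
    | cpair _ _ _ _ _ _ d' e' =>
    intro G Δ σ σ' hσ k k' hk
    refine .congr (run_cpair d e σ k) (run_cpair d' e' σ' k') ?_
    refine hk.cand_obs ?_ ?_
    · intro G' ρ Δ' l l' hl
      rw [ss_sub_run_svar, ss_sub_run_svar]
      exact (ihd d') _ _ _ _ (hσ.sub ρ) _ _ hl
    · intro G' ρ Δ' l l' hl
      rw [ss_sub_run_svar, ss_sub_run_svar]
      exact (ihe e') _ _ _ _ (hσ.sub ρ) _ _ hl
  | cfst _ _ _ _ _ d ihd =>
    intro _ _ _ d'
    cases d' with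
    | cfst _ _ _ _ _ d' =>
    intro G Δ σ σ' hσ k k' hk
    refine .congr (run_cfst d σ k) (run_cfst d' σ' k') ?_
    exact (ihd d') _ _ _ _ hσ _ _ hk.cinl
  | csnd _ _ _ _ _ d ihd =>
    intro _ _ _ d'
    cases d' with
    | csnd _ _ _ _ _ d' =>
    intro G Δ σ σ' hσ k k' hk
    refine .congr (run_csnd d σ k) (run_csnd d' σ' k') ?_
    exact (ihd d') _ _ _ _ hσ _ _ hk.cinr
  | clam _ _ _ _ _ d ihd =>
    intro _ _ _ d'
    cases d' with
    | clam _ _ _ _ _ d' =>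
    intro G Δ σ σ' hσ k k' hk
    refine .congr (run_clam d σ k) (run_clam d' σ' k') ?_
    refine hk.carr_obs ?_
    intro G' ρ Δ' a a' l l' ha hl
    rw [ss_sub_run_lift_svar, ss_sub_run_lift_svar]
    exact (ihd d') _ _ _ _ ((hσ.sub ρ).cons ha) _ _ hl
  | capp _ _ _ _ _ _ d e ihd ihe =>
    intro _ _ _ d'
    cases d' with
    | capp _ _ _ _ _ _ d' e' =>
    intro G Δ σ σ' hσ k k' hk
    refine .congr (run_capp d e σ k) (run_capp d' e' σ' k') ?_
    exact (ihd d') _ _ _ _ hσ _ _ (hk.pair_copow ((ihe e').val _ _ _ hσ))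
  | top =>
    intro _ _ _ d'
    cases d' with
    | top =>
    intro G Δ σ σ' hσ k k' hk
    exact (run_top σ k).trans (Eq.trans hk (run_top σ' k').symm)
  | ilet _ _ _ _ _ d e ihd ihe =>
    intro _ _ _ d'
    cases d' with
    | ilet _ _ _ _ _ d' e' =>
    intro G Δ σ σ' hσ k k' hk
    refine .congr (run_ilet d e σ k) (run_ilet d' e' σ' k') ?_
    exact (ihd d') _ _ _ _ hσ _ _ ((ihe e') _ _ _ _ hσ _ _ hk)
  | bang _ _ _ d ihd =>
    intro _ _ _ d'
    cases d' with
    | bang _ _ _ d' =>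
    intro G Δ σ σ' hσ k k' hk
    refine .congr (run_bang d σ k) (run_bang d' σ' k') ?_
    exact hk.bang_app ((ihd d').val _ _ _ hσ)
  | banglet _ _ _ _ _ _ d e ihd ihe =>
    intro _ _ _ d'
    cases d' with
    | banglet _ _ _ _ _ _ d' e' =>
    intro G Δ σ σ' hσ k k' hk
    refine .congr (run_banglet d e σ k) (run_banglet d' e' σ' k') ?_
    refine (ihd d') _ _ _ _ hσ _ _ (.bang_clam fun G' ρ a a' ha => ?_)
    have := (ihe e') _ _ _ _ ((hσ.sub ρ).cons ha) _ _ (CRel.sub _ _ hk ρ)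
    refine (sub_run_lift e _ _ _ _).trans (Eq.trans ?_ (sub_run_lift e' _ _ _ _).symm)
    rw [Q.sub_cons_up, Q.sub_cons_up]
    exact this
  | copow _ _ _ _ _ _ e d ihe ihd =>
    intro _ _ _ d'
    cases d' with
    | copow _ _ _ _ _ _ e' d' =>
    intro G Δ σ σ' hσ k k' hk
    refine .congr (run_copow e d σ k) (run_copow e' d' σ' k') ?_
    exact (ihd d') _ _ _ _ hσ _ _ (hk.copow_app ((ihe e').val _ _ _ hσ))
  | copowlet _ _ _ _ _ _ _ d e ihd ihe =>
    intro _ _ _ d'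
    cases d' with
    | copowlet _ _ _ _ _ _ _ d' e' =>
    intro G Δ σ σ' hσ k k' hk
    refine .congr (run_copowlet d e σ k) (run_copowlet d' e' σ' k') ?_
    refine (ihd d') _ _ _ _ hσ _ _ (.copow_clam fun G' ρ a a' ha => ?_)
    have := (ihe e') _ _ _ _ ((hσ.sub ρ).cons ha) _ _ (CRel.sub _ _ hk ρ)
    refine .congr (sub_run_lift e _ _ _ _) (sub_run_lift e' _ _ _ _) ?_
    rw [Q.sub_cons_up, Q.sub_cons_up]
    exact this
  | cimage _ _ _ _ d ihd =>
    intro _ _ _ d'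
    cases d' with
    | cimage _ _ _ _ d' =>
    intro G Δ σ σ' hσ k k' hk
    refine .congr (run_cimage d σ k) (run_cimage d' σ' k') ?_
    exact (ihd d') _ _ _ _ hσ _ _ rfl
  | cinl _ _ _ _ _ d ihd =>
    intro _ _ _ d'
    cases d' with
    | cinl _ _ _ _ _ d' =>
    intro G Δ σ σ' hσ k k' hk
    refine .congr (run_cinl d σ k) (run_cinl d' σ' k') ?_
    exact (ihd d') _ _ _ _ hσ _ _ hk.1
  | cinr _ _ _ _ _ d ihd =>
    intro _ _ _ d'
    cases d' with
    | cinr _ _ _ _ _ d' =>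
    intro G Δ σ σ' hσ k k' hk
    refine .congr (run_cinr d σ k) (run_cinr d' σ' k') ?_
    exact (ihd d') _ _ _ _ hσ _ _ hk.2
  | ccase _ _ _ _ _ _ _ _ d e f ihd ihe ihf =>
    intro _ _ _ d'
    cases d' with
    | ccase _ _ _ _ _ _ _ _ d' e' f' =>
    intro G Δ σ σ' hσ k k' hk
    refine .congr (run_ccase d e f σ k) (run_ccase d' e' f' σ' k') ?_
    exact (ihd d') _ _ _ _ hσ _ _
      (.csum_cpair ((ihe e') _ _ _ _ hσ _ _ hk) ((ihf f') _ _ _ _ hσ _ _ hk))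
  | llam _ _ _ _ d ihd =>
    intro _ _ _ d'
    cases d' with
    | llam _ _ _ _ d' =>
    refine Coh.of_val fun G σ σ' hσ => ?_
    refine .congr (val_llam d σ) (val_llam d' σ') ?_
    refine .lin_llam fun G' ρ Δ k k' hk => ?_
    refine .congr (ss_sub_run_svar d _ _ _) (ss_sub_run_svar d' _ _ _) ?_
    exact (ihd d') _ _ _ _ (hσ.sub ρ) _ _ hk
  | lapp _ _ _ _ _ _ e d ihe ihd =>
    intro _ _ _ d'
    cases d' with
    | lapp _ _ _ _ _ _ e' d' =>
    intro G Δ σ σ' hσ k k' hk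
    refine .congr (run_lapp e d σ k) (run_lapp e' d' σ' k') ?_
    exact (ihd d') _ _ _ _ hσ _ _ (((ihe e').val _ _ _ hσ).lin_app hk)

theorem SRel.refl (σ : Sub (cpsCtx R Γ) G) : SRel R Γ Γ G σ σ := by
  intro n A A' h h'
  cases h.symm.trans h'
  exact VRel.refl _ _

/-- Coherence: the self-translation does not depend on the chosen derivation. -/
theorem cpsQ_congr (d d' : Deriv Γ Δ t A) : cpsQ R d = cpsQ R d' := by
  cases Δ with
  | none =>
    have := VRel.eq A ((fundamental (R := R) d d').val _ _ _ (SRel.refl .id))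
    exact (Q.sub_id _).symm.trans (this.trans (Q.sub_id _))
  | some D =>
    cases A with
    | comp C =>
      have := CRel.eq D (fundamental (R := R) d d' _ _ _ _ (SRel.refl .id) _ _
        (CRel.refl C (.svar (Γ := cpsCtx R Γ))))
      have e (d : Deriv Γ (some D) t (.comp C)) : run d .id .svar = cpsLin R d :=
        (Q.svar_ss _).trans (Q.sub_id _)
      exact (e d).symm.trans (this.trans (e d'))
    | _ => nomatch d

end

/-- The result type is a constant or the unit of the tensor. -/
class ResultType (R : CType) : Prop where
  eq_base_or_iunit : (∃ a, R = .base a) ∨ R = .iunit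

section
variable {R : CType} [ResultType R]

theorem cpsC_result : cpsC R R = .iunit := by
  rcases ResultType.eq_base_or_iunit (R := R) with ⟨a, rfl⟩ | rfl
  · simp [cpsC]
  · rfl

theorem cpsC_cpsC_base (a : ℕ) : cpsC R (cpsC R (.base a)) = .base a := by
  rcases ResultType.eq_base_or_iunit (R := R) with ⟨b, rfl⟩ | rfl
  · by_cases h : b = a
    · subst h; simp [cpsC]
    · simp [cpsC, h]
  · rfl

end

mutual
theorem iotaV_closed (R : CType) : (A : VType) → (s : ℕ → Tm) →
    (iotaV R A).psubst s = iotaV R A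
  | .base _, _ | .unit, _ => rfl
  | .prod A B, s => by simp [iotaV, Tm.psubst, Tm.liftS, iotaV_closed R A, iotaV_closed R B]
  | .arr A B, s => by
    simp [iotaV, Tm.psubst, Tm.liftS, Tm.shift, Tm.rename, iotaVinv_closed R A, iotaV_closed R B]
  | .comp A, s => by simp [iotaV, Tm.psubst, Tm.liftS, iotaC_closed R A]
  | .lin A B, s => by
    simp [iotaV, Tm.psubst, Tm.liftS, iotaC_closed R B, iotaCinv_closed R A]
theorem iotaVinv_closed (R : CType) : (A : VType) → (s : ℕ → Tm) →
    (iotaVinv R A).psubst s = iotaVinv R A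
  | .base _, _ | .unit, _ => rfl
  | .prod A B, s => by
    simp [iotaVinv, Tm.psubst, Tm.liftS, iotaVinv_closed R A, iotaVinv_closed R B]
  | .arr A B, s => by
    simp [iotaVinv, Tm.psubst, Tm.liftS, Tm.shift, Tm.rename, iotaV_closed R A,
      iotaVinv_closed R B]
  | .comp A, s => by simp [iotaVinv, Tm.psubst, Tm.liftS, iotaCinv_closed R A]
  | .lin A B, s => by
    simp [iotaVinv, Tm.psubst, Tm.liftS, iotaCinv_closed R B, iotaC_closed R A]
theorem iotaC_closed (R : CType) : (A : CType) → (s : ℕ → Tm) →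
    (iotaC R A).psubst s = iotaC R A
  | .base _, _ | .cunit, _ | .iunit, _ | .czero, _ => rfl
  | .cand A B, s => by simp [iotaC, Tm.psubst, iotaC_closed R A, iotaC_closed R B]
  | .carr A B, s => by
    simp [iotaC, Tm.psubst, Tm.liftS, iotaVinv_closed R A, iotaC_closed R B]
  | .bang A, s => by simp [iotaC, Tm.psubst, Tm.liftS, iotaV_closed R A]
  | .copow A B, s => by
    simp [iotaC, Tm.psubst, Tm.liftS, iotaV_closed R A, iotaC_closed R B]
  | .csum A B, s => by simp [iotaC, Tm.psubst, iotaC_closed R A, iotaC_closed R B]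
theorem iotaCinv_closed (R : CType) : (A : CType) → (s : ℕ → Tm) →
    (iotaCinv R A).psubst s = iotaCinv R A
  | .base _, _ | .cunit, _ | .iunit, _ | .czero, _ => rfl
  | .cand A B, s => by simp [iotaCinv, Tm.psubst, iotaCinv_closed R A, iotaCinv_closed R B]
  | .carr A B, s => by
    simp [iotaCinv, Tm.psubst, Tm.liftS, iotaV_closed R A, iotaCinv_closed R B]
  | .bang A, s => by simp [iotaCinv, Tm.psubst, Tm.liftS, iotaVinv_closed R A]
  | .copow A B, s => by
    simp [iotaCinv, Tm.psubst, Tm.liftS, iotaVinv_closed R A, iotaCinv_closed R B]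
  | .csum A B, s => by simp [iotaCinv, Tm.psubst, iotaCinv_closed R A, iotaCinv_closed R B]
end


section
variable {Γ : List VType}

theorem HasTy.svar_of_eq {C D : CType} (h : C = D) : HasTy Γ (some C) .svar (.comp D) := by
  subst h; exact .svar
theorem HasTy.top_of_eq {C : CType} (h : C = .iunit) : HasTy Γ none .top (.comp C) := by
  subst h; exact ⟨.top _⟩
theorem HasTy.v0 {A : VType} : HasTy (A :: Γ) none (.var 0) A := ⟨.var _ _ _ rfl⟩
theorem HasTy.v1 {A B : VType} : HasTy (A :: B :: Γ) none (.var 1) B := ⟨.var _ _ _ rfl⟩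
theorem HasTy.unit : HasTy Γ none .unit .unit := ⟨.unit _⟩
theorem HasTy.cunit {Δ : Option CType} : HasTy Γ Δ .cunit (.comp .cunit) := ⟨.cunit _ _⟩
end

mutual
theorem iotaV_ty (R : CType) [ResultType R] : (A : VType) → (Γ : List VType) →
    HasTy Γ none (iotaV R A) (.arr (cpsV R (cpsV R A)) A)
  | .base _, _ => HasTy.v0.vlam
  | .unit, _ => HasTy.unit.vlam
  | .prod A B, _ => HasTy.vlam (((iotaV_ty R A _).vapp HasTy.v0.vfst).vpair
      ((iotaV_ty R B _).vapp HasTy.v0.vsnd))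
  | .arr A B, _ => HasTy.vlam (HasTy.vlam ((iotaV_ty R B _).vapp
      (HasTy.v1.vapp ((iotaVinv_ty R A _).vapp .v0))))
  | .comp A, _ => HasTy.vlam ((iotaC_ty R A _).lapp (HasTy.v0.lapp (.top_of_eq cpsC_result)))
  | .lin A B, _ => HasTy.vlam (HasTy.llam ((iotaC_ty R B _).lapp
      (HasTy.v0.lapp ((iotaCinv_ty R A _).lapp .svar))))
theorem iotaVinv_ty (R : CType) [ResultType R] : (A : VType) → (Γ : List VType) →
    HasTy Γ none (iotaVinv R A) (.arr A (cpsV R (cpsV R A)))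
  | .base _, _ => HasTy.v0.vlam
  | .unit, _ => HasTy.unit.vlam
  | .prod A B, _ => HasTy.vlam (((iotaVinv_ty R A _).vapp HasTy.v0.vfst).vpair
      ((iotaVinv_ty R B _).vapp HasTy.v0.vsnd))
  | .arr A B, _ => HasTy.vlam (HasTy.vlam ((iotaVinv_ty R B _).vapp
      (HasTy.v1.vapp ((iotaV_ty R A _).vapp .v0))))
  | .comp A, Γ => by
    have : HasTy Γ none (iotaVinv R (.comp A))
        (.arr (.comp A) (.lin .iunit (cpsC R (cpsC R A)))) :=
      HasTy.vlam (HasTy.llam (HasTy.svar.ilet ((iotaCinv_ty R A _).lapp .v0)))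
    rw [← cpsC_result (R := R)] at this
    exact this
  | .lin A B, _ => HasTy.vlam (HasTy.llam ((iotaCinv_ty R B _).lapp
      (HasTy.v0.lapp ((iotaC_ty R A _).lapp .svar))))
theorem iotaC_ty (R : CType) [ResultType R] : (A : CType) → (Γ : List VType) →
    HasTy Γ none (iotaC R A) (.lin (cpsC R (cpsC R A)) A)
  | .base a, _ => HasTy.llam (.svar_of_eq (cpsC_cpsC_base a))
  | .cunit, _ => HasTy.llam .cunit
  | .czero, _ => HasTy.llam .svar
  | .iunit, _ => HasTy.llam (.svar_of_eq cpsC_result)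
  | .cand A B, _ => HasTy.llam (((iotaC_ty R A _).lapp HasTy.svar.cfst).cpair
      ((iotaC_ty R B _).lapp HasTy.svar.csnd))
  | .carr A B, _ => HasTy.llam (HasTy.clam ((iotaC_ty R B _).lapp
      (HasTy.svar.capp ((iotaVinv_ty R A _).vapp .v0))))
  | .bang A, _ => HasTy.llam (HasTy.svar.copowlet
      ((HasTy.svar_of_eq cpsC_result).ilet ((iotaV_ty R A _).vapp .v0).bang))
  | .copow A B, _ => HasTy.llam (HasTy.svar.copowlet
      (((iotaV_ty R A _).vapp .v0).copow ((iotaC_ty R B _).lapp .svar)))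
  | .csum A B, _ => HasTy.llam (HasTy.svar.ccase ((iotaC_ty R A _).lapp .svar).cinl
      ((iotaC_ty R B _).lapp .svar).cinr)
theorem iotaCinv_ty (R : CType) [ResultType R] : (A : CType) → (Γ : List VType) →
    HasTy Γ none (iotaCinv R A) (.lin A (cpsC R (cpsC R A)))
  | .base a, _ => HasTy.llam (.svar_of_eq (cpsC_cpsC_base a).symm)
  | .cunit, _ => HasTy.llam .cunit
  | .czero, _ => HasTy.llam .svar
  | .iunit, _ => HasTy.llam (.svar_of_eq cpsC_result.symm)
  | .cand A B, _ => HasTy.llam (((iotaCinv_ty R A _).lapp HasTy.svar.cfst).cpair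
      ((iotaCinv_ty R B _).lapp HasTy.svar.csnd))
  | .carr A B, _ => HasTy.llam (HasTy.clam ((iotaCinv_ty R B _).lapp
      (HasTy.svar.capp ((iotaV_ty R A _).vapp .v0))))
  | .bang A, _ => HasTy.llam (HasTy.svar.banglet
      (((iotaVinv_ty R A _).vapp .v0).copow (.top_of_eq cpsC_result)))
  | .copow A B, _ => HasTy.llam (HasTy.svar.copowlet
      (((iotaVinv_ty R A _).vapp .v0).copow ((iotaCinv_ty R B _).lapp .svar)))
  | .csum A B, _ => HasTy.llam (HasTy.svar.ccase ((iotaCinv_ty R A _).lapp .svar).cinl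
      ((iotaCinv_ty R B _).lapp .svar).cinr)
end

namespace Q
variable {Γ G : List VType} {Δ : Option CType} {C D X : CType} {A : VType}

/-- Transport along an equality of computation types. -/
def coe (h : C = D) (q : Q Γ Δ (.comp C)) : Q Γ Δ (.comp D) := h ▸ q

@[simp] theorem coe_rfl (h : C = C) (q : Q Γ Δ (.comp C)) : coe h q = q := rfl
@[simp] theorem coe_coe (h : C = D) (h' : D = X) (q : Q Γ Δ (.comp C)) :
    coe h' (coe h q) = coe (h.trans h') q := by subst h; subst h'; rfl
@[simp] theorem sub_coe (σ : Sub Γ G) (h : C = D) (q : Q Γ Δ (.comp C)) :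
    sub σ (coe h q) = coe h (sub σ q) := by subst h; rfl
@[simp] theorem ss_coe (h : C = D) (q : Q Γ Δ (.comp X)) (r : Q Γ (some X) (.comp C)) :
    ss q (coe h r) = coe h (ss q r) := by subst h; rfl
theorem mk_coe (h : C = D) {t : Tm} (ht : HasTy Γ Δ t (.comp C)) (ht' : HasTy Γ Δ t (.comp D)) :
    mk t ht' = coe h (mk t ht) := by subst h; rfl
end Q

section
variable {R : CType} [ResultType R] {Γ G : List VType} {Δ Δ' : Option CType} {C D X : CType}
  {A B : VType}

/-- The element of the twice translated result type. -/
def topc : Q Γ none (.comp (cpsC R R)) := Q.coe cpsC_result.symm .top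
theorem topc_eq : (topc : Q Γ none (.comp (cpsC R R))) = Q.mk .top (.top_of_eq cpsC_result) :=
  (Q.mk_coe _ ⟨.top _⟩ _).symm
@[simp] theorem sub_topc (σ : Sub Γ G) : Q.sub σ (topc (R := R)) = topc := by simp [topc]

/-- The action of `ι_A` on values. -/
def iV (A : VType) (v : Q Γ none (cpsV R (cpsV R A))) : Q Γ none A :=
  Q.vapp (Q.mk _ (iotaV_ty R A Γ)) v
/-- The action of the inverse of `ι_A` on values. -/
def jV (A : VType) (v : Q Γ none A) : Q Γ none (cpsV R (cpsV R A)) :=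
  Q.vapp (Q.mk _ (iotaVinv_ty R A Γ)) v
/-- The action of `ι_C` on computations. -/
def iC (C : CType) (q : Q Γ Δ (.comp (cpsC R (cpsC R C)))) : Q Γ Δ (.comp C) :=
  Q.lapp (Q.mk _ (iotaC_ty R C Γ)) q
/-- The action of the inverse of `ι_C` on computations. -/
def jC (C : CType) (q : Q Γ Δ (.comp C)) : Q Γ Δ (.comp (cpsC R (cpsC R C))) :=
  Q.lapp (Q.mk _ (iotaCinv_ty R C Γ)) q

@[simp] theorem sub_iV (σ : Sub Γ G) (v : Q Γ none (cpsV R (cpsV R A))) :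
    Q.sub σ (iV A v) = iV A (Q.sub σ v) := by
  rw [iV, Q.sub_vapp, Q.sub_mk_raw]
  exact congrArg (Q.vapp · _) (Q.mk_congr (iotaV_closed ..))
@[simp] theorem sub_jV (σ : Sub Γ G) (v : Q Γ none A) :
    Q.sub σ (jV (R := R) A v) = jV A (Q.sub σ v) := by
  rw [jV, Q.sub_vapp, Q.sub_mk_raw]
  exact congrArg (Q.vapp · _) (Q.mk_congr (iotaVinv_closed ..))
@[simp] theorem sub_iC (σ : Sub Γ G) (q : Q Γ Δ (.comp (cpsC R (cpsC R C)))) :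
    Q.sub σ (iC C q) = iC C (Q.sub σ q) := by
  rw [iC, Q.sub_lapp, Q.sub_mk_raw]
  exact congrArg (Q.lapp · _) (Q.mk_congr (iotaC_closed ..))
@[simp] theorem sub_jC (σ : Sub Γ G) (q : Q Γ Δ (.comp C)) :
    Q.sub σ (jC (R := R) C q) = jC C (Q.sub σ q) := by
  rw [jC, Q.sub_lapp, Q.sub_mk_raw]
  exact congrArg (Q.lapp · _) (Q.mk_congr (iotaCinv_closed ..))
@[simp] theorem ss_iC (r : Q Γ Δ (.comp X)) (q : Q Γ (some X) (.comp (cpsC R (cpsC R C)))) :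
    Q.ss r (iC C q) = iC C (Q.ss r q) := Q.ss_lapp ..
@[simp] theorem ss_jC (r : Q Γ Δ (.comp X)) (q : Q Γ (some X) (.comp C)) :
    Q.ss r (jC (R := R) C q) = jC C (Q.ss r q) := Q.ss_lapp ..
theorem jC_eq_ss (q : Q Γ Δ (.comp C)) : jC (R := R) C q = Q.ss q (jC C .svar) := by simp

theorem iV_prod (v : Q Γ none (.prod (cpsV R (cpsV R A)) (cpsV R (cpsV R B)))) :
    iV (R := R) (.prod A B) v = .vpair (iV A (.vfst v)) (iV B (.vsnd v)) :=
  (Q.vapp_vlam (.vpair (iV (R := R) A (.vfst .v0)) (iV B (.vsnd .v0))) v).trans (by simp)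
theorem jV_prod (v : Q Γ none (.prod A B)) :
    jV (R := R) (.prod A B) v = Q.vpair (jV (R := R) A (.vfst v)) (jV (R := R) B (.vsnd v)) :=
  (Q.vapp_vlam (.vpair (jV (R := R) A (.vfst .v0)) (jV (R := R) B (.vsnd .v0))) v).trans (by simp)
theorem Q.sub_inst_var_one (a : Q Γ none A) :
    (Sub.inst a).lift B 1 A rfl = Q.up B a := rfl
theorem iV_arr (v : Q Γ none (.arr (cpsV R (cpsV R A)) (cpsV R (cpsV R B)))) :
    iV (R := R) (.arr A B) v = .vlam (iV B (.vapp (.up A v) (jV A .v0))) :=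
  (Q.vapp_vlam (.vlam (iV (R := R) B (.vapp (.var 1 _ rfl) (jV A .v0)))) v).trans
    (by simp [Q.sub_inst_var_one])
theorem jV_arr (v : Q Γ none (.arr A B)) :
    jV (R := R) (.arr A B) v =
      Q.vlam (jV (R := R) B (.vapp (.up (cpsV R (cpsV R A)) v) (iV A .v0))) :=
  (Q.vapp_vlam (.vlam (jV (R := R) B (.vapp (.var 1 _ rfl) (iV (R := R) A .v0)))) v).trans
    (by simp [Q.sub_inst_var_one])
theorem iV_comp (v : Q Γ none (.lin (cpsC R R) (cpsC R (cpsC R C)))) :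
    iV (R := R) (.comp C) v = iC C (.lapp v topc) := by
  refine (Q.vapp_vlam (iC (R := R) C
    (.lapp .v0 (.mk .top (.top_of_eq cpsC_result)))) v).trans ?_
  rw [← topc_eq]
  simp
theorem Q.mk_iota_comp (h : D = .iunit) {t : Tm} (ht : HasTy (.comp C :: Γ) none t (.comp X))
    (h' : HasTy Γ none (.vlam (.comp C) (.llam .iunit (.ilet .svar t))) (.arr (.comp C) (.lin D X))) :
    Q.mk _ h' = Q.vlam (.llam (.ilet (.coe h .svar) (.mk t ht))) := by
  subst h; rfl
theorem jV_comp (v : Q Γ none (.comp C)) :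
    jV (R := R) (.comp C) v =
      Q.llam (C := cpsC R R) (.ilet (.coe cpsC_result .svar) (jC (R := R) C v)) := by
  refine (congrArg (Q.vapp · v) (Q.mk_iota_comp (D := cpsC R R) cpsC_result
    ((iotaCinv_ty R C _).lapp .v0) _)).trans ?_
  refine (Q.vapp_vlam (Q.llam (.ilet (.coe cpsC_result .svar) (jC (R := R) C .v0))) v).trans ?_
  simp
theorem iV_lin (v : Q Γ none (.lin (cpsC R (cpsC R C)) (cpsC R (cpsC R D)))) :
    iV (R := R) (.lin C D) v = .llam (iC D (.lapp v (jC C .svar))) :=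
  (Q.vapp_vlam (.llam (iC (R := R) D (.lapp .v0 (jC C .svar)))) v).trans (by simp)
theorem jV_lin (v : Q Γ none (.lin C D)) :
    jV (R := R) (.lin C D) v = Q.llam (jC (R := R) D (.lapp v (iC (R := R) C .svar))) :=
  (Q.vapp_vlam (.llam (jC (R := R) D (.lapp .v0 (iC (R := R) C .svar)))) v).trans (by simp)

theorem Q.lapp_mk_llam_svar (h : C = D) (h' : HasTy Γ none (.llam C .svar) (.lin C D))
    (q : Q Γ Δ (.comp C)) : Q.lapp (.mk _ h') q = Q.coe h q := by
  subst h; exact (Q.lapp_llam .svar q).trans (by simp)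
theorem Q.svar_coe (h : C = D) :
    Q.coe h (.svar : Q Γ _ _) = Q.mk .svar (.svar_of_eq h) := by subst h; rfl

theorem iC_base (a : ℕ) (q : Q Γ Δ (.comp (cpsC R (cpsC R (.base a))))) :
    iC (.base a) q = Q.coe (cpsC_cpsC_base a) q :=
  Q.lapp_mk_llam_svar ..
theorem jC_base (a : ℕ) (q : Q Γ Δ (.comp (.base a))) :
    jC (R := R) (.base a) q = Q.coe (cpsC_cpsC_base a).symm q :=
  Q.lapp_mk_llam_svar ..
theorem iC_iunit (q : Q Γ Δ (.comp (cpsC R R))) :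
    iC (R := R) .iunit q = Q.coe cpsC_result q :=
  Q.lapp_mk_llam_svar (D := .iunit) cpsC_result _ q
theorem jC_iunit (q : Q Γ Δ (.comp .iunit)) :
    jC (R := R) .iunit q = Q.coe cpsC_result.symm q :=
  Q.lapp_mk_llam_svar (C := .iunit) (D := cpsC R R) cpsC_result.symm _ q
theorem iC_czero (q : Q Γ Δ (.comp .czero)) : iC (R := R) .czero q = q :=
  (Q.lapp_llam .svar q).trans (by simp)
theorem jC_czero (q : Q Γ Δ (.comp .czero)) : jC (R := R) .czero q = q :=
  (Q.lapp_llam .svar q).trans (by simp)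
theorem iC_cand (q : Q Γ Δ (.comp (.cand (cpsC R (cpsC R C)) (cpsC R (cpsC R D))))) :
    iC (R := R) (.cand C D) q = .cpair (iC C (.cfst q)) (iC D (.csnd q)) :=
  (Q.lapp_llam (.cpair (iC (R := R) C (.cfst .svar)) (iC D (.csnd .svar))) q).trans (by simp)
theorem jC_cand (q : Q Γ Δ (.comp (.cand C D))) :
    jC (R := R) (.cand C D) q = Q.cpair (jC (R := R) C (.cfst q)) (jC (R := R) D (.csnd q)) :=
  (Q.lapp_llam (.cpair (jC (R := R) C (.cfst .svar)) (jC (R := R) D (.csnd .svar))) q).trans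
    (by simp)
theorem iC_carr (q : Q Γ Δ (.comp (.carr (cpsV R (cpsV R A)) (cpsC R (cpsC R C))))) :
    iC (R := R) (.carr A C) q = .clam (iC C (.capp (.up A q) (jV A .v0))) :=
  (Q.lapp_llam (.clam (iC (R := R) C (.capp .svar (jV A .v0)))) q).trans (by simp)
theorem jC_carr (q : Q Γ Δ (.comp (.carr A C))) :
    jC (R := R) (.carr A C) q =
      Q.clam (jC (R := R) C (.capp (.up (cpsV R (cpsV R A)) q) (iV A .v0))) :=
  (Q.lapp_llam (.clam (jC (R := R) C (.capp .svar (iV (R := R) A .v0)))) q).trans (by simp)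
theorem iC_copow (q : Q Γ Δ (.comp (.copow (cpsV R (cpsV R A)) (cpsC R (cpsC R C))))) :
    iC (R := R) (.copow A C) q = .copowlet q (.copow (iV A .v0) (iC C .svar)) :=
  (Q.lapp_llam (.copowlet .svar (.copow (iV (R := R) A .v0) (iC C .svar))) q).trans (by simp)
theorem jC_copow (q : Q Γ Δ (.comp (.copow A C))) :
    jC (R := R) (.copow A C) q =
      Q.copowlet q (.copow (jV (R := R) A .v0) (jC (R := R) C .svar)) :=
  (Q.lapp_llam (.copowlet .svar (.copow (jV (R := R) A .v0) (jC (R := R) C .svar))) q).trans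
    (by simp)
theorem iC_csum (q : Q Γ Δ (.comp (.csum (cpsC R (cpsC R C)) (cpsC R (cpsC R D))))) :
    iC (R := R) (.csum C D) q = .ccase q (.cinl (iC C .svar)) (.cinr (iC D .svar)) :=
  (Q.lapp_llam (.ccase .svar (.cinl (iC (R := R) C .svar)) (.cinr (iC D .svar))) q).trans (by simp)
theorem jC_csum (q : Q Γ Δ (.comp (.csum C D))) :
    jC (R := R) (.csum C D) q =
      Q.ccase q (.cinl (jC (R := R) C .svar)) (.cinr (jC (R := R) D .svar)) :=
  (Q.lapp_llam (.ccase .svar (.cinl (jC (R := R) C .svar)) (.cinr (jC (R := R) D .svar))) q).trans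
    (by simp)
theorem iC_bang (q : Q Γ Δ (.comp (.copow (cpsV R (cpsV R A)) (cpsC R R)))) :
    iC (R := R) (.bang A) q = .copowlet q (.ilet (.coe cpsC_result .svar) (.bang (iV A .v0))) := by
  refine (Q.lapp_llam (.copowlet .svar (.ilet (.mk .svar (.svar_of_eq cpsC_result))
    (.bang (iV (R := R) A .v0)))) q).trans ?_
  rw [← Q.svar_coe cpsC_result]
  simp
theorem jC_bang (q : Q Γ Δ (.comp (.bang A))) :
    jC (R := R) (.bang A) q = Q.banglet q (.copow (jV (R := R) A .v0) (topc (R := R))) := by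
  refine (Q.lapp_llam (.banglet .svar (.copow (jV (R := R) A .v0)
    (.mk .top (.top_of_eq cpsC_result)))) q).trans ?_
  rw [← topc_eq]
  simp

@[simp] theorem coe_topc : Q.coe (cpsC_result (R := R)) topc = (Q.top : Q Γ none _) := by
  simp [topc]

theorem Q.ilet_coe_lapp (h : C = .iunit) (v : Q Γ none (.lin C D)) :
    Q.ilet (.coe h .svar) (.lapp v (.coe h.symm .top)) = Q.lapp v .svar := by
  subst h
  have := Q.ilet_eta .svar (.lapp v .svar)
  simpa using this
theorem Q.ilet_coe_copow (h : C = .iunit) (v : Q Γ none A) :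
    Q.ilet (.coe h .svar) (.copow v (.coe h.symm .top)) = Q.copow v .svar := by
  subst h
  have := Q.ilet_eta .svar (.copow v .svar)
  simpa using this

mutual
theorem iV_jV : (A : VType) → {Γ : List VType} → (v : Q Γ none A) →
    iV (R := R) A (jV (R := R) A v) = v
  | .base a, Γ, v => by
    refine (Q.vapp_vlam (A := .base a) .v0 _).trans ((Q.sub_v0 _).trans ?_)
    refine (Q.vapp_vlam (A := .base a) .v0 _).trans ((Q.sub_v0 _).trans rfl)
  | .unit, _, v => (Q.unit_eta _).trans (Q.unit_eta _).symm
  | .prod A B, _, v => by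
    refine (congrArg (iV (R := R) (.prod A B)) (jV_prod v)).trans ((iV_prod _).trans ?_)
    simp [iV_jV A, iV_jV B]
  | .arr A B, _, v => by
    refine (congrArg (iV (R := R) (.arr A B)) (jV_arr v)).trans ((iV_arr _).trans ?_)
    simp [iV_jV A, iV_jV B, Q.vlam_eta]
  | .comp C, _, v => by
    refine (congrArg (iV (R := R) (.comp C)) (jV_comp v)).trans ((iV_comp _).trans ?_)
    simp [iC_jC C]
  | .lin C D, _, v => by
    refine (congrArg (iV (R := R) (.lin C D)) (jV_lin v)).trans ((iV_lin _).trans ?_)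
    simp [iC_jC C, iC_jC D]
theorem jV_iV : (A : VType) → {Γ : List VType} → (v : Q Γ none (cpsV R (cpsV R A))) →
    jV (R := R) A (iV (R := R) A v) = v
  | .base a, _, v => by
    refine (Q.vapp_vlam (A := .base a) .v0 _).trans ((Q.sub_v0 _).trans ?_)
    refine (Q.vapp_vlam (A := .base a) .v0 _).trans ((Q.sub_v0 _).trans rfl)
  | .unit, _, v => (Q.unit_eta _).trans (Q.unit_eta _).symm
  | .prod A B, _, v => by
    refine (congrArg (jV (R := R) (.prod A B)) (iV_prod v)).trans ((jV_prod _).trans ?_)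
    rw [Q.vfst_vpair, Q.vsnd_vpair, jV_iV A, jV_iV B]
    exact Q.vpair_eta _
  | .arr A B, Γ, v => by
    refine (congrArg (jV (R := R) (.arr A B)) (iV_arr v)).trans ((jV_arr _).trans ?_)
    have key (w : Q Γ none (.arr (cpsV R (cpsV R A)) (cpsV R (cpsV R B)))) :
        Q.vlam (jV (R := R) B (.vapp (.up (cpsV R (cpsV R A))
          (.vlam (iV B (.vapp (.up A w) (jV A .v0))))) (iV A .v0))) = w := by
      simp [jV_iV A, jV_iV B, Q.vlam_eta]
    exact key v
  | .comp C, _, v => by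
    refine (congrArg (jV (R := R) (.comp C)) (iV_comp v)).trans ((jV_comp _).trans ?_)
    rw [jC_iC C, topc]
    exact (congrArg Q.llam (Q.ilet_coe_lapp cpsC_result v)).trans (Q.llam_eta _)
  | .lin C D, Γ, v => by
    refine (congrArg (jV (R := R) (.lin C D)) (iV_lin v)).trans ((jV_lin _).trans ?_)
    have key (w : Q Γ none (.lin (cpsC R (cpsC R C)) (cpsC R (cpsC R D)))) :
        Q.llam (jC (R := R) D (.lapp (.llam (iC D (.lapp w (jC C .svar)))) (iC (R := R) C .svar))) = w := by
      simp [jC_iC C, jC_iC D]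
    exact key v
theorem iC_jC : (C : CType) → {Γ : List VType} → {Δ : Option CType} → (q : Q Γ Δ (.comp C)) →
    iC (R := R) C (jC (R := R) C q) = q
  | .base _, _, _, q => by rw [jC_base, iC_base]; simp
  | .cunit, _, _, q => (Q.cunit_eta _).trans (Q.cunit_eta _).symm
  | .czero, _, _, q => by rw [jC_czero, iC_czero]
  | .iunit, _, _, q => by rw [jC_iunit, iC_iunit]; simp
  | .cand C D, _, _, q => by
    refine (congrArg (iC (R := R) (.cand C D)) (jC_cand q)).trans ((iC_cand _).trans ?_)
    simp [iC_jC C, iC_jC D]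
  | .carr A C, _, _, q => by
    refine (congrArg (iC (R := R) (.carr A C)) (jC_carr q)).trans ((iC_carr _).trans ?_)
    simp [iV_jV A, iC_jC C, Q.clam_eta]
  | .bang A, _, _, q => by
    refine (congrArg (iC (R := R) (.bang A)) (jC_bang q)).trans ((iC_bang _).trans ?_)
    have := Q.ss_banglet_left q (.copow (jV (R := R) A .v0) (topc (R := R)))
      (.copowlet .svar (.ilet (.coe cpsC_result .svar) (.bang (iV A .v0))))
    simp [iV_jV A] at this
    refine this.trans ?_
    have := Q.banglet_eta q .svar
    simpa using this
  | .copow A C, _, _, q => by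
    refine (congrArg (iC (R := R) (.copow A C)) (jC_copow q)).trans ((iC_copow _).trans ?_)
    have := Q.ss_copowlet_left q (.copow (jV (R := R) A .v0) (jC (R := R) C .svar))
      (.copowlet .svar (.copow (iV A .v0) (iC C .svar)))
    simp [iV_jV A, iC_jC C] at this
    refine this.trans ?_
    have := Q.copowlet_eta q .svar
    simpa using this
  | .csum C D, _, _, q => by
    refine (congrArg (iC (R := R) (.csum C D)) (jC_csum q)).trans ((iC_csum _).trans ?_)
    have := Q.ss_ccase_left q (.cinl (jC (R := R) C .svar)) (.cinr (jC (R := R) D .svar))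
      (.ccase .svar (.cinl (iC C .svar)) (.cinr (iC D .svar)))
    simp [iC_jC C, iC_jC D] at this
    refine this.trans ?_
    have := Q.ccase_eta q .svar
    simpa using this
theorem jC_iC : (C : CType) → {Γ : List VType} → {Δ : Option CType} →
    (q : Q Γ Δ (.comp (cpsC R (cpsC R C)))) → jC (R := R) C (iC (R := R) C q) = q
  | .base _, _, _, q => by rw [iC_base, jC_base]; simp
  | .cunit, _, _, q => (Q.cunit_eta _).trans (Q.cunit_eta _).symm
  | .czero, _, _, q => (jC_czero _).trans (iC_czero _)
  | .iunit, _, _, q => (jC_iunit _).trans ((congrArg _ (iC_iunit q)).trans (Q.coe_coe ..))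
  | .cand C D, _, _, q => by
    refine (congrArg (jC (R := R) (.cand C D)) (iC_cand q)).trans ((jC_cand _).trans ?_)
    rw [Q.cfst_cpair, Q.csnd_cpair, jC_iC C, jC_iC D]
    exact Q.cpair_eta _
  | .carr A C, Γ, Δ, q => by
    refine (congrArg (jC (R := R) (.carr A C)) (iC_carr q)).trans ((jC_carr _).trans ?_)
    have key (w : Q Γ Δ (.comp (.carr (cpsV R (cpsV R A)) (cpsC R (cpsC R C))))) :
        Q.clam (jC (R := R) C (.capp (.up (cpsV R (cpsV R A))
          (.clam (iC C (.capp (.up A w) (jV A .v0))))) (iV A .v0))) = w := by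
      simp [jV_iV A, jC_iC C, Q.clam_eta]
    exact key q
  | .bang A, Γ, Δ, q => by
    refine (congrArg (jC (R := R) (.bang A)) (iC_bang q)).trans ((jC_bang _).trans ?_)
    have key (w : Q Γ Δ (.comp (.copow (cpsV R (cpsV R A)) (cpsC R R)))) :
        Q.banglet (.copowlet w (.ilet (.coe cpsC_result .svar) (.bang (iV (R := R) A .v0))))
          (.copow (jV (R := R) A .v0) (topc (R := R))) = w := by
      have h := Q.ss_copowlet_left w (.ilet (.coe cpsC_result .svar) (.bang (iV A .v0)))
        (.banglet .svar (.copow (jV (R := R) A .v0) (topc (R := R))))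
      rw [Q.up, Q.sub_banglet, Q.ss_ilet_left] at h
      simp [jV_iV A] at h
      rw [h, topc, Q.ilet_coe_copow]
      simpa using Q.copowlet_eta w .svar
    exact key q
  | .copow A C, Γ, Δ, q => by
    refine (congrArg (jC (R := R) (.copow A C)) (iC_copow q)).trans ((jC_copow _).trans ?_)
    have key (w : Q Γ Δ (.comp (.copow (cpsV R (cpsV R A)) (cpsC R (cpsC R C))))) :
        Q.copowlet (.copowlet w (.copow (iV (R := R) A .v0) (iC (R := R) C .svar)))
          (.copow (jV (R := R) A .v0) (jC (R := R) C .svar)) = w := by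
      have h := Q.ss_copowlet_left w (.copow (iV (R := R) A .v0) (iC (R := R) C .svar))
        (.copowlet .svar (.copow (jV (R := R) A .v0) (jC (R := R) C .svar)))
      simp [jV_iV A, jC_iC C] at h
      rw [h]
      simpa using Q.copowlet_eta w .svar
    exact key q
  | .csum C D, Γ, Δ, q => by
    refine (congrArg (jC (R := R) (.csum C D)) (iC_csum q)).trans ((jC_csum _).trans ?_)
    have key (w : Q Γ Δ (.comp (.csum (cpsC R (cpsC R C)) (cpsC R (cpsC R D))))) :
        Q.ccase (.ccase w (.cinl (iC (R := R) C .svar)) (.cinr (iC (R := R) D .svar)))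
          (.cinl (jC (R := R) C .svar)) (.cinr (jC (R := R) D .svar)) = w := by
      have h := Q.ss_ccase_left w (.cinl (iC (R := R) C .svar)) (.cinr (iC (R := R) D .svar))
        (.ccase .svar (.cinl (jC (R := R) C .svar)) (.cinr (jC (R := R) D .svar)))
      simp [jC_iC C, jC_iC D] at h
      rw [h]
      simpa using Q.ccase_eta w .svar
    exact key q
end

end

theorem Tm.rename_ssubst (f : ℕ → ℕ) (u t : Tm) :
    (Tm.ssubst u t).rename f = Tm.ssubst (u.rename f) (t.rename f) := by
  simp only [Tm.rename_eq_psubst]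
  exact Tm.psubst_ssubst _ (fun _ => by trivial) _ _

/-- Renaming of derivations commutes with the self-translation. -/
theorem Deriv.exists_rename (R : CType) {Γ : List VType} {Δ : Option CType} {t : Tm} {A : VType}
    (d : Deriv Γ Δ t A) : ∀ {Γ' : List VType} (f : ℕ → ℕ),
    (∀ n B, Γ[n]? = some B → Γ'[f n]? = some B) →
    ∃ d' : Deriv Γ' Δ (t.rename f) A, cps R d' = (cps R d).rename f := by
  have lift : ∀ {Γ Γ' : List VType} {f : ℕ → ℕ} (B : VType),
      (∀ n B, Γ[n]? = some B → Γ'[f n]? = some B) →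
      ∀ n C, (B :: Γ)[n]? = some C → (B :: Γ')[Tm.liftN f n]? = some C := by
    intro Γ Γ' f B h n C
    cases n with
    | zero => simp [Tm.liftN]
    | succ n => simpa [Tm.liftN] using h n C
  induction d with
  | var Γ n A h => intro Γ' f hf; exact ⟨.var _ _ _ (hf _ _ h), rfl⟩
  | svar => intro Γ' f hf; exact ⟨.svar _ _, rfl⟩
  | unit => intro Γ' f hf; exact ⟨.unit _, rfl⟩
  | top => intro Γ' f hf; exact ⟨.top _, rfl⟩
  | cunit Γ Δ => intro Γ' f hf; exact ⟨.cunit _ _, by cases Δ <;> rfl⟩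
  | vfst _ _ _ _ _ h | vsnd _ _ _ _ _ h | bang _ _ _ _ h | llam _ _ _ _ _ h =>
    intro Γ' f hf
    obtain ⟨d, hd⟩ := h f hf
    first
    | exact ⟨.vfst _ _ _ _ d, by simp [cps, Tm.rename, hd]⟩
    | exact ⟨.vsnd _ _ _ _ d, by simp [cps, Tm.rename, hd]⟩
    | exact ⟨.bang _ _ _ d, by simp [cps, Tm.rename, hd]⟩
    | exact ⟨.llam _ _ _ _ d, by simp [cps, Tm.rename, hd]⟩
  | vpair _ _ _ _ _ _ _ h1 h2 | vapp _ _ _ _ _ _ _ h1 h2 =>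
    intro Γ' f hf
    obtain ⟨d, hd⟩ := h1 f hf
    obtain ⟨e, he⟩ := h2 f hf
    first
    | exact ⟨.vpair _ _ _ _ _ d e, by simp [cps, Tm.rename, hd, he]⟩
    | exact ⟨.vapp _ _ _ _ _ d e, by simp [cps, Tm.rename, hd, he]⟩
  | vlam _ _ _ _ _ h =>
    intro Γ' f hf
    obtain ⟨d, hd⟩ := h _ (lift _ hf)
    exact ⟨.vlam _ _ _ _ d, by simp [cps, Tm.rename, hd]⟩
  | clam Γ Δ _ _ _ _ h =>
    intro Γ' f hf
    obtain ⟨d, hd⟩ := h _ (lift _ hf)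
    exact ⟨.clam _ _ _ _ _ d, by cases Δ <;> simp [cps, Tm.rename, hd]⟩
  | cfst Γ Δ _ _ _ _ h | csnd Γ Δ _ _ _ _ h | cimage Γ Δ _ _ _ h | cinl Γ Δ _ _ _ _ h
  | cinr Γ Δ _ _ _ _ h =>
    intro Γ' f hf
    obtain ⟨d, hd⟩ := h f hf
    first
    | exact ⟨.cfst _ _ _ _ _ d, by cases Δ <;> simp [cps, Tm.rename, hd, Tm.rename_ssubst]⟩
    | exact ⟨.csnd _ _ _ _ _ d, by cases Δ <;> simp [cps, Tm.rename, hd, Tm.rename_ssubst]⟩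
    | exact ⟨.cimage _ _ _ _ d, by cases Δ <;> simp [cps, Tm.rename, hd, Tm.rename_ssubst]⟩
    | exact ⟨.cinl _ _ _ _ _ d, by cases Δ <;> simp [cps, Tm.rename, hd, Tm.rename_ssubst]⟩
    | exact ⟨.cinr _ _ _ _ _ d, by cases Δ <;> simp [cps, Tm.rename, hd, Tm.rename_ssubst]⟩
  | cpair Γ Δ _ _ _ _ _ _ h1 h2 | capp Γ Δ _ _ _ _ _ _ h1 h2 | ilet Γ Δ _ _ _ _ _ h1 h2
  | copow Γ Δ _ _ _ _ _ _ h1 h2 | lapp Γ Δ _ _ _ _ _ _ h1 h2 =>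
    intro Γ' f hf
    obtain ⟨d, hd⟩ := h1 f hf
    obtain ⟨e, he⟩ := h2 f hf
    first
    | exact ⟨.cpair _ _ _ _ _ _ d e,
        by cases Δ <;> simp [cps, Tm.rename, hd, he]⟩
    | exact ⟨.capp _ _ _ _ _ _ d e,
        by cases Δ <;> simp [cps, Tm.rename, hd, he, Tm.rename_ssubst]⟩
    | exact ⟨.ilet _ _ _ _ _ d e,
        by cases Δ <;> simp [cps, Tm.rename, hd, he, Tm.rename_ssubst]⟩
    | exact ⟨.copow _ _ _ _ _ _ d e,
        by cases Δ <;> simp [cps, Tm.rename, hd, he, Tm.rename_ssubst]⟩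
    | exact ⟨.lapp _ _ _ _ _ _ d e,
        by cases Δ <;> simp [cps, Tm.rename, hd, he, Tm.rename_ssubst]⟩
  | banglet Γ Δ _ _ _ _ _ _ h1 h2 | copowlet Γ Δ _ _ _ _ _ _ _ h1 h2 =>
    intro Γ' f hf
    obtain ⟨d, hd⟩ := h1 f hf
    obtain ⟨e, he⟩ := h2 _ (lift _ hf)
    first
    | exact ⟨.banglet _ _ _ _ _ _ d e,
        by cases Δ <;> simp [cps, Tm.rename, hd, he, Tm.rename_ssubst]⟩
    | exact ⟨.copowlet _ _ _ _ _ _ _ d e,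
        by cases Δ <;> simp [cps, Tm.rename, hd, he, Tm.rename_ssubst]⟩
  | ccase Γ Δ _ _ _ _ _ _ _ _ _ h1 h2 h3 =>
    intro Γ' f hf
    obtain ⟨d, hd⟩ := h1 f hf
    obtain ⟨e, he⟩ := h2 f hf
    obtain ⟨e', he'⟩ := h3 f hf
    exact ⟨.ccase _ _ _ _ _ _ _ _ d e e',
      by cases Δ <;> simp [cps, Tm.rename, hd, he, he', Tm.rename_ssubst]⟩

section
variable {R : CType} {Γ G : List VType} {Δ Δ' : Option CType} {t : Tm} {A B : VType} {C : CType}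

theorem Deriv.exists_shift (R : CType) (B : VType) (d : Deriv Γ Δ t A) :
    ∃ d' : Deriv (B :: Γ) Δ t.shift A, cpsQ R d' = Q.up (cpsV R B) (cpsQ R d) := by
  obtain ⟨d', h⟩ := d.exists_rename R (Γ' := B :: Γ) Nat.succ (fun _ _ h => by simpa using h)
  exact ⟨d', (Q.mk_congr h).trans (Q.up_mk ..).symm⟩

theorem Deriv.exists_shift_run (R : CType) (B : VType) (d : Deriv Γ Δ t (.comp C)) :
    ∃ d' : Deriv (B :: Γ) Δ t.shift (.comp C), ∀ (G : List VType) (Δ' : Option CType)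
      (σ : Sub (cpsCtx R (B :: Γ)) G) (k : Q G Δ' (.comp (cpsC R C))),
      run d' σ k = run d (Sub.comp (Sub.wk (A := cpsV R B)) σ) k := by
  obtain ⟨d', h⟩ := d.exists_shift R B
  refine ⟨d', fun G Δ' σ k => ?_⟩
  cases Δ with
  | none =>
    rw [run_none, run_none]
    refine congrArg (fun x => Q.lapp (Q.sub σ x) k) h |>.trans ?_
    exact congrArg (Q.lapp · k) (Q.sub_sub ..)
  | some D =>
    rw [run_some, run_some]
    refine congrArg (fun x => Q.ss k (Q.sub σ x)) h |>.trans ?_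
    exact congrArg (Q.ss k) (Q.sub_sub ..)
end

section
variable {R : CType} {Γ G : List VType} {Δ Δ' : Option CType} {t u m : Tm} {A B : VType}
  {C D : CType}

theorem run_eq_ss (d : Deriv Γ Δ t (.comp C)) (σ : Sub (cpsCtx R Γ) G)
    (k : Q G Δ' (.comp (cpsC R C))) : run d σ k = Q.ss k (run d σ .svar) := by
  rw [ss_run, Q.ss_svar]

theorem run_cimage_ss (d : Deriv Γ Δ t (.comp C)) (σ : Sub (cpsCtx R Γ) G)
    (k : Q G Δ' (.comp .czero)) : run d σ (Q.cimage k) = Q.cimage k := by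
  rw [run_eq_ss, Q.ss_cimage_left]

theorem run_ccase_ss {X Y : CType} (d : Deriv Γ Δ t (.comp C)) (σ : Sub (cpsCtx R Γ) G)
    (k : Q G Δ' (.comp (.csum X Y))) (a : Q G (some X) (.comp (cpsC R C)))
    (b : Q G (some Y) (.comp (cpsC R C))) :
    run d σ (Q.ccase k a b) = Q.ccase k (run d σ a) (run d σ b) := by
  rw [run_eq_ss, Q.ss_ccase_left, ← run_eq_ss, ← run_eq_ss]

theorem run_copowlet_ss {X : CType} (d : Deriv Γ Δ t (.comp C)) (σ : Sub (cpsCtx R Γ) G)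
    (k : Q G Δ' (.comp (.copow A X))) (a : Q (A :: G) (some X) (.comp (cpsC R C))) :
    run d σ (Q.copowlet k a) = Q.copowlet k (run d (σ.comp .wk) a) := by
  rw [run_eq_ss, Q.ss_copowlet_left, Q.up, sub_run, run_eq_ss _ _ a]
  exact congrArg (fun x => Q.copowlet k (Q.ss a (run d (σ.comp .wk) x))) (Q.sub_svar _)

/-- Substitution into the stoup of `M` is translated to composition of continuations. -/
def SubOK (R : CType) {Δ₁ : Option CType} (M : Deriv Γ Δ₁ m A) : Prop :=
  match Δ₁, A, M with
  | some C, .comp B, M => ∀ (Δ : Option CType) (u : Tm) (U : Deriv Γ Δ u (.comp C)),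
      ∃ e : Deriv Γ Δ (Tm.ssubst u m) (.comp B),
        ∀ (G : List VType) (Δ' : Option CType) (σ : Sub (cpsCtx R Γ) G)
          (k : Q G Δ' (.comp (cpsC R B))), run e σ k = run (Δ := Δ) U σ (run M σ k)
  | _, _, _ => True

theorem Deriv.subOK (R : CType) {Δ₁ : Option CType} (M : Deriv Γ Δ₁ m A) : SubOK R M := by
  induction M with
  | var | unit | vpair | vfst | vsnd | vlam | vapp | top | bang | llam => trivial
  | svar => exact fun Δ u U => ⟨U, fun G Δ' σ k =>
      (congrArg (run U σ) (run_svar σ k)).symm⟩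
  | cunit Γ Δ₁ =>
    cases Δ₁ with
    | none => trivial
    | some C =>
      exact fun Δ u U => ⟨.cunit _ _, fun G Δ' σ k =>
        (run_cunit σ k).trans ((run_cimage_ss U σ k).symm.trans
          (congrArg (run U σ) (run_cunit σ k)).symm)⟩
  | cpair Γ Δ₁ _ _ _ _ d1 d2 h1 h2 =>
    cases Δ₁ with
    | none => trivial
    | some C =>
      intro Δ u U
      obtain ⟨e1, h1⟩ := h1 Δ u U
      obtain ⟨e2, h2⟩ := h2 Δ u U
      refine ⟨.cpair _ _ _ _ _ _ e1 e2, fun G Δ' σ k => ?_⟩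
      refine (run_cpair e1 e2 σ k).trans (Eq.trans ?_ (congrArg (run U σ) (run_cpair d1 d2 σ k).symm))
      rw [h1, h2]
      exact (run_ccase_ss ..).symm
  | clam Γ Δ₁ _ A _ d h =>
    cases Δ₁ with
    | none => trivial
    | some C =>
      intro Δ u U
      obtain ⟨U', hU⟩ := U.exists_shift_run R A
      obtain ⟨e, h⟩ := h Δ _ U'
      refine ⟨.clam _ _ _ _ _ e, fun G Δ' σ k => ?_⟩
      refine (run_clam e σ k).trans (Eq.trans ?_ (congrArg (run U σ) (run_clam d σ k).symm))
      refine (congrArg (Q.copowlet (A := cpsV R A) k) ((h _ _ (σ.lift (cpsV R A)) .svar).trans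
        ((hU _ _ (σ.lift (cpsV R A)) _).trans ?_))).trans (run_copowlet_ss ..).symm
      exact congrArg (run U · _) (Sub.wk_lift ..)
  | cfst Γ Δ₁ _ _ _ d h =>
    cases Δ₁ with
    | none => trivial
    | some C =>
      intro Δ u U
      obtain ⟨e, h⟩ := h Δ u U
      exact ⟨.cfst _ _ _ _ _ e, fun G Δ' σ k => (run_cfst e σ k).trans ((h ..).trans
        (congrArg (run U σ) (run_cfst d σ k).symm))⟩
  | csnd Γ Δ₁ _ _ _ d h =>
    cases Δ₁ with
    | none => trivial
    | some C =>
      intro Δ u U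
      obtain ⟨e, h⟩ := h Δ u U
      exact ⟨.csnd _ _ _ _ _ e, fun G Δ' σ k => (run_csnd e σ k).trans ((h ..).trans
        (congrArg (run U σ) (run_csnd d σ k).symm))⟩
  | cimage Γ Δ₁ _ _ d h =>
    cases Δ₁ with
    | none => trivial
    | some C =>
      intro Δ u U
      obtain ⟨e, h⟩ := h Δ u U
      exact ⟨.cimage _ _ _ _ e, fun G Δ' σ k => (run_cimage e σ k).trans ((h ..).trans
        (congrArg (run U σ) (run_cimage d σ k).symm))⟩
  | cinl Γ Δ₁ _ _ _ d h =>
    cases Δ₁ with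
    | none => trivial
    | some C =>
      intro Δ u U
      obtain ⟨e, h⟩ := h Δ u U
      exact ⟨.cinl _ _ _ _ _ e, fun G Δ' σ k => (run_cinl e σ k).trans ((h ..).trans
        (congrArg (run U σ) (run_cinl d σ k).symm))⟩
  | cinr Γ Δ₁ _ _ _ d h =>
    cases Δ₁ with
    | none => trivial
    | some C =>
      intro Δ u U
      obtain ⟨e, h⟩ := h Δ u U
      exact ⟨.cinr _ _ _ _ _ e, fun G Δ' σ k => (run_cinr e σ k).trans ((h ..).trans
        (congrArg (run U σ) (run_cinr d σ k).symm))⟩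
  | capp Γ Δ₁ _ _ _ _ d f h _ =>
    cases Δ₁ with
    | none => trivial
    | some C =>
      intro Δ u U
      obtain ⟨e, h⟩ := h Δ u U
      rw [Tm.ssubst, (f.noStoup rfl).ssubst]
      exact ⟨.capp _ _ _ _ _ _ e f, fun G Δ' σ k => (run_capp e f σ k).trans ((h ..).trans
        (congrArg (run U σ) (run_capp d f σ k).symm))⟩
  | ilet Γ Δ₁ _ _ _ d f h _ =>
    cases Δ₁ with
    | none => trivial
    | some C =>
      intro Δ u U
      obtain ⟨e, h⟩ := h Δ u U
      rw [Tm.ssubst, (f.noStoup rfl).ssubst]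
      exact ⟨.ilet _ _ _ _ _ e f, fun G Δ' σ k => (run_ilet e f σ k).trans ((h ..).trans
        (congrArg (run U σ) (run_ilet d f σ k).symm))⟩
  | banglet Γ Δ₁ _ _ _ _ d f h _ =>
    cases Δ₁ with
    | none => trivial
    | some C =>
      intro Δ u U
      obtain ⟨e, h⟩ := h Δ u U
      rw [Tm.ssubst, (f.noStoup rfl).ssubst]
      exact ⟨.banglet _ _ _ _ _ _ e f, fun G Δ' σ k => (run_banglet e f σ k).trans ((h ..).trans
        (congrArg (run U σ) (run_banglet d f σ k).symm))⟩
  | copow Γ Δ₁ _ _ _ _ f d _ h =>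
    cases Δ₁ with
    | none => trivial
    | some C =>
      intro Δ u U
      obtain ⟨e, h⟩ := h Δ u U
      rw [Tm.ssubst, (f.noStoup rfl).ssubst]
      exact ⟨.copow _ _ _ _ _ _ f e, fun G Δ' σ k => (run_copow f e σ k).trans ((h ..).trans
        (congrArg (run U σ) (run_copow f d σ k).symm))⟩
  | copowlet Γ Δ₁ _ _ _ _ _ d f h _ =>
    cases Δ₁ with
    | none => trivial
    | some C =>
      intro Δ u U
      obtain ⟨e, h⟩ := h Δ u U
      exact ⟨.copowlet _ _ _ _ _ _ _ e f, fun G Δ' σ k => (run_copowlet e f σ k).trans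
        ((h ..).trans (congrArg (run U σ) (run_copowlet d f σ k).symm))⟩
  | ccase Γ Δ₁ _ _ _ _ _ _ d f g h _ _ =>
    cases Δ₁ with
    | none => trivial
    | some C =>
      intro Δ u U
      obtain ⟨e, h⟩ := h Δ u U
      exact ⟨.ccase _ _ _ _ _ _ _ _ e f g, fun G Δ' σ k => (run_ccase e f g σ k).trans
        ((h ..).trans (congrArg (run U σ) (run_ccase d f g σ k).symm))⟩
  | lapp Γ Δ₁ _ _ _ _ f d _ h =>
    cases Δ₁ with
    | none => trivial
    | some C =>
      intro Δ u U
      obtain ⟨e, h⟩ := h Δ u U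
      rw [Tm.ssubst, (f.noStoup rfl).ssubst]
      exact ⟨.lapp _ _ _ _ _ _ f e, fun G Δ' σ k => (run_lapp f e σ k).trans ((h ..).trans
        (congrArg (run U σ) (run_lapp f d σ k).symm))⟩

theorem run_congr (d d' : Deriv Γ Δ t (.comp C)) (σ : Sub (cpsCtx R Γ) G)
    (k : Q G Δ' (.comp (cpsC R C))) : run d σ k = run d' σ k := by
  cases Δ with
  | none => exact congrArg (fun x => Q.lapp (D := R) (C := cpsC R C) (Q.sub σ x) k) (cpsQ_congr d d')
  | some D => exact congrArg (fun x => Q.ss k (Q.sub (A := .comp (cpsC R D)) σ x)) (cpsQ_congr d d')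

theorem val_congr (d d' : Deriv Γ none t A) (σ : Sub (cpsCtx R Γ) G) : val d σ = val d' σ :=
  congrArg (Q.sub (A := cpsV R A) σ) (cpsQ_congr d d')

/-- The translation of a substitution into the stoup. -/
theorem run_ssubst (M : Deriv Γ (some C) m (.comp D)) (U : Deriv Γ Δ u (.comp C))
    (e : Deriv Γ Δ (Tm.ssubst u m) (.comp D)) (σ : Sub (cpsCtx R Γ) G)
    (k : Q G Δ' (.comp (cpsC R D))) : run e σ k = run U σ (run M σ k) := by
  obtain ⟨e', h⟩ := M.subOK R Δ u U
  exact (run_congr e e' σ k).trans (h G Δ' σ k)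
end

section
variable {R : CType} {Γ G G' : List VType} {Δ Δ' : Option CType} {t s u : Tm} {A B : VType}
  {C D X : CType}

/-- A derivation of the translation of a derivable judgement. -/
noncomputable def dbl (R : CType) (d : Deriv Γ Δ t A) :
    Deriv (cpsCtx R Γ) (csrc R Δ A) (cps R d) (ctgt R Δ A) := Classical.choice (cps_ty R d)

/-- A derivation of the translation of a value. -/
noncomputable def dblVal (R : CType) (d : Deriv Γ none t A) :
    Deriv (cpsCtx R Γ) none (cps R d) (cpsV R A) := dbl R d
/-- A derivation of the translation of a computation with empty stoup. -/
noncomputable def dblComp (R : CType) (d : Deriv Γ none t (.comp C)) :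
    Deriv (cpsCtx R Γ) none (cps R d) (.lin (cpsC R C) R) := dbl R d
/-- A derivation of the translation of a value of linear function type. -/
noncomputable def dblFun (R : CType) (d : Deriv Γ none t (.lin C D)) :
    Deriv (cpsCtx R Γ) none (cps R d) (.lin (cpsC R D) (cpsC R C)) := dbl R d
/-- A derivation of the translation of a computation with a stoup. -/
noncomputable def dblLin (R : CType) (d : Deriv Γ (some D) t (.comp C)) :
    Deriv (cpsCtx R Γ) (some (cpsC R C)) (cps R d) (.comp (cpsC R D)) := dbl R d

/-- The double translation of a value in an environment. -/
noncomputable def dval (d : Deriv Γ none t A) (τ : Sub (cpsCtx R (cpsCtx R Γ)) G) :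
    Q G none (cpsV R (cpsV R A)) := val (dblVal R d) τ

/-- The double translation of a computation in an environment. -/
noncomputable def dcomp : {Δ : Option CType} → (d : Deriv Γ Δ t (.comp C)) →
    Sub (cpsCtx R (cpsCtx R Γ)) G → Q G Δ' (.comp (cpsC R (ans R Δ))) →
    Q G Δ' (.comp (cpsC R (cpsC R C)))
  | none, d, τ, x => Q.lapp (C := cpsC R R) (D := cpsC R (cpsC R C)) (dval d τ) x
  | some _, d, τ, x => run (dblLin R d) τ x

theorem sub_dcomp (d : Deriv Γ Δ t (.comp C)) (τ : Sub (cpsCtx R (cpsCtx R Γ)) G)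
    (x : Q G Δ' (.comp (cpsC R (ans R Δ)))) (ρ : Sub G G') :
    Q.sub ρ (dcomp d τ x) = dcomp d (τ.comp ρ) (Q.sub ρ x) := by
  cases Δ with
  | none => exact (Q.sub_lapp ..).trans (congrArg (Q.lapp (D := cpsC R (cpsC R C)) · _) (sub_val ..))
  | some => exact sub_run (dblLin R d) τ x ρ

theorem sub_dval (d : Deriv Γ none t A) (τ : Sub (cpsCtx R (cpsCtx R Γ)) G) (ρ : Sub G G') :
    Q.sub ρ (dval d τ) = dval d (τ.comp ρ) := sub_val ..

theorem ss_dcomp (d : Deriv Γ Δ t (.comp C)) (τ : Sub (cpsCtx R (cpsCtx R Γ)) G)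
    (x : Q G (some X) (.comp (cpsC R (ans R Δ)))) (r : Q G Δ' (.comp X)) :
    Q.ss r (dcomp d τ x) = dcomp d τ (Q.ss r x) := by
  cases Δ with
  | none => exact Q.ss_lapp ..
  | some => exact ss_run (dblLin R d) τ x r

theorem dcomp_of_llam {b : Tm} (d : Deriv Γ none t (.comp C))
    (e : Deriv (cpsCtx R Γ) (some (cpsC R C)) b (.comp R)) (h : cps R d = .llam (cpsC R C) b)
    (τ : Sub (cpsCtx R (cpsCtx R Γ)) G) (x : Q G Δ' (.comp (cpsC R R))) :
    dcomp d τ x = run e τ x := by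
  have key : ∀ {a : Tm} (da : Deriv (cpsCtx R Γ) none a (.lin (cpsC R C) R)),
      a = .llam (cpsC R C) b → val da τ = Q.llam (C := cpsC R R) (run e τ .svar) := by
    rintro a da rfl
    exact (val_congr da (.llam _ _ _ _ e) τ).trans (val_llam e τ)
  refine (congrArg (Q.lapp (C := cpsC R R) (D := cpsC R (cpsC R C)) · x) (key (dblComp R d) h)).trans ?_
  exact (Q.lapp_llam (C := cpsC R R) (D := cpsC R (cpsC R C)) _ x).trans (run_eq_ss e τ x).symm

theorem dcomp_of_eq {b : Tm} (d : Deriv Γ (some D) t (.comp C))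
    (e : Deriv (cpsCtx R Γ) (some (cpsC R C)) b (.comp (cpsC R D))) (h : cps R d = b)
    (τ : Sub (cpsCtx R (cpsCtx R Γ)) G) (x : Q G Δ' (.comp (cpsC R (cpsC R D)))) :
    dcomp d τ x = run e τ x := by
  subst h; exact run_congr (dblLin R d) e τ x

theorem dval_of_eq {b : Tm} (d : Deriv Γ none t A) (e : Deriv (cpsCtx R Γ) none b (cpsV R A))
    (h : cps R d = b) (τ : Sub (cpsCtx R (cpsCtx R Γ)) G) : dval d τ = val e τ := by
  subst h; exact val_congr ..

/-- The double translation of a computation whose translation precomposes that of `d` with `m`. -/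
theorem dcomp_of_pre {b : Tm} (d : Deriv Γ Δ t (.comp C)) (d' : Deriv Γ Δ s (.comp D))
    (m : Deriv (cpsCtx R Γ) (some (cpsC R D)) b (.comp (cpsC R C)))
    (h : cps R d' = match Δ with
      | none => .llam (cpsC R D) (.lapp (cps R d) b)
      | some _ => Tm.ssubst b (cps R d))
    (τ : Sub (cpsCtx R (cpsCtx R Γ)) G) (x : Q G Δ' (.comp (cpsC R (ans R Δ)))) :
    dcomp d' τ x = run m τ (dcomp d τ x) := by
  cases Δ with
  | none =>
    exact (dcomp_of_llam d' (.lapp _ _ _ _ _ _ (dblComp R d) m) h τ x).trans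
      (run_lapp (dblComp R d) m τ x)
  | some X =>
    let e : HasTy (cpsCtx R Γ) (some (cpsC R D)) (Tm.ssubst b (cps R d)) (.comp (cpsC R X)) :=
      HasTy.ssubst ⟨dblLin R d⟩ ⟨m⟩
    exact (dcomp_of_eq d' e.some h τ x).trans (run_ssubst (dblLin R d) m e.some τ x)

theorem dcomp_svar (τ : Sub (cpsCtx R (cpsCtx R Γ)) G) (x : Q G Δ' (.comp (cpsC R (cpsC R C)))) :
    dcomp (.svar Γ C) τ x = x :=
  (dcomp_of_eq (.svar Γ C) (.svar _ _) rfl τ x).trans (run_svar ..)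

theorem dcomp_top (τ : Sub (cpsCtx R (cpsCtx R Γ)) G) (x : Q G Δ' (.comp (cpsC R R))) :
    dcomp (.top Γ) τ x = x :=
  (dcomp_of_llam (.top Γ) (.svar _ R) rfl τ x).trans (run_svar ..)

theorem dcomp_cpair (d : Deriv Γ Δ t (.comp C)) (e : Deriv Γ Δ u (.comp D))
    (τ : Sub (cpsCtx R (cpsCtx R Γ)) G) (x : Q G Δ' (.comp (cpsC R (ans R Δ)))) :
    dcomp (.cpair _ _ _ _ _ _ d e) τ x = Q.cpair (dcomp d τ x) (dcomp e τ x) := by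
  cases Δ with
  | none =>
    refine (dcomp_of_llam (.cpair _ _ _ _ _ _ d e) (.ccase _ _ _ _ _ _ _ _ (.svar _ _)
      (.lapp _ _ _ _ _ _ (dblComp R d) (.svar _ _)) (.lapp _ _ _ _ _ _ (dblComp R e) (.svar _ _)))
      rfl τ x).trans ((run_ccase ..).trans ((run_svar ..).trans ?_))
    refine congrArg₂ Q.cpair ?_ ?_ <;> exact (run_lapp ..).trans (run_svar ..)
  | some X =>
    exact (dcomp_of_eq (.cpair _ _ _ _ _ _ d e) (.ccase _ _ _ _ _ _ _ _ (.svar _ _)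
      (dblLin R d) (dblLin R e)) rfl τ x).trans ((run_ccase ..).trans (run_svar ..))

theorem dcomp_clam (d : Deriv (A :: Γ) Δ t (.comp C))
    (τ : Sub (cpsCtx R (cpsCtx R Γ)) G) (x : Q G Δ' (.comp (cpsC R (ans R Δ)))) :
    dcomp (.clam _ _ _ _ _ d) τ x =
      Q.clam (A := cpsV R (cpsV R A)) (dcomp d (τ.lift (cpsV R (cpsV R A))) (Q.up _ x)) := by
  cases Δ with
  | none =>
    refine (dcomp_of_llam (.clam _ _ _ _ _ d) (.copowlet _ _ _ _ _ _ _ (.svar _ _)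
      (.lapp _ _ _ _ _ _ (dblComp R d) (.svar _ _)))
      rfl τ x).trans ((run_copowlet ..).trans ((run_svar ..).trans ?_))
    exact congrArg _ ((run_lapp ..).trans (run_svar ..))
  | some X =>
    exact (dcomp_of_eq (.clam _ _ _ _ _ d) (.copowlet _ _ _ _ _ _ _ (.svar _ _)
      (dblLin R d)) rfl τ x).trans ((run_copowlet ..).trans (run_svar ..))

theorem dcomp_bang (d : Deriv Γ none t A)
    (τ : Sub (cpsCtx R (cpsCtx R Γ)) G) (x : Q G Δ' (.comp (cpsC R R))) :
    dcomp (.bang _ _ _ d) τ x = Q.copow (dval d τ) x :=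
  (dcomp_of_llam (.bang _ _ _ d) (.capp _ _ _ _ _ _ (.svar _ _) (dblVal R d)) rfl τ x).trans
    ((run_capp ..).trans (run_svar ..))

theorem dcomp_cfst (d : Deriv Γ Δ t (.comp (.cand C D)))
    (τ : Sub (cpsCtx R (cpsCtx R Γ)) G) (x : Q G Δ' (.comp (cpsC R (ans R Δ)))) :
    dcomp (.cfst _ _ _ _ _ d) τ x =
      Q.cfst (C := cpsC R (cpsC R C)) (D := cpsC R (cpsC R D)) (dcomp d τ x) :=
  (dcomp_of_pre d (.cfst _ _ _ _ _ d) (.cinl _ _ _ _ _ (.svar _ _)) (by cases Δ <;> rfl) τ x).trans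
    ((run_cinl ..).trans (run_svar ..))

theorem dcomp_csnd (d : Deriv Γ Δ t (.comp (.cand C D)))
    (τ : Sub (cpsCtx R (cpsCtx R Γ)) G) (x : Q G Δ' (.comp (cpsC R (ans R Δ)))) :
    dcomp (.csnd _ _ _ _ _ d) τ x =
      Q.csnd (C := cpsC R (cpsC R C)) (D := cpsC R (cpsC R D)) (dcomp d τ x) :=
  (dcomp_of_pre d (.csnd _ _ _ _ _ d) (.cinr _ _ _ _ _ (.svar _ _)) (by cases Δ <;> rfl) τ x).trans
    ((run_cinr ..).trans (run_svar ..))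

theorem dcomp_capp (d : Deriv Γ Δ t (.comp (.carr A C))) (e : Deriv Γ none u A)
    (τ : Sub (cpsCtx R (cpsCtx R Γ)) G) (x : Q G Δ' (.comp (cpsC R (ans R Δ)))) :
    dcomp (.capp _ _ _ _ _ _ d e) τ x =
      Q.capp (A := cpsV R (cpsV R A)) (C := cpsC R (cpsC R C)) (dcomp d τ x) (dval e τ) :=
  (dcomp_of_pre d (.capp _ _ _ _ _ _ d e) (.copow _ _ _ _ _ _ (dblVal R e) (.svar _ _))
    (by cases Δ <;> rfl) τ x).trans ((run_copow ..).trans (run_svar ..))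

theorem dcomp_ilet (d : Deriv Γ Δ t (.comp .iunit)) (e : Deriv Γ none u (.comp C))
    (τ : Sub (cpsCtx R (cpsCtx R Γ)) G) (x : Q G Δ' (.comp (cpsC R (ans R Δ)))) :
    dcomp (.ilet _ _ _ _ _ d e) τ x = dcomp (Δ := none) e τ (dcomp d τ x) :=
  (dcomp_of_pre d (.ilet _ _ _ _ _ d e) (.lapp _ _ _ _ _ R (dblComp R e) (.svar _ _))
    (by cases Δ <;> rfl) τ x).trans ((run_lapp ..).trans (run_svar ..))

theorem dcomp_banglet (d : Deriv Γ Δ t (.comp (.bang A))) (e : Deriv (A :: Γ) none u (.comp C))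
    (τ : Sub (cpsCtx R (cpsCtx R Γ)) G) (x : Q G Δ' (.comp (cpsC R (ans R Δ)))) :
    dcomp (.banglet _ _ _ _ _ _ d e) τ x =
      Q.copowlet (A := cpsV R (cpsV R A)) (C := cpsC R R) (dcomp d τ x)
        (dcomp (Δ := none) e (τ.lift (cpsV R (cpsV R A))) .svar) :=
  (dcomp_of_pre d (.banglet _ _ _ _ _ _ d e) (.clam _ _ _ _ R
      (.lapp _ _ _ _ _ R (dblComp R e) (.svar _ _)))
    (by cases Δ <;> rfl) τ x).trans ((run_clam ..).trans
      (congrArg (Q.copowlet (A := cpsV R (cpsV R A)) (C := cpsC R R) _)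
        ((run_lapp ..).trans (run_svar ..))))

theorem dcomp_copow (e : Deriv Γ none u A) (d : Deriv Γ Δ t (.comp C))
    (τ : Sub (cpsCtx R (cpsCtx R Γ)) G) (x : Q G Δ' (.comp (cpsC R (ans R Δ)))) :
    dcomp (.copow _ _ _ _ _ _ e d) τ x = Q.copow (dval e τ) (dcomp d τ x) :=
  (dcomp_of_pre d (.copow _ _ _ _ _ _ e d) (.capp _ _ _ _ _ _ (.svar _ _) (dblVal R e))
    (by cases Δ <;> rfl) τ x).trans ((run_capp ..).trans (run_svar ..))

theorem dcomp_copowlet (d : Deriv Γ Δ t (.comp (.copow A D)))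
    (e : Deriv (A :: Γ) (some D) u (.comp C))
    (τ : Sub (cpsCtx R (cpsCtx R Γ)) G) (x : Q G Δ' (.comp (cpsC R (ans R Δ)))) :
    dcomp (.copowlet _ _ _ _ _ _ _ d e) τ x =
      Q.copowlet (A := cpsV R (cpsV R A)) (C := cpsC R (cpsC R D)) (dcomp d τ x)
        (dcomp (Δ := some D) e (τ.lift (cpsV R (cpsV R A))) .svar) :=
  (dcomp_of_pre d (.copowlet _ _ _ _ _ _ _ d e) (.clam _ _ _ _ _ (dblLin R e))
    (by cases Δ <;> rfl) τ x).trans (run_clam ..)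

theorem dcomp_cimage (d : Deriv Γ Δ t (.comp .czero))
    (τ : Sub (cpsCtx R (cpsCtx R Γ)) G) (x : Q G Δ' (.comp (cpsC R (ans R Δ)))) :
    dcomp (.cimage _ _ _ C d) τ x = Q.cimage (dcomp d τ x) :=
  (dcomp_of_pre d (.cimage _ _ _ C d) (.cunit _ _) (by cases Δ <;> rfl) τ x).trans (run_cunit ..)

theorem dcomp_cinl (d : Deriv Γ Δ t (.comp C))
    (τ : Sub (cpsCtx R (cpsCtx R Γ)) G) (x : Q G Δ' (.comp (cpsC R (ans R Δ)))) :
    dcomp (.cinl _ _ _ C D d) τ x = Q.cinl (D := cpsC R (cpsC R D)) (dcomp d τ x) :=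
  (dcomp_of_pre d (.cinl _ _ _ C D d) (.cfst _ _ _ _ _ (.svar _ _)) (by cases Δ <;> rfl) τ x).trans
    ((run_cfst ..).trans (run_svar ..))

theorem dcomp_cinr (d : Deriv Γ Δ t (.comp D))
    (τ : Sub (cpsCtx R (cpsCtx R Γ)) G) (x : Q G Δ' (.comp (cpsC R (ans R Δ)))) :
    dcomp (.cinr _ _ _ C D d) τ x = Q.cinr (C := cpsC R (cpsC R C)) (dcomp d τ x) :=
  (dcomp_of_pre d (.cinr _ _ _ C D d) (.csnd _ _ _ _ _ (.svar _ _)) (by cases Δ <;> rfl) τ x).trans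
    ((run_csnd ..).trans (run_svar ..))

theorem dcomp_ccase (d : Deriv Γ Δ t (.comp (.csum C D))) (e : Deriv Γ (some C) s (.comp X))
    (f : Deriv Γ (some D) u (.comp X))
    (τ : Sub (cpsCtx R (cpsCtx R Γ)) G) (x : Q G Δ' (.comp (cpsC R (ans R Δ)))) :
    dcomp (.ccase _ _ _ _ _ _ _ _ d e f) τ x =
      Q.ccase (C := cpsC R (cpsC R C)) (D := cpsC R (cpsC R D)) (dcomp d τ x)
        (dcomp (Δ := some C) e τ .svar) (dcomp (Δ := some D) f τ .svar) :=
  (dcomp_of_pre d (.ccase _ _ _ _ _ _ _ _ d e f) (.cpair _ _ _ _ _ _ (dblLin R e) (dblLin R f))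
    (by cases Δ <;> rfl) τ x).trans (run_cpair ..)

theorem dcomp_lapp (e : Deriv Γ none s (.lin C D)) (d : Deriv Γ Δ t (.comp C))
    (τ : Sub (cpsCtx R (cpsCtx R Γ)) G) (x : Q G Δ' (.comp (cpsC R (ans R Δ)))) :
    dcomp (.lapp _ _ _ _ _ _ e d) τ x =
      Q.lapp (C := cpsC R (cpsC R C)) (D := cpsC R (cpsC R D)) (dval e τ) (dcomp d τ x) :=
  (dcomp_of_pre d (.lapp _ _ _ _ _ _ e d) (.lapp _ _ _ _ _ _ (dblFun R e) (.svar _ _))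
    (by cases Δ <;> rfl) τ x).trans ((run_lapp ..).trans (run_svar ..))

theorem dval_var (n : ℕ) (h : Γ[n]? = some A) (τ : Sub (cpsCtx R (cpsCtx R Γ)) G) :
    dval (.var _ _ _ h) τ =
      τ n (cpsV R (cpsV R A)) (cpsCtx_getElem? R (cpsCtx_getElem? R h)) :=
  (dval_of_eq (.var _ _ _ h) (.var _ _ _ (cpsCtx_getElem? R h)) rfl τ).trans (val_var ..)

theorem dval_vpair (d : Deriv Γ none t A) (e : Deriv Γ none u B)
    (τ : Sub (cpsCtx R (cpsCtx R Γ)) G) :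
    dval (.vpair _ _ _ _ _ d e) τ = Q.vpair (dval d τ) (dval e τ) :=
  (dval_of_eq (.vpair _ _ _ _ _ d e) (.vpair _ _ _ _ _ (dblVal R d) (dblVal R e)) rfl τ).trans
    (val_vpair ..)

theorem dval_vfst (d : Deriv Γ none t (.prod A B)) (τ : Sub (cpsCtx R (cpsCtx R Γ)) G) :
    dval (.vfst _ _ _ _ d) τ =
      Q.vfst (A := cpsV R (cpsV R A)) (B := cpsV R (cpsV R B)) (dval d τ) :=
  (dval_of_eq (.vfst _ _ _ _ d) (.vfst _ _ (cpsV R A) (cpsV R B) (dblVal R d)) rfl τ).trans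
    (val_vfst ..)

theorem dval_vsnd (d : Deriv Γ none t (.prod A B)) (τ : Sub (cpsCtx R (cpsCtx R Γ)) G) :
    dval (.vsnd _ _ _ _ d) τ =
      Q.vsnd (A := cpsV R (cpsV R A)) (B := cpsV R (cpsV R B)) (dval d τ) :=
  (dval_of_eq (.vsnd _ _ _ _ d) (.vsnd _ _ (cpsV R A) (cpsV R B) (dblVal R d)) rfl τ).trans
    (val_vsnd ..)

theorem dval_vlam (d : Deriv (A :: Γ) none t B) (τ : Sub (cpsCtx R (cpsCtx R Γ)) G) :
    dval (.vlam _ _ _ _ d) τ = Q.vlam (dval d (τ.lift (cpsV R (cpsV R A)))) :=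
  (dval_of_eq (.vlam _ _ _ _ d) (.vlam _ _ _ _ (dblVal R d)) rfl τ).trans (val_vlam ..)

theorem dval_vapp (d : Deriv Γ none t (.arr A B)) (e : Deriv Γ none u A)
    (τ : Sub (cpsCtx R (cpsCtx R Γ)) G) :
    dval (.vapp _ _ _ _ _ d e) τ =
      Q.vapp (A := cpsV R (cpsV R A)) (B := cpsV R (cpsV R B)) (dval d τ) (dval e τ) :=
  (dval_of_eq (.vapp _ _ _ _ _ d e)
    (.vapp _ _ _ (cpsV R A) (cpsV R B) (dblVal R d) (dblVal R e)) rfl τ).trans (val_vapp ..)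

theorem dval_llam (d : Deriv Γ (some C) t (.comp D)) (τ : Sub (cpsCtx R (cpsCtx R Γ)) G) :
    dval (.llam _ _ _ _ d) τ =
      Q.llam (C := cpsC R (cpsC R C)) (dcomp (Δ := some C) d τ .svar) :=
  (dval_of_eq (.llam _ _ _ _ d) (.llam _ _ _ _ (dblLin R d)) rfl τ).trans (val_llam ..)

end

section
variable {R : CType} [ResultType R] {Γ G G' : List VType} {Δ Δ' : Option CType} {t s u : Tm}
  {A B : VType} {C D X : CType}

/-- Reindexing along `ι_A` of the last variable. -/
def iSub (R : CType) [ResultType R] (Γ : List VType) (A : VType) :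
    Sub (A :: Γ) (cpsV R (cpsV R A) :: Γ) := .cons (iV A .v0) .wk
/-- Reindexing along the inverse of `ι_A` of the last variable. -/
def jSub (R : CType) [ResultType R] (Γ : List VType) (A : VType) :
    Sub (cpsV R (cpsV R A) :: Γ) (A :: Γ) := .cons (jV A .v0) .wk

theorem iSub_comp_jSub : (iSub R Γ A).comp (jSub R Γ A) = .id := by
  rw [iSub, Sub.cons_comp]; simp [jSub, iV_jV, Sub.cons_v0_wk]

theorem jV_vpair (v : Q Γ none A) (w : Q Γ none B) :
    jV (R := R) (.prod A B) (.vpair v w) = Q.vpair (jV (R := R) A v) (jV (R := R) B w) :=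
  (jV_prod _).trans (by simp [Q.vfst_vpair, Q.vsnd_vpair]; rfl)
theorem jV_vfst (v : Q Γ none (.prod A B)) :
    jV (R := R) A (.vfst v) =
      Q.vfst (A := cpsV R (cpsV R A)) (B := cpsV R (cpsV R B)) (jV (.prod A B) v) :=
  ((congrArg Q.vfst (jV_prod v)).trans (Q.vfst_vpair ..)).symm
theorem jV_vsnd (v : Q Γ none (.prod A B)) :
    jV (R := R) B (.vsnd v) =
      Q.vsnd (A := cpsV R (cpsV R A)) (B := cpsV R (cpsV R B)) (jV (.prod A B) v) :=
  ((congrArg Q.vsnd (jV_prod v)).trans (Q.vsnd_vpair ..)).symm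
theorem jV_vlam (b : Q (A :: Γ) none B) :
    jV (R := R) (.arr A B) (.vlam b) = Q.vlam (Q.sub (iSub R Γ A) (jV (R := R) B b)) := by
  refine (jV_arr _).trans ?_
  simp [Q.up, Q.vapp_vlam, iSub, Sub.inst, Sub.lift_cons]
  rfl
theorem jV_vapp (v : Q Γ none (.arr A B)) (w : Q Γ none A) :
    jV (R := R) B (.vapp v w) =
      Q.vapp (A := cpsV R (cpsV R A)) (B := cpsV R (cpsV R B)) (jV (.arr A B) v) (jV A w) := by
  refine ((congrArg (Q.vapp · _) (jV_arr v)).trans ((Q.vapp_vlam ..).trans ?_)).symm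
  simp [Q.up, iV_jV]
theorem jV_llam (q : Q Γ (some C) (.comp D)) :
    jV (R := R) (.lin C D) (.llam q) =
      Q.llam (jC (R := R) D (.ss (iC (R := R) C .svar) q)) :=
  (jV_lin _).trans (by rw [Q.lapp_llam])

theorem jC_cpair (a : Q Γ Δ (.comp C)) (b : Q Γ Δ (.comp D)) :
    jC (R := R) (.cand C D) (.cpair a b) = Q.cpair (jC (R := R) C a) (jC (R := R) D b) :=
  (jC_cand _).trans (by simp [Q.cfst_cpair, Q.csnd_cpair]; rfl)
theorem jC_cfst (q : Q Γ Δ (.comp (.cand C D))) :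
    jC (R := R) C (.cfst q) =
      Q.cfst (C := cpsC R (cpsC R C)) (D := cpsC R (cpsC R D)) (jC (.cand C D) q) :=
  ((congrArg Q.cfst (jC_cand q)).trans (Q.cfst_cpair ..)).symm
theorem jC_csnd (q : Q Γ Δ (.comp (.cand C D))) :
    jC (R := R) D (.csnd q) =
      Q.csnd (C := cpsC R (cpsC R C)) (D := cpsC R (cpsC R D)) (jC (.cand C D) q) :=
  ((congrArg Q.csnd (jC_cand q)).trans (Q.csnd_cpair ..)).symm
theorem jC_clam (b : Q (A :: Γ) Δ (.comp C)) :
    jC (R := R) (.carr A C) (.clam b) = Q.clam (Q.sub (iSub R Γ A) (jC (R := R) C b)) := by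
  refine (jC_carr _).trans ?_
  simp [Q.up, Q.capp_clam, iSub, Sub.inst, Sub.lift_cons]
  rfl
theorem jC_capp (q : Q Γ Δ (.comp (.carr A C))) (v : Q Γ none A) :
    jC (R := R) C (.capp q v) =
      Q.capp (A := cpsV R (cpsV R A)) (C := cpsC R (cpsC R C)) (jC (.carr A C) q) (jV A v) := by
  refine ((congrArg (Q.capp · _) (jC_carr q)).trans ((Q.capp_clam ..).trans ?_)).symm
  simp [Q.up, iV_jV]
theorem jC_top : jC (R := R) .iunit (Q.top : Q Γ _ _) = topc := jC_iunit _
theorem jC_ilet (a : Q Γ Δ (.comp .iunit)) (b : Q Γ none (.comp C)) :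
    jC (R := R) C (.ilet a b) = .ilet a (jC C b) := by
  rw [jC_eq_ss, Q.ss_ilet_left, ← jC_eq_ss]
theorem jC_banglet (a : Q Γ Δ (.comp (.bang A))) (b : Q (A :: Γ) none (.comp C)) :
    jC (R := R) C (.banglet a b) = .banglet a (jC C b) := by
  rw [jC_eq_ss, Q.ss_banglet_left, Q.up, sub_jC, Q.sub_svar, ← jC_eq_ss]
theorem jC_copowlet (a : Q Γ Δ (.comp (.copow A D))) (b : Q (A :: Γ) (some D) (.comp C)) :
    jC (R := R) C (.copowlet a b) = .copowlet a (jC C b) := by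
  rw [jC_eq_ss, Q.ss_copowlet_left, Q.up, sub_jC, Q.sub_svar, ← jC_eq_ss]
theorem jC_ccase (a : Q Γ Δ (.comp (.csum C D))) (b : Q Γ (some C) (.comp X))
    (c : Q Γ (some D) (.comp X)) :
    jC (R := R) X (.ccase a b c) = .ccase a (jC X b) (jC X c) := by
  rw [jC_eq_ss, Q.ss_ccase_left, ← jC_eq_ss, ← jC_eq_ss]
theorem jC_cimage (a : Q Γ Δ (.comp .czero)) :
    jC (R := R) C (.cimage a) = .cimage a := by
  rw [jC_eq_ss, Q.ss_cimage_left]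
theorem jC_bang' (v : Q Γ none A) :
    jC (R := R) (.bang A) (.bang v) = Q.copow (jV (R := R) A v) (topc (R := R)) :=
  (jC_bang _).trans (by simp [Q.banglet_bang]; rfl)
theorem jC_copow' (v : Q Γ none A) (q : Q Γ Δ (.comp C)) :
    jC (R := R) (.copow A C) (.copow v q) = Q.copow (jV (R := R) A v) (jC (R := R) C q) :=
  (jC_copow _).trans (by simp [Q.copowlet_copow]; rfl)
theorem jC_cinl (q : Q Γ Δ (.comp C)) :
    jC (R := R) (.csum C D) (.cinl q) = Q.cinl (D := cpsC R (cpsC R D)) (jC (R := R) C q) :=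
  (jC_csum _).trans (by simp [Q.ccase_cinl]; rfl)
theorem jC_cinr (q : Q Γ Δ (.comp D)) :
    jC (R := R) (.csum C D) (.cinr q) = Q.cinr (C := cpsC R (cpsC R C)) (jC (R := R) D q) :=
  (jC_csum _).trans (by simp [Q.ccase_cinr]; rfl)
theorem jC_lapp (v : Q Γ none (.lin C D)) (q : Q Γ Δ (.comp C)) :
    jC (R := R) D (.lapp v q) =
      Q.lapp (C := cpsC R (cpsC R C)) (D := cpsC R (cpsC R D)) (jV (.lin C D) v) (jC C q) := by
  refine ((congrArg (Q.lapp · _) (jV_lin v)).trans ((Q.lapp_llam ..).trans ?_)).symm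
  simp [iC_jC]

theorem ss_ss_iunit {Y : CType} (q : Q Γ Δ (.comp .iunit)) (g : Q Γ (some .iunit) (.comp Y))
    (f : Q Γ (some Y) (.comp X)) :
    Q.ss (.ss q g) f = .ilet q (.ss (.ss .top g) f) := by
  have := Q.ilet_eta q (Q.ss g f)
  rwa [Q.ss_ss, Q.ss_ss, eq_comm] at this
theorem ss_jC_iunit (q : Q Γ Δ (.comp .iunit)) (f : Q Γ (some (cpsC R R)) (.comp X)) :
    Q.ss (C := cpsC R R) (jC (R := R) .iunit q) f = .ilet q (.ss topc f) := by
  have := ss_ss_iunit (Y := cpsC R R) q (jC (R := R) .iunit .svar) f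
  refine Eq.trans ?_ (this.trans ?_)
  · exact congrArg (Q.ss (C := cpsC R R) · f) (jC_eq_ss q)
  · refine congrArg (fun x => Q.ilet q (Q.ss (C := cpsC R R) x f)) ?_
    exact (jC_eq_ss _).symm.trans jC_top
theorem copowlet_jC_bang (q : Q Γ Δ (.comp (.bang A)))
    (f : Q (cpsV R (cpsV R A) :: Γ) (some (cpsC R R)) (.comp X)) :
    Q.copowlet (A := cpsV R (cpsV R A)) (C := cpsC R R) (jC (.bang A) q) f =
      .banglet q (.sub (jSub R Γ A) (.ss topc f)) := by
  have key (a : Q Γ Δ (.comp (.copow (cpsV R (cpsV R A)) (cpsC R R)))) :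
    Q.copowlet a f = .ss a (.copowlet .svar f) := by simp
  refine (congrArg (Q.copowlet · f) (jC_bang q)).trans ?_
  rw [key, Q.ss_banglet_left]
  simp [Q.up, Q.copowlet_copow, jSub, Sub.inst, Sub.lift_cons]
theorem copowlet_jC_copow (q : Q Γ Δ (.comp (.copow A C)))
    (f : Q (cpsV R (cpsV R A) :: Γ) (some (cpsC R (cpsC R C))) (.comp X)) :
    Q.copowlet (A := cpsV R (cpsV R A)) (C := cpsC R (cpsC R C)) (jC (.copow A C) q) f =
      .copowlet q (.sub (jSub R Γ A) (.ss (jC C .svar) f)) := by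
  have key (a : Q Γ Δ (.comp (.copow (cpsV R (cpsV R A)) (cpsC R (cpsC R C))))) :
    Q.copowlet a f = .ss a (.copowlet .svar f) := by simp
  refine (congrArg (Q.copowlet · f) (jC_copow q)).trans ?_
  rw [key, Q.ss_copowlet_left]
  simp [Q.up, Q.copowlet_copow, jSub, Sub.inst, Sub.lift_cons]
theorem ccase_jC_csum (q : Q Γ Δ (.comp (.csum C D)))
    (f : Q Γ (some (cpsC R (cpsC R C))) (.comp X)) (g : Q Γ (some (cpsC R (cpsC R D))) (.comp X)) :
    Q.ccase (C := cpsC R (cpsC R C)) (D := cpsC R (cpsC R D)) (jC (.csum C D) q) f g =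
      .ccase q (.ss (jC C .svar) f) (.ss (jC D .svar) g) := by
  have key (a : Q Γ Δ (.comp (.csum (cpsC R (cpsC R C)) (cpsC R (cpsC R D))))) :
    Q.ccase a f g = .ss a (.ccase .svar f g) := by simp
  refine (congrArg (Q.ccase · f g) (jC_csum q)).trans ?_
  rw [key, Q.ss_ccase_left]
  simp [Q.ccase_cinl, Q.ccase_cinr]
end

section
variable {R : CType} [ResultType R] {Γ G G' : List VType} {Δ Δ' : Option CType} {t s u : Tm}
  {A B : VType} {C D X : CType}

/-- The environment interpreting the doubly translated context by the inverses of `ι`. -/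
noncomputable def jS (R : CType) [ResultType R] : (Γ : List VType) →
    Sub (cpsCtx R (cpsCtx R Γ)) Γ
  | [] => fun n A h => absurd (show ([] : List VType)[n]? = some A from h) (by simp)
  | A :: Γ => .cons (jV A .v0) ((jS R Γ).comp .wk)

theorem jS_var : (Γ : List VType) → (n : ℕ) → (A : VType) → (h : Γ[n]? = some A) →
    jS R Γ n (cpsV R (cpsV R A)) (cpsCtx_getElem? R (cpsCtx_getElem? R h)) = jV A (Q.var n A h)
  | [], n, A, h => absurd h (by simp)
  | B :: Γ, 0, A, h => by
    obtain rfl : B = A := by simpa using h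
    rfl
  | B :: Γ, n + 1, A, h => by
    have h' : Γ[n]? = some A := h
    refine (congrArg (Q.sub Sub.wk) (jS_var Γ n A h')).trans ?_
    rw [sub_jV, Q.sub_var]
    rfl

theorem jS_comp_iSub : (jS R (A :: Γ)).comp (iSub R Γ A) =
    (jS R Γ).lift (cpsV R (cpsV R A)) := by
  have key (σ : Sub (cpsCtx R (cpsCtx R Γ)) (A :: Γ)) :
      (Sub.cons (jV (R := R) A .v0) σ).comp (iSub R Γ A) =
        .cons (.sub (iSub R Γ A) (jV (R := R) A .v0)) (σ.comp (iSub R Γ A)) := Sub.cons_comp ..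
  refine (key _).trans ?_
  rw [Sub.lift, sub_jV, Sub.comp_comp]
  simp [iSub, jV_iV, Sub.wk_cons]

/-- The canonical argument of a doubly translated computation. -/
def jInp (R : CType) [ResultType R] {Γ : List VType} :
    (Δ : Option CType) → Q Γ Δ (.comp (cpsC R (ans R Δ)))
  | none => topc
  | some D => jC D .svar

theorem sub_jInp (σ : Sub Γ G) (Δ : Option CType) : Q.sub σ (jInp R Δ) = jInp R Δ := by
  cases Δ with
  | none => exact sub_topc σ
  | some D => exact (sub_jC ..).trans (congrArg _ (Q.sub_svar ..))

theorem lapp_jV_comp (q : Q Γ none (.comp C)) :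
    Q.lapp (C := cpsC R R) (D := cpsC R (cpsC R C)) (jV (R := R) (.comp C) q) topc = jC C q := by
  refine (congrArg (Q.lapp · topc) (jV_comp q)).trans ((Q.lapp_llam ..).trans ?_)
  simp [Q.ilet_top]

theorem jV_comp_of_lapp (q : Q Γ none (.comp C))
    (v : Q Γ none (.lin (cpsC R R) (cpsC R (cpsC R C))))
    (h : Q.lapp v topc = jC C q) : v = jV (R := R) (.comp C) q := by
  rw [← jV_iV (.comp C) v]
  refine congrArg _ ((iV_comp v).trans ?_)
  rw [h, iC_jC]

/-- The double translation of a value is its image under the inverse of `ι`. -/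
def DVal (R : CType) [ResultType R] (d : Deriv Γ none t A) : Prop :=
  dval d (jS R Γ) = jV A (Q.mk t ⟨d⟩)
/-- The double translation of a computation is its image under the inverse of `ι`. -/
def DComp (R : CType) [ResultType R] (d : Deriv Γ Δ t (.comp C)) : Prop :=
  dcomp d (jS R Γ) (jInp R Δ) = jC C (Q.mk t ⟨d⟩)

theorem DVal.comp {d : Deriv Γ none t (.comp C)} (h : DVal R d) : DComp R d :=
  (congrArg (Q.lapp (C := cpsC R R) (D := cpsC R (cpsC R C)) · topc) h).trans (lapp_jV_comp _)

theorem DComp.val {d : Deriv Γ none t (.comp C)} (h : DComp R d) : DVal R d :=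
  jV_comp_of_lapp _ _ h

/-- The double translation is the image under the inverse of `ι`. -/
def DInv (R : CType) [ResultType R] (d : Deriv Γ Δ t A) : Prop :=
  (∀ h : Δ = none, DVal R (h ▸ d)) ∧ ∀ (C : CType) (h : A = .comp C), DComp R (h ▸ d)

theorem DInv.val {d : Deriv Γ none t A} (h : DInv R d) : DVal R d := h.1 rfl
theorem DInv.comp {d : Deriv Γ Δ t (.comp C)} (h : DInv R d) : DComp R d := h.2 _ rfl
theorem DVal.inv {d : Deriv Γ none t A} (h : DVal R d) : DInv R d :=
  ⟨fun _ => h, by rintro C rfl; exact h.comp⟩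
theorem DComp.inv {d : Deriv Γ Δ t (.comp C)} (h : DComp R d) : DInv R d := by
  refine ⟨?_, ?_⟩
  · rintro rfl; exact h.val
  · rintro C h'; cases h'; exact h

end

section
variable {R : CType} [ResultType R] {Γ G G' : List VType} {Δ Δ' : Option CType} {t s u : Tm}
  {A B : VType} {C D X : CType}

theorem dcomp_lift_up (d : Deriv (A :: Γ) Δ t (.comp C)) (h : DComp R d) :
    dcomp d ((jS R Γ).lift (cpsV R (cpsV R A))) (jInp R Δ) =
      .sub (iSub R Γ A) (jC C (Q.mk t ⟨d⟩)) := by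
  rw [← h, ← jS_comp_iSub]
  exact ((sub_dcomp d _ _ _).trans (congrArg _ (sub_jInp _ Δ))).symm

theorem dval_lift_up (d : Deriv (A :: Γ) none t B) (h : DVal R d) :
    dval d ((jS R Γ).lift (cpsV R (cpsV R A))) = .sub (iSub R Γ A) (jV B (Q.mk t ⟨d⟩)) := by
  rw [← h, ← jS_comp_iSub]
  exact (sub_dval d _ _).symm

theorem sub_jSub_iSub (q : Q (A :: Γ) Δ B) : Q.sub (jSub R Γ A) (.sub (iSub R Γ A) q) = q := by
  rw [Q.sub_sub, iSub_comp_jSub, Q.sub_id]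

/-- Running a doubly translated computation on the image of a stoup variable. -/
theorem ss_jInp_dcomp_some (d : Deriv Γ (some D) t (.comp C)) (h : DComp R d) :
    Q.ss (jC D .svar) (dcomp (Δ := some D) d (jS R Γ) .svar) = jC C (Q.mk t ⟨d⟩) :=
  (ss_dcomp (Δ := some D) d _ _ _).trans ((congrArg _ (Q.ss_svar _)).trans h)

theorem dInv (d : Deriv Γ Δ t A) : DInv R d := by
  induction d with
  | var Γ n A h => exact DVal.inv ((dval_var n h _).trans (jS_var Γ n A h))
  | svar Γ C => exact DComp.inv (dcomp_svar ..)
  | unit Γ => exact DVal.inv ((Q.unit_eta _).trans (Q.unit_eta _).symm)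
  | vpair Γ t u A B d e hd he =>
    exact DVal.inv ((dval_vpair ..).trans
      ((congrArg₂ Q.vpair hd.val he.val).trans (jV_vpair (Q.mk t ⟨d⟩) (Q.mk u ⟨e⟩)).symm))
  | vfst Γ t A B d hd =>
    exact DVal.inv ((dval_vfst ..).trans
      ((congrArg Q.vfst hd.val).trans (jV_vfst (Q.mk t ⟨d⟩)).symm))
  | vsnd Γ t A B d hd =>
    exact DVal.inv ((dval_vsnd ..).trans
      ((congrArg Q.vsnd hd.val).trans (jV_vsnd (Q.mk t ⟨d⟩)).symm))
  | vlam Γ t A B d hd =>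
    exact DVal.inv ((dval_vlam ..).trans
      ((congrArg Q.vlam (dval_lift_up d hd.val)).trans (jV_vlam (Q.mk t ⟨d⟩)).symm))
  | vapp Γ s t A B d e hd he =>
    exact DVal.inv ((dval_vapp ..).trans
      ((congrArg₂ Q.vapp hd.val he.val).trans (jV_vapp (Q.mk s ⟨d⟩) (Q.mk t ⟨e⟩)).symm))
  | cunit Γ Δ => exact DComp.inv ((Q.cunit_eta _).trans (Q.cunit_eta _).symm)
  | cpair Γ Δ t u C D d e hd he =>
    exact DComp.inv ((dcomp_cpair ..).trans
      ((congrArg₂ Q.cpair hd.comp he.comp).trans (jC_cpair (Q.mk t ⟨d⟩) (Q.mk u ⟨e⟩)).symm))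
  | cfst Γ Δ t C D d hd =>
    exact DComp.inv ((dcomp_cfst ..).trans
      ((congrArg Q.cfst hd.comp).trans (jC_cfst (Q.mk t ⟨d⟩)).symm))
  | csnd Γ Δ t C D d hd =>
    exact DComp.inv ((dcomp_csnd ..).trans
      ((congrArg Q.csnd hd.comp).trans (jC_csnd (Q.mk t ⟨d⟩)).symm))
  | clam Γ Δ t A C d hd =>
    refine DComp.inv ((dcomp_clam d _ _).trans
      ((congrArg Q.clam ?_).trans (jC_clam (Q.mk t ⟨d⟩)).symm))
    exact (congrArg _ (sub_jInp _ Δ)).trans (dcomp_lift_up d hd.comp)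
  | capp Γ Δ s t A C d e hd he =>
    exact DComp.inv ((dcomp_capp ..).trans
      ((congrArg₂ Q.capp hd.comp he.val).trans (jC_capp (Q.mk s ⟨d⟩) (Q.mk t ⟨e⟩)).symm))
  | top Γ => exact DComp.inv ((dcomp_top ..).trans jC_top.symm)
  | ilet Γ Δ t u C d e hd he =>
    refine DComp.inv ((dcomp_ilet ..).trans ?_)
    refine Eq.trans ?_ (jC_ilet (Q.mk t ⟨d⟩) (Q.mk u ⟨e⟩)).symm
    refine Eq.trans (congrArg (dcomp (Δ := none) e (jS R Γ)) hd.comp) ?_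
    refine Eq.trans (congrArg (dcomp (Δ := none) e (jS R Γ)) (Q.ss_svar (C := cpsC R R) _).symm) ?_
    refine (ss_dcomp (Δ := none) (X := cpsC R R) e _ _ _).symm.trans ?_
    refine (ss_jC_iunit _ _).trans (congrArg _ ?_)
    exact (ss_dcomp (Δ := none) (X := cpsC R R) e _ _ _).trans
      ((congrArg _ (Q.ss_svar (C := cpsC R R) _)).trans he.comp)
  | bang Γ t A d hd =>
    exact DComp.inv ((dcomp_bang ..).trans
      ((congrArg (Q.copow · _) hd.val).trans (jC_bang' (Q.mk t ⟨d⟩)).symm))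
  | banglet Γ Δ t u A C d e hd he =>
    refine DComp.inv ((dcomp_banglet ..).trans ?_)
    refine Eq.trans ?_ (jC_banglet (Q.mk t ⟨d⟩) (Q.mk u ⟨e⟩)).symm
    refine Eq.trans (congrArg (Q.copowlet · _) hd.comp) ?_
    refine (copowlet_jC_bang _ _).trans (congrArg _ ?_)
    refine Eq.trans (congrArg _ ?_) (sub_jSub_iSub (R := R) _)
    exact (ss_dcomp (Δ := none) (X := cpsC R R) e _ _ _).trans
      ((congrArg _ (Q.ss_svar (C := cpsC R R) _)).trans (dcomp_lift_up e he.comp))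
  | copow Γ Δ t u A C e d he hd =>
    exact DComp.inv ((dcomp_copow ..).trans
      ((congrArg₂ Q.copow he.val hd.comp).trans (jC_copow' (Q.mk t ⟨e⟩) (Q.mk u ⟨d⟩)).symm))
  | copowlet Γ Δ s t A D C d e hd he =>
    refine DComp.inv ((dcomp_copowlet ..).trans ?_)
    refine Eq.trans ?_ (jC_copowlet (Q.mk s ⟨d⟩) (Q.mk t ⟨e⟩)).symm
    refine Eq.trans (congrArg (Q.copowlet · _) hd.comp) ?_
    refine (copowlet_jC_copow _ _).trans (congrArg _ ?_)
    refine Eq.trans (congrArg _ ?_) (sub_jSub_iSub (R := R) _)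
    exact (ss_dcomp (Δ := some D) e _ _ _).trans
      ((congrArg _ (Q.ss_svar _)).trans (dcomp_lift_up e he.comp))
  | cimage Γ Δ t C d hd =>
    refine DComp.inv ((dcomp_cimage d _ _).trans ?_)
    refine Eq.trans ?_ (jC_cimage (Q.mk t ⟨d⟩)).symm
    exact congrArg Q.cimage (hd.comp.trans (jC_czero _))
  | cinl Γ Δ t C D d hd =>
    exact DComp.inv ((dcomp_cinl ..).trans
      ((congrArg Q.cinl hd.comp).trans (jC_cinl (Q.mk t ⟨d⟩)).symm))
  | cinr Γ Δ t C D d hd =>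
    exact DComp.inv ((dcomp_cinr ..).trans
      ((congrArg Q.cinr hd.comp).trans (jC_cinr (Q.mk t ⟨d⟩)).symm))
  | ccase Γ Δ s t u C D X d e f hd he hf =>
    refine DComp.inv ((dcomp_ccase ..).trans ?_)
    refine Eq.trans ?_ (jC_ccase (Q.mk s ⟨d⟩) (Q.mk t ⟨e⟩) (Q.mk u ⟨f⟩)).symm
    refine Eq.trans (congrArg (Q.ccase · _ _) hd.comp) ?_
    refine (ccase_jC_csum _ _ _).trans ?_
    rw [ss_jInp_dcomp_some e he.comp, ss_jInp_dcomp_some f hf.comp]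
  | llam Γ t C D d hd =>
    refine DVal.inv ((dval_llam d _).trans ?_)
    refine Eq.trans (congrArg Q.llam ?_) (jV_llam (Q.mk t ⟨d⟩)).symm
    refine Eq.trans ?_ (congrArg _ (ss_jInp_dcomp_some d hd.comp) |>.trans (ss_jC _ _))
    refine Eq.trans ?_ (Q.ss_ss _ _ _).symm
    have key : Q.ss (iC (R := R) C (Q.svar (Γ := Γ))) (jC C .svar) = .svar := by
      rw [← jC_eq_ss, jC_iC]
    exact ((congrArg (Q.ss · (dcomp (Δ := some C) d (jS R Γ) .svar)) key).trans (Q.svar_ss _)).symm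
  | lapp Γ Δ s t C D e d he hd =>
    exact DComp.inv ((dcomp_lapp ..).trans
      ((congrArg₂ Q.lapp he.val hd.comp).trans (jC_lapp (Q.mk s ⟨e⟩) (Q.mk t ⟨d⟩)).symm))

theorem rep_jS (Γ : List VType) : (jS R Γ).Rep (fun n => match Γ[n]? with
    | some C => .vapp (iotaVinv R C) (.var n)
    | none => .var n) := by
  intro n A h
  obtain ⟨B, hB, rfl⟩ : ∃ B, Γ[n]? = some B ∧ A = cpsV R (cpsV R B) := by
    have h' : ((Γ.map (cpsV R)).map (cpsV R))[n]? = some A := h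
    rw [List.map_map, List.getElem?_map, Option.map_eq_some_iff] at h'
    obtain ⟨B, hB, e⟩ := h'
    exact ⟨B, hB, e.symm⟩
  simp only [hB]
  exact ⟨(iotaVinv_ty R B Γ).vapp ⟨.var _ _ _ hB⟩, jS_var Γ n B hB⟩
end

/-- **Involution property of the self-translation (value-term part)**
(Theorem 5.4(1)): suppose `R̲` is either a computation-type constant or the
type `I̲`.  If `Γ ⊢ t : A` is derivable in EEC, then
`Γ ⊢ t = ι_A((tᶜ)ᶜ)[ι⁻¹(Γ)] : A` in the equational theory of EEC, where
`[ι⁻¹(Γ)]` replaces each variable `xᵢ:Cᵢ` of `Γ` by `ι_{Cᵢ}⁻¹(xᵢ)`. -/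
theorem cps_involution_value (R : CType)
    (hR : (∃ a : ℕ, R = CType.base a) ∨ R = CType.iunit)
    (Γ : List VType) (t : Tm) (A : VType)
    (dt : Deriv Γ none t A)
    (dtt : Deriv (cpsCtx R Γ) none (cps R dt) (cpsV R A)) :
    EEq Γ none t (iotaSubst R Γ (.vapp (iotaV R A) (cps R dtt))) A := by
  have : ResultType R := ⟨hR⟩
  have inv : dval dt (jS R Γ) = jV A (Q.mk t ⟨dt⟩) := (dInv dt).val
  have ty : HasTy (cpsCtx R (cpsCtx R Γ)) none (cps R dtt) (cpsV R (cpsV R A)) := cps_ty R dtt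
  have dval_eq : dval dt (jS R Γ) = Q.sub (jS R Γ) (Q.mk (cps R dtt) ty) :=
    dval_of_eq dt dtt rfl _
  rw [Q.sub_mk (rep_jS (R := R) Γ)] at dval_eq
  refine Q.exact (h := ⟨dt⟩) (h' := ?_) ?_
  · rw [iotaSubst, Tm.psubst, iotaV_closed]
    exact (iotaV_ty R A Γ).vapp (ty.psubst (rep_jS (R := R) Γ).ty)
  · rw [← iV_jV (R := R) A (Q.mk t ⟨dt⟩), ← inv, dval_eq]
    exact Q.mk_congr (congrArg (Tm.vapp · _) (iotaV_closed R A _).symm)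

end EEC
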